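/- Suppose rank L = d+1 and u ∈ ℂ^{n+1} is generic. Then the intersection 𝕃_u ∩ ℛ_L consists of finitely many points, and for every flat I of the matroid M(L): (i) if rank(A_I^⊤) = rank(L_I), then 𝕃_u ∩ ℛ_{L_I}^∘ = ∅; (ii) if rank(A_I^⊤) = rank(L_I) − 1, then the set-theoretic intersection 𝕃_u ∩ ℛ_{L_I}^∘ consists of exactly (−1)^{rank(A_I^⊤)} · χ(X_I) points, where X_I = (ℂ^d ∖ 𝒜_I)/K_I, 𝒜_I = V(Π_{i∈I} ℓ_i(x)) and K_I ⊂ ℂ^d is the left kernel of A_I^⊤. -/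

import Mathlib

open scoped BigOperators
noncomputable section

namespace ScatteringPaper

open CategoryTheory AlgebraicTopology

/- ## Topological Euler characteristic via rational singular homology -/

/-- The singular chain complex of a topological space, with rational coefficients. -/
def singularChainComplex (X : Type) [TopologicalSpace X] : ChainComplex (ModuleCat ℚ) ℕ :=
  (alternatingFaceMapComplex (ModuleCat ℚ)).obj
    (((SimplicialObject.whiskering _ _).obj (ModuleCat.free ℚ)).obj (TopCat.toSSet.obj (TopCat.of X)))

/-- The `q`-th (rational) Betti number of a topological space. -/
def betti (X : Type) [TopologicalSpace X] (q : ℕ) : ℕ :=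
  Module.finrank ℚ ((singularChainComplex X).homology q)

/-- The topological Euler characteristic, as the alternating sum of Betti numbers. -/
def eulerChar (X : Type) [TopologicalSpace X] : ℤ :=
  ∑ᶠ q : ℕ, (-1 : ℤ) ^ q * (betti X q : ℤ)

variable {d : ℕ} {ι : Type} [Fintype ι] [DecidableEq ι]

/- ## Hyperplane arrangements: `(ℓ_i(x))_i = (1, x_1, …, x_d) · L` -/

/-- Value of the affine-linear form encoded by column `i` of `L`. -/
def ell (K : Type) [Field K] (L : Matrix (Fin (d+1)) ι K) (x : Fin d → K) (i : ι) : K :=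
  L 0 i + ∑ j : Fin d, x j * L j.succ i

/-- The complement `X = ℂ^d ∖ 𝒜` of the arrangement `𝒜 = V(∏ ℓ_i)`. -/
def complementX (L : Matrix (Fin (d+1)) ι ℂ) : Set (Fin d → ℂ) := {x | ∀ i, ell ℂ L x i ≠ 0}

/-- `x ∈ X` is a solution of the scattering equations
`∂ℒ_u/∂x_k = ∑_i u_i a_{ki}/ℓ_i(x) = 0`, `k = 1, …, d`. -/
def IsSol (L : Matrix (Fin (d+1)) ι ℂ) (u : ι → ℂ) (x : Fin d → ℂ) : Prop :=
  x ∈ complementX L ∧ ∀ k : Fin d, ∑ i : ι, u i * L k.succ i / ell ℂ L x i = 0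

/-- An arrangement is essential if some subset of its hyperplanes meets in a single point. -/
def IsEssential (L : Matrix (Fin (d+1)) ι ℂ) : Prop :=
  ∃ (S : Set ι) (x₀ : Fin d → ℂ), {x : Fin d → ℂ | ∀ i ∈ S, ell ℂ L x i = 0} = {x₀}

/-- `P u` holds for all `u` outside a proper algebraic subset (i.e. for generic `u`). -/
def Generically {σ : Type} [Fintype σ] [DecidableEq σ] (P : (σ → ℂ) → Prop) : Prop :=
  ∃ g : MvPolynomial σ ℂ, g ≠ 0 ∧ ∀ u : σ → ℂ, MvPolynomial.eval u g ≠ 0 → P u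

/- ## Matroid data of the columns of `L` -/

/-- Rank of the set `I` of columns of `L` (the matroid rank in `M(L)`). -/
def rkL (K : Type) [Field K] (L : Matrix (Fin (d+1)) ι K) (I : Set ι) : ℕ :=
  Module.finrank K (Submodule.span K ((fun i => fun r => L r i) '' I))

/-- Rank of the set `I` of columns of `A^⊤` (`L` with its first row deleted). -/
def rkA (K : Type) [Field K] (L : Matrix (Fin (d+1)) ι K) (I : Set ι) : ℕ :=
  Module.finrank K (Submodule.span K ((fun i => fun k : Fin d => L k.succ i) '' I))

/-- `I` is a flat of the matroid `M(L)`. -/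
def IsFlat (K : Type) [Field K] (L : Matrix (Fin (d+1)) ι K) (I : Set ι) : Prop :=
  ∀ i ∉ I, rkL K L I < rkL K L (insert i I)

/-- `C` is a circuit of `M(L)`: a minimal linearly dependent set of columns. -/
def IsCircuit (K : Type) [Field K] (L : Matrix (Fin (d+1)) ι K) (C : Finset ι) : Prop :=
  (¬ LinearIndependent K (fun i : {a // a ∈ C} => fun r => L r i.1)) ∧
  ∀ D : Finset ι, D ⊂ C → LinearIndependent K (fun i : {a // a ∈ D} => fun r => L r i.1)

/-- `M(L)` is connected: there is no separation into two nonempty parts with additive rank. -/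
def MatroidConnected (K : Type) [Field K] (L : Matrix (Fin (d+1)) ι K) : Prop :=
  ∀ S : Set ι, S.Nonempty → Sᶜ.Nonempty → rkL K L S + rkL K L Sᶜ ≠ rkL K L Set.univ

/- ## The reciprocal linear space -/

/-- Zariski closure of a subset of affine space `K^ι`. -/
def zarClosure (K : Type) [Field K] (S : Set (ι → K)) : Set (ι → K) :=
  {v | ∀ f : MvPolynomial ι K, (∀ w ∈ S, MvPolynomial.eval w f = 0) → MvPolynomial.eval v f = 0}

/-- The affine cone over the image of `φ : x ↦ (ℓ_0(x)⁻¹ : ⋯ : ℓ_n(x)⁻¹)`. -/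
def coneImage (L : Matrix (Fin (d+1)) ι ℂ) : Set (ι → ℂ) :=
  {v | ∃ (c : ℂ) (x : Fin d → ℂ), x ∈ complementX L ∧ v = fun i => c / ell ℂ L x i}

/-- The vanishing ideal of a subset of affine space. -/
def vanishingIdeal (K : Type) [Field K] (S : Set (ι → K)) : Ideal (MvPolynomial ι K) where
  carrier := {f | ∀ v ∈ S, MvPolynomial.eval v f = 0}
  add_mem' := by
    intro a b ha hb v hv
    simp [map_add, ha v hv, hb v hv]
  zero_mem' := by intro v hv; simp
  smul_mem' := by
    intro c f hf v hv
    simp [smul_eq_mul, map_mul, hf v hv]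

/-- Projective space `ℙ^n = ℙ(ℂ^ι)`. -/
abbrev Pn (ι : Type) [Fintype ι] := Projectivization ℂ (ι → ℂ)

/-- The reciprocal linear space `ℛ_L ⊂ ℙ^n`, the Zariski closure of `im φ`. -/
def RL (L : Matrix (Fin (d+1)) ι ℂ) : Set (Pn ι) :=
  {p | p.rep ∈ zarClosure ℂ (coneImage L)}

/-- The linear space `𝕃_u = {y : A^⊤ diag(u) y = 0} ⊂ ℙ^n`. -/
def LuSet (L : Matrix (Fin (d+1)) ι ℂ) (u : ι → ℂ) : Set (Pn ι) :=
  {p | ∀ k : Fin d, ∑ i : ι, L k.succ i * u i * p.rep i = 0}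

/-- The torus orbit `U_I = {y ∈ ℙ^n : y_i ≠ 0 ⇔ i ∈ I}`. -/
def Ustratum (I : Set ι) : Set (Pn ι) := {p : Pn ι | ∀ i : ι, p.rep i ≠ 0 ↔ i ∈ I}

/-- `p = φ(x)` for the map `φ : x ↦ (ℓ_0(x)⁻¹ : ⋯ : ℓ_n(x)⁻¹)`. -/
def PhiRel (L : Matrix (Fin (d+1)) ι ℂ) (x : Fin d → ℂ) (p : Pn ι) : Prop :=
  ∃ hv : (fun i => (ell ℂ L x i)⁻¹) ≠ 0, p = Projectivization.mk ℂ (fun i => (ell ℂ L x i)⁻¹) hv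

/-- The image of `φ` in `ℙ^n`. -/
def imPhi (L : Matrix (Fin (d+1)) ι ℂ) : Set (Pn ι) :=
  {p | ∃ x ∈ complementX L, PhiRel L x p}

/-- Complement of the subarrangement `𝒜_I`. -/
def subComplement (L : Matrix (Fin (d+1)) ι ℂ) (I : Set ι) : Set (Fin d → ℂ) :=
  {x | ∀ i ∈ I, ell ℂ L x i ≠ 0}

/-- The affine cone over the image of the reciprocal map of the subarrangement indexed by `I`,
embedded in the coordinate subspace `{y_i = 0, i ∉ I}`. -/
def coneImageSub (L : Matrix (Fin (d+1)) ι ℂ) (I : Set ι) : Set (ι → ℂ) :=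
  {v | ∃ (c : ℂ) (x : Fin d → ℂ), x ∈ subComplement L I ∧
      v = I.indicator (fun i => c / ell ℂ L x i)}

/-- The reciprocal linear space `ℛ_{L_I}` of the submatrix `L_I`, embedded in `ℙ^n`. -/
def RLsub (L : Matrix (Fin (d+1)) ι ℂ) (I : Set ι) : Set (Pn ι) :=
  {p | p.rep ∈ zarClosure ℂ (coneImageSub L I)}

/-- The open stratum `ℛ_{L_I}^∘ = ℛ_{L_I} ∩ U_I`. -/
def RLsubOpen (L : Matrix (Fin (d+1)) ι ℂ) (I : Set ι) : Set (Pn ι) :=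
  RLsub L I ∩ Ustratum I

/- ## The very affine variety `X_I = (ℂ^d ∖ 𝒜_I)/K_I` -/

/-- Quotient of `ℂ^d ∖ 𝒜_I` by translation by the left kernel `K_I` of `A_I^⊤`:
two points are identified iff `A_I^⊤` takes the same values on them. -/
def XIsetoid (L : Matrix (Fin (d+1)) ι ℂ) (I : Set ι) : Setoid ↥(subComplement L I) where
  r x y := ∀ i ∈ I, ∑ k : Fin d, (x : Fin d → ℂ) k * L k.succ i
      = ∑ k : Fin d, (y : Fin d → ℂ) k * L k.succ i
  iseqv := ⟨fun _ _ _ => rfl, fun h i hi => (h i hi).symm, fun h1 h2 i hi => (h1 i hi).trans (h2 i hi)⟩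

/-- The very affine variety `X_I = (ℂ^d ∖ 𝒜_I)/K_I`. -/
def XI (L : Matrix (Fin (d+1)) ι ℂ) (I : Set ι) : Type := Quotient (XIsetoid L I)

instance (L : Matrix (Fin (d+1)) ι ℂ) (I : Set ι) : TopologicalSpace (XI L I) :=
  instTopologicalSpaceQuotient

/-- The complement of the arrangement, over a general field `K`. -/
def complementK (K : Type) [Field K] (L : Matrix (Fin (d+1)) ι K) : Set (Fin d → K) :=
  {x | ∀ i, ell K L x i ≠ 0}

/-- The affine cone over the image of the reciprocal map, over a general field `K`. -/
def coneImageK (K : Type) [Field K] (L : Matrix (Fin (d+1)) ι K) : Set (ι → K) :=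
  {v | ∃ (c : K) (x : Fin d → K), x ∈ complementK K L ∧ v = fun i => c / ell K L x i}

/- ## Hilbert functions, degree, Hilbert regularity -/

/-- The Hilbert function of the graded algebra `K[y]/I`:
`q ↦ dim_K (K[y]/I)_q`. -/
def hilb (K : Type) [Field K] (I : Ideal (MvPolynomial ι K)) (q : ℕ) : ℕ :=
  Module.finrank K ((MvPolynomial.homogeneousSubmodule ι K q).map
    (Ideal.Quotient.mkₐ K I).toLinearMap)

/-- `k` is the degree of the `d`-dimensional projective variety with homogeneous
coordinate ring `K[y]/I`: the Hilbert polynomial has degree `d` and leading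
coefficient `k/d!`. -/
def IsProjDegree (K : Type) [Field K] (I : Ideal (MvPolynomial ι K)) (d k : ℕ) : Prop :=
  ∃ P : Polynomial ℚ, (∃ N : ℕ, ∀ q : ℕ, N ≤ q → Polynomial.eval (q : ℚ) P = hilb K I q) ∧
    P.degree = (d : WithBot ℕ) ∧ P.leadingCoeff = (k : ℚ) / (Nat.factorial d : ℚ)

/-- The Hilbert function, extended by `0` to negative integers. -/
def HFZ (K : Type) [Field K] (I : Ideal (MvPolynomial ι K)) (q : ℤ) : ℕ :=
  if 0 ≤ q then hilb K I q.toNat else 0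

/-- The Hilbert regularity: the smallest degree from which the Hilbert function
agrees with a (necessarily unique) polynomial. -/
def HReg (K : Type) [Field K] (I : Ideal (MvPolynomial ι K)) : ℤ :=
  sInf {i : ℤ | ∃ P : Polynomial ℚ, ∀ q : ℤ, i ≤ q → Polynomial.eval (q : ℚ) P = HFZ K I q}

section
open CategoryTheory AlgebraicTopology

/- ## Homological algebra -/

lemma finite_of_exact_pair {A B C : Type} [AddCommGroup A] [AddCommGroup B] [AddCommGroup C]
    [Module ℚ A] [Module ℚ B] [Module ℚ C] (f : A →ₗ[ℚ] B) (g : B →ₗ[ℚ] C)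
    (h : LinearMap.range f = LinearMap.ker g) [Module.Finite ℚ A] [Module.Finite ℚ C] :
    Module.Finite ℚ B := by
  have h1 : Module.Finite ℚ (LinearMap.ker g) := by
    rw [← h]; infer_instance
  have h2 : Module.Finite ℚ (B ⧸ LinearMap.ker g) :=
    Module.Finite.equiv g.quotKerEquivRange.symm
  exact Module.Finite.of_submodule_quotient (LinearMap.ker g)

lemma finrank_exact_pair {A B C : Type} [AddCommGroup A] [AddCommGroup B] [AddCommGroup C]
    [Module ℚ A] [Module ℚ B] [Module ℚ C] (f : A →ₗ[ℚ] B) (g : B →ₗ[ℚ] C)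
    (h : LinearMap.range f = LinearMap.ker g) [Module.Finite ℚ B] :
    Module.finrank ℚ B = Module.finrank ℚ (LinearMap.range f)
      + Module.finrank ℚ (LinearMap.range g) := by
  rw [h, ← LinearMap.finrank_range_add_finrank_ker g, add_comm]

/-- Finite total homology of a graded vector space. -/
def GFin (M : ℕ → ModuleCat.{0} ℚ) : Prop :=
  (∀ n, Module.Finite ℚ (M n)) ∧ ∃ N, ∀ n, N ≤ n → Module.finrank ℚ (M n) = 0

/-- graded Euler characteristic -/
def gchi (M : ℕ → ModuleCat.{0} ℚ) : ℤ := ∑ᶠ n : ℕ, (-1 : ℤ) ^ n * (Module.finrank ℚ (M n) : ℤ)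

lemma gchi_eq (M : ℕ → ModuleCat.{0} ℚ) (N : ℕ) (h : ∀ n, N ≤ n → Module.finrank ℚ (M n) = 0) :
    gchi M = ∑ n ∈ Finset.range N, (-1 : ℤ) ^ n * (Module.finrank ℚ (M n) : ℤ) := by
  unfold gchi
  apply finsum_eq_sum_of_support_subset
  intro n hn
  by_contra hc
  apply hn
  simp only [Finset.coe_range, Set.mem_Iio, not_lt] at hc
  simp [h n hc]

/-- A long exact sequence. -/
structure LES (A B C : ℕ → ModuleCat.{0} ℚ) where
  f : ∀ n, A n →ₗ[ℚ] B n
  g : ∀ n, B n →ₗ[ℚ] C n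
  δ : ∀ n, C (n+1) →ₗ[ℚ] A n
  exB : ∀ n, LinearMap.range (f n) = LinearMap.ker (g n)
  exC : ∀ n, LinearMap.range (g (n+1)) = LinearMap.ker (δ n)
  exA : ∀ n, LinearMap.range (δ n) = LinearMap.ker (f n)
  exC0 : LinearMap.range (g 0) = ⊤

variable {A B C : ℕ → ModuleCat.{0} ℚ}

lemma LES.finB (E : LES A B C) (hA : ∀ n, Module.Finite ℚ (A n)) (hC : ∀ n, Module.Finite ℚ (C n))
    (n : ℕ) : Module.Finite ℚ (B n) := by
  have := hA n; have := hC n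
  exact finite_of_exact_pair (E.f n) (E.g n) (E.exB n)

lemma LES.finA (E : LES A B C) (hB : ∀ n, Module.Finite ℚ (B n)) (hC : ∀ n, Module.Finite ℚ (C n))
    (n : ℕ) : Module.Finite ℚ (A n) := by
  have := hB n; have := hC (n+1)
  exact finite_of_exact_pair (E.δ n) (E.f n) (E.exA n)

lemma LES.finC (E : LES A B C) (hA : ∀ n, Module.Finite ℚ (A n)) (hB : ∀ n, Module.Finite ℚ (B n))
    (n : ℕ) : Module.Finite ℚ (C n) := by
  cases n with
  | zero =>
    have := hB 0
    exact Module.Finite.of_surjective (E.g 0) (LinearMap.range_eq_top.mp E.exC0)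
  | succ n =>
    have := hA n; have := hB (n+1)
    exact finite_of_exact_pair (E.g (n+1)) (E.δ n) (E.exC n)

lemma LES.chi (E : LES A B C) (hA : ∀ n, Module.Finite ℚ (A n)) (hB : ∀ n, Module.Finite ℚ (B n))
    (hC : ∀ n, Module.Finite ℚ (C n)) (N : ℕ) :
    ∑ n ∈ Finset.range N, (-1 : ℤ) ^ n * (Module.finrank ℚ (B n) : ℤ)
     = ∑ n ∈ Finset.range N, (-1 : ℤ) ^ n * (Module.finrank ℚ (A n) : ℤ)
     + ∑ n ∈ Finset.range N, (-1 : ℤ) ^ n * (Module.finrank ℚ (C n) : ℤ)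
     + (-1) ^ N * (Module.finrank ℚ (C N) - Module.finrank ℚ (LinearMap.range (E.g N)) : ℤ) := by
  induction N with
  | zero => 
    rw [E.exC0]; simp
  | succ N ih =>
    rw [Finset.sum_range_succ, Finset.sum_range_succ, Finset.sum_range_succ, ih]
    have := hA N; have := hB N; have := hC N; have := hC (N+1)
    have e1 := finrank_exact_pair _ _ (E.exB N)
    have e2 := finrank_exact_pair _ _ (E.exA N)
    have e3 := finrank_exact_pair _ _ (E.exC N)
    rw [e1, e2, e3, pow_succ]; push_cast; ring

lemma finrank_zero_of_exact {A B C : Type} [AddCommGroup A] [AddCommGroup B] [AddCommGroup C]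
    [Module ℚ A] [Module ℚ B] [Module ℚ C] (f : A →ₗ[ℚ] B) (g : B →ₗ[ℚ] C)
    (h : LinearMap.range f = LinearMap.ker g) [Module.Finite ℚ A] [Module.Finite ℚ C]
    (hA : Module.finrank ℚ A = 0) (hC : Module.finrank ℚ C = 0) : Module.finrank ℚ B = 0 := by
  have := finite_of_exact_pair f g h
  rw [finrank_exact_pair f g h]
  have h1 := LinearMap.finrank_range_le f
  have h2 := Submodule.finrank_le (LinearMap.range g)
  omega

lemma LES.chi' (E : LES A B C) (hA : GFin A) (hB : GFin B) (hC : GFin C) :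
    gchi B = gchi A + gchi C := by
  obtain ⟨fA, NA, hA⟩ := hA
  obtain ⟨fB, NB, hB⟩ := hB
  obtain ⟨fC, NC, hC⟩ := hC
  set N := max NA (max NB NC) with hN
  rw [gchi_eq A N (fun n hn => hA n (by omega)), gchi_eq B N (fun n hn => hB n (by omega)),
    gchi_eq C N (fun n hn => hC n (by omega)), E.chi fA fB fC N, hC N (by omega)]
  have := fC N
  have h2 := Submodule.finrank_le (LinearMap.range (E.g N))
  have h3 := hC N (by omega)
  have : Module.finrank ℚ (LinearMap.range (E.g N)) = 0 := by omega
  simp [this]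

lemma LES.gfinB (E : LES A B C) (hA : GFin A) (hC : GFin C) : GFin B := by
  obtain ⟨fA, NA, hA⟩ := hA
  obtain ⟨fC, NC, hC⟩ := hC
  refine ⟨E.finB fA fC, max NA NC, fun n hn => ?_⟩
  have := fA n; have := fC n
  exact finrank_zero_of_exact _ _ (E.exB n) (hA n (by omega)) (hC n (by omega))

lemma LES.gfinA (E : LES A B C) (hB : GFin B) (hC : GFin C) : GFin A := by
  obtain ⟨fA, NA, hA⟩ := hB
  obtain ⟨fC, NC, hC⟩ := hC
  refine ⟨E.finA fA fC, max NA NC, fun n hn => ?_⟩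
  have := fA n; have := fC (n+1)
  exact finrank_zero_of_exact _ _ (E.exA n) (hC (n+1) (by omega)) (hA n (by omega))

lemma LES.gfinC (E : LES A B C) (hA : GFin A) (hB : GFin B) : GFin C := by
  obtain ⟨fA, NA, hA⟩ := hA
  obtain ⟨fB, NB, hB⟩ := hB
  refine ⟨E.finC fA fB, max NA NB + 1, fun n hn => ?_⟩
  obtain ⟨n, rfl⟩ : ∃ m, n = m + 1 := ⟨n - 1, by omega⟩
  have := fA n; have := fB (n+1)
  exact finrank_zero_of_exact _ _ (E.exC n) (hB (n+1) (by omega)) (hA n (by omega))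

/-- The long exact homology sequence of a short exact sequence of complexes. -/
def lesOfShortExact (S : ShortComplex (ChainComplex (ModuleCat.{0} ℚ) ℕ)) (hS : S.ShortExact) :
    LES (fun n => S.X₁.homology n) (fun n => S.X₂.homology n) (fun n => S.X₃.homology n) where
  f n := (HomologicalComplex.homologyMap S.f n).hom
  g n := (HomologicalComplex.homologyMap S.g n).hom
  δ n := (hS.δ (n+1) n (by simp)).hom
  exB n := (hS.homology_exact₂ n).moduleCat_range_eq_ker
  exC n := (hS.homology_exact₃ (n+1) n (by simp)).moduleCat_range_eq_ker
  exA n := (hS.homology_exact₁ (n+1) n (by simp)).moduleCat_range_eq_ker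
  exC0 := by
    have := hS.epi_g
    have : Epi (HomologicalComplex.homologyMap S.g 0) :=
      HomologicalComplex.epi_homologyMap_of_epi_of_not_rel S.g 0 (by simp)
    rw [LinearMap.range_eq_top]
    exact (ModuleCat.epi_iff_surjective _).1 this

/-- A concrete chain complex of rational vector spaces. -/
structure CC where
  X : ℕ → Type
  [ag : ∀ n, AddCommGroup (X n)]
  [md : ∀ n, Module ℚ (X n)]
  d : ∀ n, X (n+1) →ₗ[ℚ] X n
  dd : ∀ n x, d n (d (n+1) x) = 0

attribute [instance] CC.ag CC.md

/-- The categorical chain complex of a concrete one. -/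
def CC.ch (K : CC) : ChainComplex (ModuleCat.{0} ℚ) ℕ :=
  ChainComplex.of (fun n => ModuleCat.of ℚ (K.X n)) (fun n => ModuleCat.ofHom (K.d n))
    (fun n => by ext x; exact K.dd n x)

lemma CC.ch_d (K : CC) (n : ℕ) : K.ch.d (n+1) n = ModuleCat.ofHom (K.d n) := by
  exact ChainComplex.of_d (fun n => ModuleCat.of ℚ (K.X n)) (fun n => ModuleCat.ofHom (K.d n)) n

/-- finite total homology -/
def CC.Fin (K : CC) : Prop := GFin (fun n => K.ch.homology n)
/-- Euler characteristic of the homology -/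
def CC.chi (K : CC) : ℤ := gchi (fun n => K.ch.homology n)

/-- morphisms of concrete complexes -/
structure CCHom (K M : CC) where
  f : ∀ n, K.X n →ₗ[ℚ] M.X n
  comm : ∀ n x, M.d n (f (n+1) x) = f n (K.d n x)

/-- The induced morphism. -/
def CCHom.ch {K M : CC} (φ : CCHom K M) : K.ch ⟶ M.ch where
  f n := ModuleCat.ofHom (φ.f n)
  comm' := by
    rintro i j h
    simp only [ComplexShape.down_Rel] at h
    subst h
    rw [CC.ch_d, CC.ch_d]
    ext x
    exact φ.comm j x

/-- SES of concrete complexes gives LES. -/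
def CCHom.les {K M P : CC} (φ : CCHom K M) (ψ : CCHom M P)
    (hi : ∀ n, Function.Injective (φ.f n)) (hs : ∀ n, Function.Surjective (ψ.f n))
    (he : ∀ n, LinearMap.range (φ.f n) = LinearMap.ker (ψ.f n)) :
    LES (fun n => K.ch.homology n) (fun n => M.ch.homology n) (fun n => P.ch.homology n) := by
  have h0 : φ.ch ≫ ψ.ch = 0 := by
    ext n x
    have : φ.f n x ∈ LinearMap.ker (ψ.f n) := by rw [← he]; exact ⟨x, rfl⟩
    exact this
  refine lesOfShortExact (ShortComplex.mk φ.ch ψ.ch h0) ?_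
  refine HomologicalComplex.shortExact_of_degreewise_shortExact _ (fun n => ?_)
  refine ShortComplex.ShortExact.mk' ?_ ?_ ?_
  · rw [ShortComplex.moduleCat_exact_iff]
    intro x hx
    have h1 : x ∈ LinearMap.ker (ψ.f n) := hx
    rw [← he] at h1
    exact h1
  · exact (ModuleCat.mono_iff_injective _).2 (hi n)
  · exact (ModuleCat.epi_iff_surjective _).2 (hs n)

/-- Isomorphic concrete complexes. -/
lemma CC.iso_congr {K M : CC} (φ : CCHom K M) (h : ∀ n, Function.Bijective (φ.f n)) (n : ℕ) :
    Nonempty (K.ch.homology n ≅ M.ch.homology n) := by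
  have : ∀ n, IsIso (φ.ch.f n) := fun n => (ConcreteCategory.isIso_iff_bijective _).2 (h n)
  have : IsIso φ.ch := HomologicalComplex.Hom.isIso_of_components φ.ch
  exact ⟨(HomologicalComplex.homologyFunctor _ _ n).mapIso (asIso φ.ch)⟩

lemma gfin_congr {M N : ℕ → ModuleCat.{0} ℚ} (h : ∀ n, Nonempty (M n ≅ N n)) (hM : GFin M) :
    GFin N := by
  obtain ⟨f, B, hB⟩ := hM
  refine ⟨fun n => ?_, B, fun n hn => ?_⟩
  · have := f n
    exact Module.Finite.equiv (h n).some.toLinearEquiv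
  · rw [← hB n hn]; exact (LinearEquiv.finrank_eq (h n).some.toLinearEquiv).symm

lemma gchi_congr {M N : ℕ → ModuleCat.{0} ℚ} (h : ∀ n, Nonempty (M n ≅ N n)) :
    gchi M = gchi N := by
  unfold gchi
  congr 1; ext n
  rw [LinearEquiv.finrank_eq (h n).some.toLinearEquiv]

lemma CC.acyclic (K : CC) (h : ∀ n x, K.d n x = 0 → ∃ y, K.d (n+1) y = x)
    (h0 : ∀ x, ∃ y, K.d 0 y = x) : K.Fin ∧ K.chi = 0 := by
  have key : ∀ n, Limits.IsZero (K.ch.homology n) := by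
    intro n
    rw [← HomologicalComplex.exactAt_iff_isZero_homology]
    cases n with
    | zero =>
      rw [HomologicalComplex.exactAt_iff' K.ch 1 0 0 (by simp) (by simp)]
      rw [ShortComplex.moduleCat_exact_iff]
      intro x _
      obtain ⟨y, hy⟩ := h0 x
      exact ⟨y, (LinearMap.congr_fun (congrArg ModuleCat.Hom.hom (K.ch_d 0)) y).trans hy⟩
    | succ n =>
      rw [HomologicalComplex.exactAt_iff' K.ch (n+2) (n+1) n (by simp) (by simp)]
      rw [ShortComplex.moduleCat_exact_iff]
      intro x hx
      obtain ⟨y, hy⟩ := h n x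
        ((LinearMap.congr_fun (congrArg ModuleCat.Hom.hom (K.ch_d n)) x).symm.trans hx)
      exact ⟨y, (LinearMap.congr_fun (congrArg ModuleCat.Hom.hom (K.ch_d (n+1))) y).trans hy⟩
  have hz : ∀ n, Module.finrank ℚ (K.ch.homology n) = 0 := fun n => by
    have := ModuleCat.subsingleton_of_isZero (key n)
    exact Module.finrank_zero_of_subsingleton
  refine ⟨⟨fun n => ?_, 0, fun n _ => hz n⟩, ?_⟩
  · have := ModuleCat.subsingleton_of_isZero (key n)
    infer_instance
  · show gchi _ = 0
    rw [gchi_eq _ 0 (fun n _ => hz n)]; simp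

end

section
open CategoryTheory AlgebraicTopology

/-- Graded subspaces stable under the differential. -/
structure SubCC (K : CC) where
  S : ∀ n, Submodule ℚ (K.X n)
  stab : ∀ n x, x ∈ S (n+1) → K.d n x ∈ S n

/-- The subcomplex. -/
def SubCC.cc {K : CC} (A : SubCC K) : CC where
  X n := ↥(A.S n)
  d n := (K.d n).restrict (A.stab n)
  dd n x := by ext; exact K.dd n x

/-- The quotient complex. -/
def SubCC.quo {K : CC} (A : SubCC K) : CC where
  X n := (K.X n) ⧸ (A.S n)
  d n := Submodule.mapQ _ _ (K.d n) (A.stab n)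
  dd n x := by
    induction x using Submodule.Quotient.induction_on with
    | _ x => simp [K.dd]

/-- intersection -/
def SubCC.inf {K : CC} (A B : SubCC K) : SubCC K where
  S n := A.S n ⊓ B.S n
  stab n x hx := ⟨A.stab n x hx.1, B.stab n x hx.2⟩

/-- sum -/
def SubCC.sup {K : CC} (A B : SubCC K) : SubCC K where
  S n := A.S n ⊔ B.S n
  stab n x hx := by
    rw [Submodule.mem_sup] at hx ⊢
    obtain ⟨y, hy, z, hz, rfl⟩ := hx
    exact ⟨_, A.stab n y hy, _, B.stab n z hz, by simp⟩

/-- direct sum -/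
def CC.prod (K M : CC) : CC where
  X n := K.X n × M.X n
  d n := (K.d n).prodMap (M.d n)
  dd n x := by ext <;> simp [K.dd, M.dd]

/-- LES of a direct sum -/
def CC.prodLES (K M : CC) : LES (fun n => K.ch.homology n) (fun n => (K.prod M).ch.homology n)
    (fun n => M.ch.homology n) :=
  CCHom.les (K := K) (M := K.prod M) (P := M)
    ⟨fun n => LinearMap.inl ℚ _ _, fun n x => Prod.ext rfl ((M.d n).map_zero)⟩
    ⟨fun n => LinearMap.snd ℚ _ _, fun n x => rfl⟩
    (fun n => LinearMap.inl_injective) (fun n => LinearMap.snd_surjective)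
    (fun n => by exact LinearMap.range_inl ..)

/-- Mayer-Vietoris LES -/
def SubCC.mvLES {K : CC} (A B : SubCC K) : LES (fun n => (A.inf B).cc.ch.homology n)
    (fun n => (A.cc.prod B.cc).ch.homology n) (fun n => (A.sup B).cc.ch.homology n) :=
  CCHom.les (K := (A.inf B).cc) (M := A.cc.prod B.cc) (P := (A.sup B).cc)
    ⟨fun n => (Submodule.inclusion (inf_le_left : A.S n ⊓ B.S n ≤ A.S n)).prod
      (-(Submodule.inclusion (inf_le_right : A.S n ⊓ B.S n ≤ B.S n))), fun n x => by
        refine Prod.ext ?_ ?_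
        · rfl
        · apply Subtype.ext
          exact (K.d n).map_neg x.1⟩
    ⟨fun n => (Submodule.inclusion (le_sup_left : A.S n ≤ A.S n ⊔ B.S n)).coprod
      ((Submodule.inclusion (le_sup_right : B.S n ≤ A.S n ⊔ B.S n))), fun n x => by
        apply Subtype.ext
        exact (K.d n).map_add x.1.1 x.2.1⟩
    (fun n x y h => by
      have := congrArg (fun z => (Prod.fst z : A.S n).1) h
      exact Subtype.ext this)
    (fun n x => by
      obtain ⟨y, hy, z, hz, h⟩ := Submodule.mem_sup.1 x.2
      exact ⟨(⟨y, hy⟩, ⟨z, hz⟩), Subtype.ext h⟩)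
    (fun n => by
      ext x
      constructor
      · rintro ⟨y, rfl⟩
        apply Subtype.ext
        exact add_neg_cancel y.1
      · intro h
        have h1 : (x.1.1 : K.X n) + x.2.1 = 0 := congrArg Subtype.val h
        refine ⟨⟨x.1.1, x.1.2, ?_⟩, ?_⟩
        · rw [eq_neg_of_add_eq_zero_left h1]; exact (B.S n).neg_mem x.2.2
        · refine Prod.ext (Subtype.ext rfl) (Subtype.ext ?_)
          exact (eq_neg_of_add_eq_zero_right h1).symm)

/-- quotient LES -/
def SubCC.quoLES {K : CC} (A : SubCC K) : LES (fun n => A.cc.ch.homology n)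
    (fun n => K.ch.homology n) (fun n => A.quo.ch.homology n) :=
  CCHom.les (K := A.cc) (M := K) (P := A.quo)
    ⟨fun n => (A.S n).subtype, fun n x => rfl⟩ ⟨fun n => (A.S n).mkQ, fun n x => rfl⟩
    (fun n => Subtype.val_injective) (fun n => Submodule.mkQ_surjective _)
    (fun n => by exact (Submodule.range_subtype _).trans (Submodule.ker_mkQ _).symm)

lemma SubCC.acyclic_quo {K : CC} (A : SubCC K)
    (h : ∀ n x, K.d n x ∈ A.S n → ∃ y, x - K.d (n+1) y ∈ A.S (n+1))
    (h0 : ∀ x, ∃ y, x - K.d 0 y ∈ A.S 0) : (A.cc.Fin ↔ K.Fin) ∧ (K.Fin → A.cc.chi = K.chi) := by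
  have hq : A.quo.Fin ∧ A.quo.chi = 0 := by
    apply CC.acyclic
    · intro n x hx
      induction x using Submodule.Quotient.induction_on with
      | _ x =>
        obtain ⟨y, hy⟩ := h n x ((Submodule.Quotient.mk_eq_zero _).1 hx)
        exact ⟨Submodule.Quotient.mk y, ((Submodule.Quotient.eq _).2 hy).symm⟩
    · intro x
      induction x using Submodule.Quotient.induction_on with
      | _ x =>
        obtain ⟨y, hy⟩ := h0 x
        exact ⟨Submodule.Quotient.mk y, ((Submodule.Quotient.eq _).2 hy).symm⟩
  have h1 : A.cc.Fin ↔ K.Fin :=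
    ⟨fun h => A.quoLES.gfinB h hq.1, fun h => A.quoLES.gfinA h hq.1⟩
  refine ⟨h1, fun h => ?_⟩
  have := A.quoLES.chi' (h1.2 h) h hq.1
  have h2 := hq.2
  unfold CC.chi at *
  rw [this, h2, add_zero]

lemma SubCC.mv_down {K : CC} (A B : SubCC K) (h : (A.sup B).cc.Fin) (hB : B.cc.Fin)
    (hI : (A.inf B).cc.Fin) : A.cc.Fin ∧
      (A.sup B).cc.chi + (A.inf B).cc.chi = A.cc.chi + B.cc.chi := by
  have hp : (A.cc.prod B.cc).Fin := (A.mvLES B).gfinB hI h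
  have hA : A.cc.Fin := (CC.prodLES A.cc B.cc).gfinA hp hB
  refine ⟨hA, ?_⟩
  have e1 := (A.mvLES B).chi' hI hp h
  have e2 := (CC.prodLES A.cc B.cc).chi' hA hp hB
  unfold CC.chi
  linarith

lemma SubCC.mv_up {K : CC} (A B : SubCC K) (hA : A.cc.Fin) (hB : B.cc.Fin)
    (hI : (A.inf B).cc.Fin) : (A.sup B).cc.Fin ∧
      (A.sup B).cc.chi + (A.inf B).cc.chi = A.cc.chi + B.cc.chi := by
  have hp : (A.cc.prod B.cc).Fin := (CC.prodLES A.cc B.cc).gfinB hA hB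
  have h : (A.sup B).cc.Fin := (A.mvLES B).gfinC hI hp
  refine ⟨h, ?_⟩
  have e1 := (A.mvLES B).chi' hI hp h
  have e2 := (CC.prodLES A.cc B.cc).chi' hA hp hB
  unfold CC.chi
  linarith

end

section
open CategoryTheory AlgebraicTopology

/-- singular chains as a functor -/
def scF : TopCat.{0} ⥤ ChainComplex (ModuleCat.{0} ℚ) ℕ :=
  TopCat.toSSet ⋙ (SimplicialObject.whiskering _ _).obj (ModuleCat.free ℚ) ⋙
    alternatingFaceMapComplex (ModuleCat ℚ)

/-- homotopic maps -/
lemma scF_homotopy {X Y : TopCat.{0}} {f g : X ⟶ Y} (H : TopCat.Homotopy f g) (n : ℕ) :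
    HomologicalComplex.homologyMap (scF.map f) n = HomologicalComplex.homologyMap (scF.map g) n := by
  have h := ((H.toSSet.toSimplicialObjectHomotopy).whiskerRight (ModuleCat.free ℚ)).toChainHomotopy
  exact h.homologyMap_eq n

/-- graded homology of a space -/
abbrev HS (X : Type) [TopologicalSpace X] : ℕ → ModuleCat.{0} ℚ :=
  fun n => (singularChainComplex X).homology n

/-- The space has finite dimensional total rational homology. -/
def FH (X : Type) [TopologicalSpace X] : Prop := GFin (HS X)

lemma HS_homotopy {X Y : Type} [TopologicalSpace X] [TopologicalSpace Y]
    (e : ContinuousMap.HomotopyEquiv X Y) (n : ℕ) : Nonempty (HS X n ≅ HS Y n) := by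
  let f : TopCat.of X ⟶ TopCat.of Y := TopCat.ofHom e.toFun
  let g : TopCat.of Y ⟶ TopCat.of X := TopCat.ofHom e.invFun
  obtain ⟨h1⟩ := e.left_inv
  obtain ⟨h2⟩ := e.right_inv
  have h1' : TopCat.Homotopy (f ≫ g) (𝟙 _) := h1
  have h2' : TopCat.Homotopy (g ≫ f) (𝟙 _) := h2
  suffices Nonempty ((scF.obj (TopCat.of X)).homology n ≅ (scF.obj (TopCat.of Y)).homology n) from this
  refine ⟨⟨HomologicalComplex.homologyMap (scF.map f) n, HomologicalComplex.homologyMap (scF.map g) n, ?_, ?_⟩⟩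
  · rw [← HomologicalComplex.homologyMap_comp, ← scF.map_comp, scF_homotopy h1' n, scF.map_id,
      HomologicalComplex.homologyMap_id]
  · rw [← HomologicalComplex.homologyMap_comp, ← scF.map_comp, scF_homotopy h2' n, scF.map_id,
      HomologicalComplex.homologyMap_id]

lemma eulerChar_eq_gchi (X : Type) [TopologicalSpace X] : eulerChar X = gchi (HS X) := rfl

lemma FH_congr {X Y : Type} [TopologicalSpace X] [TopologicalSpace Y]
    (e : ContinuousMap.HomotopyEquiv X Y) (h : FH X) : FH Y := gfin_congr (HS_homotopy e) h

lemma eulerChar_congr {X Y : Type} [TopologicalSpace X] [TopologicalSpace Y]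
    (e : ContinuousMap.HomotopyEquiv X Y) : eulerChar X = eulerChar Y := by
  rw [eulerChar_eq_gchi, eulerChar_eq_gchi]
  exact gchi_congr (HS_homotopy e)

end

section
open CategoryTheory AlgebraicTopology

/-- presimplicial sets -/
structure PS where
  X : ℕ → Type
  face : ∀ n, Fin (n+2) → X (n+1) → X n
  rel : ∀ n (i j : Fin (n+2)) x, i ≤ j →
    face n i (face (n+1) j.succ x) = face n j (face (n+1) i.castSucc x)

/-- boundary of a simplex -/
def PS.bd1 (P : PS) (n : ℕ) (x : P.X (n+1)) : P.X n →₀ ℚ :=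
  ∑ i : Fin (n+2), (-1 : ℚ) ^ (i : ℕ) • Finsupp.single (P.face n i x) 1

/-- boundary -/
def PS.bd (P : PS) (n : ℕ) : (P.X (n+1) →₀ ℚ) →ₗ[ℚ] (P.X n →₀ ℚ) :=
  Finsupp.linearCombination ℚ (P.bd1 n)

lemma PS.bd_single (P : PS) (n : ℕ) (x : P.X (n+1)) :
    P.bd n (Finsupp.single x 1) = P.bd1 n x := by
  simp [PS.bd]

lemma PS.bd_bd (P : PS) (n : ℕ) (c) : P.bd n (P.bd (n+1) c) = 0 := by
  suffices h : P.bd n ∘ₗ P.bd (n+1) = 0 from LinearMap.congr_fun h c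
  refine Finsupp.lhom_ext' (fun x => LinearMap.ext_ring ?_)
  simp only [LinearMap.comp_apply, Finsupp.lsingle_apply, LinearMap.zero_apply]
  rw [PS.bd_single, PS.bd1, map_sum]
  simp only [map_smul, PS.bd_single]
  simp only [PS.bd1, Finset.smul_sum, ← Finset.sum_product', smul_smul]
  let Q := Fin (n + 3) × Fin (n + 2)
  let S : Finset Q := {ij : Q | (ij.1 : ℕ) ≤ (ij.2 : ℕ)}
  rw [Finset.univ_product_univ, ← Finset.sum_add_sum_compl S, ← eq_neg_iff_add_eq_zero,
    ← Finset.sum_neg_distrib]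
  let φ : ∀ ij : Q, ij ∈ S → Q := fun ij hij =>
    (ij.2.succ, Fin.castLT ij.1 (lt_of_le_of_lt (Finset.mem_filter.mp hij).right (Fin.is_lt ij.2)))
  apply Finset.sum_bij φ
  · intro ij hij
    simp_rw [S, φ, Finset.compl_filter, Finset.mem_filter_univ, Fin.val_succ,
      Fin.val_castLT] at hij ⊢
    lia
  · rintro ⟨j, i⟩ hij ⟨j', i'⟩ hij' h
    rw [Prod.mk_inj] at h ⊢
    exact ⟨by simpa [φ, Fin.castSucc_castLT] using! congr_arg Fin.castSucc h.2,
      by simpa [φ] using! h.1⟩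
  · rintro ⟨j', i'⟩ hij'
    simp_rw [S, Finset.compl_filter, Finset.mem_filter_univ, not_le] at hij'
    refine ⟨(Fin.castSucc i', j'.pred <| ?_), ?_, ?_⟩
    · rintro rfl
      simp only [Fin.val_zero, not_lt_zero] at hij'
    · simpa [S] using! Nat.le_sub_one_of_lt hij'
    · simp only [φ, Fin.castLT_castSucc, Fin.succ_pred]
  · rintro ⟨j, i⟩ hij
    have hij2 : (j : ℕ) ≤ i := (Finset.mem_filter.mp hij).right
    have := P.rel n (Fin.castLT j (lt_of_le_of_lt hij2 (Fin.is_lt i))) i x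
      (by rw [Fin.le_def]; exact hij2)
    simp only [φ, Fin.val_succ, Fin.val_castLT]
    rw [this, Fin.castSucc_castLT, ← neg_smul]
    congr 1
    ring

/-- The complex of a presimplicial set -/
def PS.cc (P : PS) : CC where
  X n := P.X n →₀ ℚ
  d n := P.bd n
  dd n x := P.bd_bd n x

/-- standard simplex -/
abbrev Dl (k : ℕ) := stdSimplex ℝ (Fin (k+1))

/-- affine map with given vertices -/
def Aff {k m : ℕ} (w : Fin (k+1) → Dl m) : C(Dl k, Dl m) where
  toFun t := ⟨fun j => ∑ i, t.1 i * (w i).1 j, fun j => Finset.sum_nonneg fun i _ =>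
    mul_nonneg (t.2.1 i) ((w i).2.1 j), by
      rw [Finset.sum_comm]
      simp_rw [← Finset.mul_sum, (w _).2.2, mul_one]
      exact t.2.2⟩
  continuous_toFun := by
    refine Continuous.subtype_mk (continuous_pi fun j => continuous_finsetSum _ fun i _ => ?_) _
    exact ((continuous_apply i).comp continuous_subtype_val).mul continuous_const

lemma Aff_val {k m : ℕ} (w : Fin (k+1) → Dl m) (t : Dl k) :
    (Aff w t).1 = ∑ i, t.1 i • (w i).1 := by
  ext j; simp [Aff]

lemma Aff_Aff {k m l : ℕ} (w : Fin (m+1) → Dl l) (v : Fin (k+1) → Dl m) (t : Dl k) :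
    Aff w (Aff v t) = Aff (fun i => Aff w (v i)) t := by
  apply Subtype.ext
  ext j
  simp only [Aff, ContinuousMap.coe_mk]
  simp_rw [Finset.sum_mul, Finset.mul_sum]
  rw [Finset.sum_comm]
  simp_rw [mul_assoc]

lemma Aff_comp {k m l : ℕ} (w : Fin (m+1) → Dl l) (v : Fin (k+1) → Dl m) :
    (Aff w).comp (Aff v) = Aff (fun i => Aff w (v i)) := by
  ext1 t; exact Aff_Aff w v t

/-- vertices -/
def vt (k : ℕ) : Fin (k+1) → Dl k := fun i => stdSimplex.vertex i

lemma Aff_vt {k m : ℕ} (w : Fin (k+1) → Dl m) (i) : Aff w (vt k i) = w i := by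
  apply Subtype.ext
  rw [Aff_val]
  simp [vt, Pi.single_apply]

lemma Aff_id (k : ℕ) : Aff (vt k) = ContinuousMap.id _ := by
  ext1 t
  apply Subtype.ext
  rw [Aff_val]
  ext j
  simp [vt, Pi.single_apply]

lemma succAbove_rel (n : ℕ) (i j : Fin (n+2)) (h : i ≤ j) (a : Fin (n+1)) :
    j.succ.succAbove (i.succAbove a) = i.castSucc.succAbove (j.succAbove a) := by
  have := SimplexCategory.δ_comp_δ h
  have := congrArg (fun f => f.toOrderHom a) this
  exact this

/-- the singular presimplicial set -/
def sing (M : Type) [TopologicalSpace M] : PS where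
  X n := C(Dl n, M)
  face n i σ := σ.comp (Aff fun j => vt (n+1) (i.succAbove j))
  rel n i j σ h := by
    rw [ContinuousMap.comp_assoc, ContinuousMap.comp_assoc, Aff_comp, Aff_comp]
    simp only [Aff_vt]
    simp only [succAbove_rel n i j h]

/-- linear chains in the standard simplex -/
def lin (m : ℕ) : PS where
  X n := Fin (n+1) → Dl m
  face n i w := fun j => w (i.succAbove j)
  rel n i j σ h := by
    funext a
    simp only [succAbove_rel n i j h]

end

section
open CategoryTheory AlgebraicTopology

/-- linear chains -/
abbrev LC (m k : ℕ) := (Fin (k+1) → Dl m) →₀ ℚ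

/-- boundary on linear chains -/
def lbd (m n : ℕ) : LC m (n+1) →ₗ[ℚ] LC m n := (lin m).bd n

lemma lbd_single {m n : ℕ} (w : Fin (n+2) → Dl m) : lbd m n (Finsupp.single w 1) =
    ∑ i : Fin (n+2), (-1 : ℚ) ^ (i : ℕ) • Finsupp.single (fun j => w (i.succAbove j)) 1 :=
  (lin m).bd_single n w

lemma lbd_lbd {m n : ℕ} (c : LC m (n+2)) : lbd m n (lbd m (n+1) c) = 0 := (lin m).bd_bd n c

/-- cone operator -/
def cone {m k : ℕ} (b : Dl m) : LC m k →ₗ[ℚ] LC m (k+1) :=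
  Finsupp.lmapDomain ℚ ℚ (fun w => Fin.cons b w)

lemma cone_single {m k : ℕ} (b : Dl m) (w : Fin (k+1) → Dl m) (a : ℚ) :
    cone b (Finsupp.single w a) = Finsupp.single (Fin.cons b w : Fin (k+2) → Dl m) a := by
  simp [cone, Finsupp.mapDomain_single]

lemma lbd_cone {m k : ℕ} (b : Dl m) (c : LC m (k+1)) :
    lbd m (k+1) (cone b c) = c - cone b (lbd m k c) := by
  suffices h : lbd m (k+1) ∘ₗ cone b = LinearMap.id - cone b ∘ₗ lbd m k from LinearMap.congr_fun h c
  refine Finsupp.lhom_ext' (fun w => LinearMap.ext_ring ?_)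
  simp only [LinearMap.comp_apply, Finsupp.lsingle_apply, LinearMap.sub_apply, LinearMap.id_apply]
  rw [cone_single, lbd_single, lbd_single, Fin.sum_univ_succ, map_sum, sub_eq_add_neg,
    ← Finset.sum_neg_distrib]
  congr 1
  · simp
  · refine Finset.sum_congr rfl fun i _ => ?_
    rw [map_smul, cone_single, ← neg_smul]
    congr 1
    · simp [pow_succ]
    · congr 1
      funext j
      refine Fin.cases ?_ (fun j => ?_) j <;> simp

lemma lbd_cone0 {m : ℕ} (b : Dl m) (c : LC m 1) :
    lbd m 0 (cone b (lbd m 0 c)) = lbd m 0 c := by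
  suffices h : lbd m 0 ∘ₗ cone b ∘ₗ lbd m 0 = lbd m 0 from LinearMap.congr_fun h c
  refine Finsupp.lhom_ext' (fun w => LinearMap.ext_ring ?_)
  simp only [LinearMap.comp_apply, Finsupp.lsingle_apply]
  have e1 : ∀ x : Fin 1 → Dl m, lbd m 0 (cone b (Finsupp.single x 1)) =
      Finsupp.single x 1 - Finsupp.single (fun _ => b) 1 := by
    intro x
    rw [cone_single, lbd_single]
    rw [Fin.sum_univ_two, sub_eq_add_neg]
    congr 1
    · simp
    · simp only [Fin.val_one, pow_one, neg_smul, one_smul]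
      congr 2
      funext j; fin_cases j; simp
  rw [lbd_single w, Fin.sum_univ_two]
  rw [map_add, map_add, map_smul, map_smul, map_smul, map_smul, e1, e1]
  simp only [Fin.val_zero, pow_zero, one_smul, Fin.val_one, pow_one, neg_smul]
  abel

/-- barycenter of a linear simplex -/
def bary {m k : ℕ} (w : Fin (k+1) → Dl m) : Dl m := Aff w stdSimplex.barycenter

/-- subdivision -/
def Sd (m : ℕ) : ∀ k, LC m k →ₗ[ℚ] LC m k
  | 0 => LinearMap.id
  | (k+1) => Finsupp.linearCombination ℚ fun w => cone (bary w) (Sd m k (lbd m k (Finsupp.single w 1)))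

/-- the chain homotopy -/
def Th (m : ℕ) : ∀ k, LC m k →ₗ[ℚ] LC m (k+1)
  | 0 => 0
  | (k+1) => Finsupp.linearCombination ℚ fun w => cone (bary w) (Finsupp.single w 1 -
      Th m k (lbd m k (Finsupp.single w 1)))

lemma Sd_single {m k : ℕ} (w : Fin (k+2) → Dl m) : Sd m (k+1) (Finsupp.single w 1) =
    cone (bary w) (Sd m k (lbd m k (Finsupp.single w 1))) := by
  simp [Sd]

lemma Th_single {m k : ℕ} (w : Fin (k+2) → Dl m) : Th m (k+1) (Finsupp.single w 1) =
    cone (bary w) (Finsupp.single w 1 - Th m k (lbd m k (Finsupp.single w 1))) := by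
  simp [Th]

lemma lbd_Sd {m k : ℕ} (c : LC m (k+1)) : lbd m k (Sd m (k+1) c) = Sd m k (lbd m k c) := by
  induction k with
  | zero =>
    suffices h : lbd m 0 ∘ₗ Sd m 1 = Sd m 0 ∘ₗ lbd m 0 from LinearMap.congr_fun h c
    refine Finsupp.lhom_ext' (fun w => LinearMap.ext_ring ?_)
    simp only [LinearMap.comp_apply, Finsupp.lsingle_apply]
    rw [Sd_single]
    exact lbd_cone0 _ _
  | succ k ih =>
    suffices h : lbd m (k+1) ∘ₗ Sd m (k+2) = Sd m (k+1) ∘ₗ lbd m (k+1) from LinearMap.congr_fun h c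
    refine Finsupp.lhom_ext' (fun w => LinearMap.ext_ring ?_)
    simp only [LinearMap.comp_apply, Finsupp.lsingle_apply]
    rw [Sd_single, lbd_cone, ih, lbd_lbd]
    simp

lemma lbd_Th {m k : ℕ} (c : LC m (k+1)) : lbd m (k+1) (Th m (k+1) c) =
    c - Sd m (k+1) c - Th m k (lbd m k c) := by
  induction k with
  | zero =>
    suffices h : lbd m 1 ∘ₗ Th m 1 = LinearMap.id - Sd m 1 - Th m 0 ∘ₗ lbd m 0 from LinearMap.congr_fun h c
    refine Finsupp.lhom_ext' (fun w => LinearMap.ext_ring ?_)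
    simp only [LinearMap.comp_apply, Finsupp.lsingle_apply, LinearMap.sub_apply, LinearMap.id_apply]
    rw [Th_single, lbd_cone, Sd_single]
    simp [Th, Sd]
  | succ k ih =>
    suffices h : lbd m (k+2) ∘ₗ Th m (k+2) = LinearMap.id - Sd m (k+2) - Th m (k+1) ∘ₗ lbd m (k+1) from LinearMap.congr_fun h c
    refine Finsupp.lhom_ext' (fun w => LinearMap.ext_ring ?_)
    simp only [LinearMap.comp_apply, Finsupp.lsingle_apply, LinearMap.sub_apply, LinearMap.id_apply]
    rw [Th_single, lbd_cone, Sd_single]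
    rw [map_sub (lbd m (k+1)), ih, lbd_lbd, map_zero]
    simp only [sub_zero, sub_sub_cancel]
    abel

/-- push forward of linear chains under affine maps -/
def push {m l : ℕ} (v : Fin (m+1) → Dl l) (k : ℕ) : LC m k →ₗ[ℚ] LC l k :=
  Finsupp.lmapDomain ℚ ℚ (fun w i => Aff v (w i))

lemma push_single {m l : ℕ} (v : Fin (m+1) → Dl l) {k : ℕ} (w : Fin (k+1) → Dl m) (a : ℚ) :
    push v k (Finsupp.single w a) = Finsupp.single (fun i => Aff v (w i)) a := by
  simp [push, Finsupp.mapDomain_single]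

lemma push_lbd {m l : ℕ} (v : Fin (m+1) → Dl l) {k : ℕ} (c : LC m (k+1)) :
    push v k (lbd m k c) = lbd l k (push v (k+1) c) := by
  suffices h : push v k ∘ₗ lbd m k = lbd l k ∘ₗ push v (k+1) from LinearMap.congr_fun h c
  refine Finsupp.lhom_ext' (fun w => LinearMap.ext_ring ?_)
  simp only [LinearMap.comp_apply, Finsupp.lsingle_apply]
  rw [push_single, lbd_single, lbd_single, map_sum]
  refine Finset.sum_congr rfl fun i _ => ?_
  rw [map_smul, push_single]

lemma push_cone {m l : ℕ} (v : Fin (m+1) → Dl l) {k : ℕ} (b : Dl m) (c : LC m k) :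
    push v (k+1) (cone b c) = cone (Aff v b) (push v k c) := by
  suffices h : push v (k+1) ∘ₗ cone b = cone (Aff v b) ∘ₗ push v k from LinearMap.congr_fun h c
  refine Finsupp.lhom_ext' (fun w => LinearMap.ext_ring ?_)
  simp only [LinearMap.comp_apply, Finsupp.lsingle_apply]
  rw [push_single, cone_single, cone_single, push_single]
  congr 1
  funext j
  refine Fin.cases ?_ (fun j => ?_) j <;> simp

lemma Aff_bary {m l k : ℕ} (v : Fin (m+1) → Dl l) (w : Fin (k+1) → Dl m) :
    Aff v (bary w) = bary (fun i => Aff v (w i)) := Aff_Aff _ _ _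

lemma push_Sd {m l : ℕ} (v : Fin (m+1) → Dl l) {k : ℕ} (c : LC m k) :
    push v k (Sd m k c) = Sd l k (push v k c) := by
  induction k with
  | zero => rfl
  | succ k ih =>
    suffices h : push v (k+1) ∘ₗ Sd m (k+1) = Sd l (k+1) ∘ₗ push v (k+1) from LinearMap.congr_fun h c
    refine Finsupp.lhom_ext' (fun w => LinearMap.ext_ring ?_)
    simp only [LinearMap.comp_apply, Finsupp.lsingle_apply]
    rw [push_single, Sd_single, Sd_single, push_cone, ih, push_lbd, push_single, Aff_bary]

lemma push_Th {m l : ℕ} (v : Fin (m+1) → Dl l) {k : ℕ} (c : LC m k) :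
    push v (k+1) (Th m k c) = Th l k (push v k c) := by
  induction k with
  | zero => simp [Th]
  | succ k ih =>
    suffices h : push v (k+2) ∘ₗ Th m (k+1) = Th l (k+1) ∘ₗ push v (k+1) from LinearMap.congr_fun h c
    refine Finsupp.lhom_ext' (fun w => LinearMap.ext_ring ?_)
    simp only [LinearMap.comp_apply, Finsupp.lsingle_apply]
    rw [push_single, Th_single, Th_single, push_cone, map_sub, ih, push_lbd, push_single, Aff_bary]

end

section
open CategoryTheory AlgebraicTopology

section
variable {M : Type} [TopologicalSpace M]

/-- singular chains -/
abbrev SC (M : Type) [TopologicalSpace M] (k : ℕ) := C(Dl k, M) →₀ ℚ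

/-- boundary -/
def sbd (M : Type) [TopologicalSpace M] (n : ℕ) : SC M (n+1) →ₗ[ℚ] SC M n := (sing M).bd n

lemma sbd_single {n : ℕ} (σ : C(Dl (n+1), M)) : sbd M n (Finsupp.single σ 1) =
    ∑ i : Fin (n+2), (-1 : ℚ) ^ (i : ℕ) •
      Finsupp.single (σ.comp (Aff fun j => vt (n+1) (i.succAbove j))) 1 :=
  (sing M).bd_single n σ

lemma sbd_sbd {n : ℕ} (c : SC M (n+2)) : sbd M n (sbd M (n+1) c) = 0 := (sing M).bd_bd n c

/-- realization -/
def rl {m : ℕ} (σ : C(Dl m, M)) (k : ℕ) : LC m k →ₗ[ℚ] SC M k :=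
  Finsupp.lmapDomain ℚ ℚ (fun w => σ.comp (Aff w))

lemma rl_single {m : ℕ} (σ : C(Dl m, M)) {k : ℕ} (w : Fin (k+1) → Dl m) (a : ℚ) :
    rl σ k (Finsupp.single w a) = Finsupp.single (σ.comp (Aff w)) a := by
  simp [rl, Finsupp.mapDomain_single]

lemma rl_lbd {m : ℕ} (σ : C(Dl m, M)) {k : ℕ} (c : LC m (k+1)) :
    rl σ k (lbd m k c) = sbd M k (rl σ (k+1) c) := by
  suffices h : rl σ k ∘ₗ lbd m k = sbd M k ∘ₗ rl σ (k+1) from LinearMap.congr_fun h c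
  refine Finsupp.lhom_ext' (fun w => LinearMap.ext_ring ?_)
  simp only [LinearMap.comp_apply, Finsupp.lsingle_apply]
  rw [rl_single, lbd_single, sbd_single, map_sum]
  refine Finset.sum_congr rfl fun i _ => ?_
  rw [map_smul, rl_single, ContinuousMap.comp_assoc, Aff_comp]
  simp only [Aff_vt]

lemma rl_push {m l : ℕ} (σ : C(Dl l, M)) (v : Fin (m+1) → Dl l) {k : ℕ} (c : LC m k) :
    rl σ k (push v k c) = rl (σ.comp (Aff v)) k c := by
  suffices h : rl σ k ∘ₗ push v k = rl (σ.comp (Aff v)) k from LinearMap.congr_fun h c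
  refine Finsupp.lhom_ext' (fun w => LinearMap.ext_ring ?_)
  simp only [LinearMap.comp_apply, Finsupp.lsingle_apply]
  rw [push_single, rl_single, rl_single, ContinuousMap.comp_assoc, Aff_comp]

/-- subdivision of singular chains -/
def sd (M : Type) [TopologicalSpace M] (k : ℕ) : SC M k →ₗ[ℚ] SC M k :=
  Finsupp.linearCombination ℚ fun σ => rl σ k (Sd k k (Finsupp.single (vt k) 1))

/-- homotopy on singular chains -/
def th (M : Type) [TopologicalSpace M] (k : ℕ) : SC M k →ₗ[ℚ] SC M (k+1) :=
  Finsupp.linearCombination ℚ fun σ => rl σ (k+1) (Th k k (Finsupp.single (vt k) 1))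

lemma sd_rl {m : ℕ} (σ : C(Dl m, M)) {k : ℕ} (c : LC m k) :
    sd M k (rl σ k c) = rl σ k (Sd m k c) := by
  suffices h : sd M k ∘ₗ rl σ k = rl σ k ∘ₗ Sd m k from LinearMap.congr_fun h c
  refine Finsupp.lhom_ext' (fun w => LinearMap.ext_ring ?_)
  simp only [LinearMap.comp_apply, Finsupp.lsingle_apply]
  rw [rl_single]
  simp only [sd, Finsupp.linearCombination_single, one_smul]
  rw [← rl_push, push_Sd, push_single]
  simp only [Aff_vt]

lemma th_rl {m : ℕ} (σ : C(Dl m, M)) {k : ℕ} (c : LC m k) :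
    th M k (rl σ k c) = rl σ (k+1) (Th m k c) := by
  suffices h : th M k ∘ₗ rl σ k = rl σ (k+1) ∘ₗ Th m k from LinearMap.congr_fun h c
  refine Finsupp.lhom_ext' (fun w => LinearMap.ext_ring ?_)
  simp only [LinearMap.comp_apply, Finsupp.lsingle_apply]
  rw [rl_single]
  simp only [th, Finsupp.linearCombination_single, one_smul]
  rw [← rl_push, push_Th, push_single]
  simp only [Aff_vt]

lemma single_eq_rl {k : ℕ} (σ : C(Dl k, M)) :
    (Finsupp.single σ 1 : SC M k) = rl σ k (Finsupp.single (vt k) 1) := by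
  rw [rl_single, Aff_id, ContinuousMap.comp_id]

lemma sbd_sd {k : ℕ} (c : SC M (k+1)) : sbd M k (sd M (k+1) c) = sd M k (sbd M k c) := by
  suffices h : sbd M k ∘ₗ sd M (k+1) = sd M k ∘ₗ sbd M k from LinearMap.congr_fun h c
  refine Finsupp.lhom_ext' (fun w => LinearMap.ext_ring ?_)
  simp only [LinearMap.comp_apply, Finsupp.lsingle_apply]
  rw [single_eq_rl, sd_rl, ← rl_lbd, lbd_Sd, ← rl_lbd, sd_rl]

lemma sbd_th {k : ℕ} (c : SC M (k+1)) : sbd M (k+1) (th M (k+1) c) =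
    c - sd M (k+1) c - th M k (sbd M k c) := by
  suffices h : sbd M (k+1) ∘ₗ th M (k+1) = LinearMap.id - sd M (k+1) - th M k ∘ₗ sbd M k from
    LinearMap.congr_fun h c
  refine Finsupp.lhom_ext' (fun w => LinearMap.ext_ring ?_)
  simp only [LinearMap.comp_apply, Finsupp.lsingle_apply, LinearMap.sub_apply, LinearMap.id_apply]
  rw [single_eq_rl, th_rl, ← rl_lbd, lbd_Th, ← rl_lbd, sd_rl, th_rl, map_sub, map_sub]

/-- chains supported in simplices whose image lies in U -/
def inn (U : Set M) (k : ℕ) : Submodule ℚ (SC M k) :=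
  Finsupp.supported ℚ ℚ {σ : C(Dl k, M) | ∀ t, σ t ∈ U}

lemma inn_of_single {U : Set M} {k l : ℕ} (f : SC M k →ₗ[ℚ] SC M l)
    (h : ∀ σ : C(Dl k, M), (∀ t, σ t ∈ U) → f (Finsupp.single σ 1) ∈ inn U l)
    {c : SC M k} (hc : c ∈ inn U k) : f c ∈ inn U l := by
  have : inn U k ≤ (inn U l).comap f := by
    unfold inn
    rw [Finsupp.supported_eq_span_single, Submodule.span_le]
    rintro _ ⟨σ, hσ, rfl⟩
    exact h σ hσ
  exact this hc

lemma rl_inn {U : Set M} {m : ℕ} (σ : C(Dl m, M)) (h : ∀ t, σ t ∈ U) {k : ℕ} (c : LC m k) :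
    rl σ k c ∈ inn U k := by
  unfold inn
  rw [Finsupp.mem_supported]
  intro τ hτ
  classical
  have := Finsupp.mapDomain_support hτ
  simp only [Finset.mem_image] at this
  obtain ⟨w, _, rfl⟩ := this
  intro t
  exact h _

lemma sbd_inn {U : Set M} {k : ℕ} {c : SC M (k+1)} (hc : c ∈ inn U (k+1)) : sbd M k c ∈ inn U k :=
  inn_of_single (sbd M k) (fun σ h => by rw [single_eq_rl, ← rl_lbd]; exact rl_inn σ h _) hc
lemma sd_inn {U : Set M} {k : ℕ} {c : SC M k} (hc : c ∈ inn U k) : sd M k c ∈ inn U k :=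
  inn_of_single (sd M k) (fun σ h => by rw [single_eq_rl, sd_rl]; exact rl_inn σ h _) hc
lemma th_inn {U : Set M} {k : ℕ} {c : SC M k} (hc : c ∈ inn U k) : th M k c ∈ inn U (k+1) :=
  inn_of_single (th M k) (fun σ h => by rw [single_eq_rl, th_rl]; exact rl_inn σ h _) hc

end

/-- linear simplex with all vertices in a convex set and mesh at most δ -/
def fine {m : ℕ} (s : Set (Fin (m+1) → ℝ)) (δ : ℝ) (k : ℕ) : Set (Fin (k+1) → Dl m) :=
  {w | (∀ i, (w i).1 ∈ s) ∧ ∀ i j, dist (w i).1 (w j).1 ≤ δ}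

lemma bary_val {m k : ℕ} (w : Fin (k+1) → Dl m) :
    (bary w).1 = ((k:ℝ)+1)⁻¹ • ∑ i, (w i).1 := by
  rw [bary, Aff_val, Finset.smul_sum]
  refine Finset.sum_congr rfl fun i _ => ?_
  congr 1
  have := stdSimplex.barycenter_apply (𝕜 := ℝ) (X := Fin (k+1)) i
  simp

lemma bary_mem {m k : ℕ} (w : Fin (k+1) → Dl m) {s : Set (Fin (m+1) → ℝ)} (hs : Convex ℝ s)
    (h : ∀ i, (w i).1 ∈ s) : (bary w).1 ∈ s := by
  rw [bary, Aff_val]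
  exact hs.sum_mem (fun i _ => (stdSimplex.barycenter (𝕜 := ℝ) (X := Fin (k+1))).2.1 i)
    (stdSimplex.barycenter (𝕜 := ℝ) (X := Fin (k+1))).2.2 (fun i _ => h i)

lemma bary_dist {m k : ℕ} (w : Fin (k+1) → Dl m) {δ : ℝ} (h : ∀ i j, dist (w i).1 (w j).1 ≤ δ)
    (j : Fin (k+1)) : dist (bary w).1 (w j).1 ≤ (k / (k+1) : ℝ) * δ := by
  have e : (bary w).1 - (w j).1 = ((k:ℝ)+1)⁻¹ • ∑ i, ((w i).1 - (w j).1) := by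
    rw [bary_val, Finset.sum_sub_distrib, smul_sub, Finset.sum_const, Finset.card_univ,
      Fintype.card_fin, ← Nat.cast_smul_eq_nsmul ℝ, smul_smul]
    push_cast
    rw [inv_mul_cancel₀ (by positivity), one_smul]
  rw [dist_eq_norm, e, norm_smul, norm_inv, Real.norm_of_nonneg (by positivity)]
  rw [← Finset.sum_erase_add _ _ (Finset.mem_univ j), sub_self, add_zero]
  have : ‖∑ i ∈ Finset.univ.erase j, ((w i).1 - (w j).1)‖ ≤ k * δ := by
    refine (norm_sum_le_of_le _ (f := fun i => (w i).1 - (w j).1) (n := fun _ => δ) (fun i _ => ?_)).trans ?_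
    · rw [← dist_eq_norm]; exact h i j
    · simp
  calc ((k:ℝ)+1)⁻¹ * _ ≤ ((k:ℝ)+1)⁻¹ * (k * δ) := by gcongr
    _ = _ := by field_simp

lemma Sd_fine {m k : ℕ} {s : Set (Fin (m+1) → ℝ)} (hs : Convex ℝ s) {δ : ℝ} (hδ : 0 ≤ δ)
    {w : Fin (k+1) → Dl m} (hw : w ∈ fine s δ k) :
    Sd m k (Finsupp.single w 1) ∈ Finsupp.supported ℚ ℚ (fine s ((k / (k+1) : ℝ) * δ) k) := by
  induction k generalizing s with
  | zero =>
    rw [Sd, LinearMap.id_apply]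
    refine Finsupp.single_mem_supported _ _ ⟨hw.1, fun i j => ?_⟩
    have : i = j := Subsingleton.elim (α := Fin 1) i j
    subst this; simp
  | succ k ih =>
    rw [Sd_single, lbd_single, map_sum, map_sum]
    refine Submodule.sum_mem _ fun i _ => ?_
    rw [map_smul, map_smul]
    refine Submodule.smul_mem _ _ ?_
    -- convex hull of the vertices
    set s' := convexHull ℝ (Set.range fun i => (w i).1) with hs'
    have hsub : s' ⊆ s := convexHull_min (by rintro _ ⟨i, rfl⟩; exact hw.1 i) hs
    have h1 := ih (s := s') (convex_convexHull _ _) (w := fun j => w (i.succAbove j))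
      ⟨fun j => subset_convexHull _ _ ⟨_, rfl⟩, fun a b => hw.2 _ _⟩
    have hb : ∀ x ∈ s', dist (bary w).1 x ≤ (((k:ℝ)+1) / (k+1+1) : ℝ) * δ := by
      intro x hx
      have : s' ⊆ Metric.closedBall (bary w).1 ((((k:ℝ)+1) / (k+1+1) : ℝ) * δ) := by
        refine convexHull_min ?_ (convex_closedBall _ _)
        rintro _ ⟨j, rfl⟩
        rw [Metric.mem_closedBall, dist_comm]
        have := bary_dist w hw.2 j
        push_cast at this
        exact this
      have := this hx
      rwa [Metric.mem_closedBall, dist_comm] at this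
    have hkk : ((k:ℝ) / (k+1)) * δ ≤ (((k:ℝ)+1) / (k+1+1) : ℝ) * δ := by
      gcongr ?_ * δ
      rw [div_le_div_iff₀ (by positivity) (by positivity)]
      nlinarith
    push_cast
    have h2 : Finsupp.supported ℚ ℚ (fine s' ((k / (k+1) : ℝ) * δ) k) ≤
        (Finsupp.supported ℚ ℚ (fine s ((((k:ℝ)+1) / (k+1+1) : ℝ) * δ) (k+1))).comap
          (cone (bary w)) := by
      rw [Finsupp.supported_eq_span_single, Submodule.span_le]
      rintro _ ⟨v, hv, rfl⟩
      simp only [Submodule.comap_coe, Set.mem_preimage, SetLike.mem_coe]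
      rw [cone_single]
      refine Finsupp.single_mem_supported _ _ ⟨fun a => ?_, fun a b => ?_⟩
      · refine Fin.cases ?_ (fun a => ?_) a
        · simpa using bary_mem w hs hw.1
        · simpa using hsub (hv.1 a)
      · refine Fin.cases ?_ (fun a => ?_) a <;> refine Fin.cases ?_ (fun b => ?_) b
        · simp; positivity
        · simpa using hb _ (hv.1 b)
        · have := hb _ (hv.1 a)
          rw [dist_comm]
          simpa using this
        · simpa using (hv.2 a b).trans hkk
    exact h2 h1

lemma Sd_fine' {m k : ℕ} {s : Set (Fin (m+1) → ℝ)} (hs : Convex ℝ s) {δ : ℝ} (hδ : 0 ≤ δ)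
    {c : LC m k} (hc : c ∈ Finsupp.supported ℚ ℚ (fine s δ k)) :
    Sd m k c ∈ Finsupp.supported ℚ ℚ (fine s ((k / (k+1) : ℝ) * δ) k) := by
  have : Finsupp.supported ℚ ℚ (fine s δ k) ≤
      (Finsupp.supported ℚ ℚ (fine s ((k / (k+1) : ℝ) * δ) k)).comap (Sd m k) := by
    rw [Finsupp.supported_eq_span_single, Submodule.span_le]
    rintro _ ⟨v, hv, rfl⟩
    exact Sd_fine hs hδ hv
  exact this hc

lemma Sd_iter_fine {m k : ℕ} {s : Set (Fin (m+1) → ℝ)} (hs : Convex ℝ s) {δ : ℝ} (hδ : 0 ≤ δ)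
    {c : LC m k} (hc : c ∈ Finsupp.supported ℚ ℚ (fine s δ k)) (r : ℕ) :
    (Sd m k)^[r] c ∈ Finsupp.supported ℚ ℚ (fine s ((k / (k+1) : ℝ)^r * δ) k) := by
  induction r with
  | zero => simpa using hc
  | succ r ih =>
    rw [Function.iterate_succ_apply']
    have := Sd_fine' hs (by positivity) ih
    convert this using 3
    ring

end

section
open CategoryTheory AlgebraicTopology

section
variable {M : Type} [TopologicalSpace M]

/-- small chains -/
def sml (U V : Set M) (k : ℕ) : Submodule ℚ (SC M k) := inn U k ⊔ inn V k

lemma fine_rl_sml {U V : Set M} {k : ℕ} (σ : C(Dl k, M)) {δ : ℝ}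
    (h : ∀ x : Dl k, (∀ y : Dl k, dist y x < δ → σ y ∈ U) ∨ (∀ y : Dl k, dist y x < δ → σ y ∈ V))
    {ε : ℝ} (hε : ε < δ) {c : LC k k} (hc : c ∈ Finsupp.supported ℚ ℚ (fine Set.univ ε k)) :
    rl σ k c ∈ sml U V k := by
  have : Finsupp.supported ℚ ℚ (fine Set.univ ε k) ≤ (sml U V k).comap (rl σ k) := by
    rw [Finsupp.supported_eq_span_single, Submodule.span_le]
    rintro _ ⟨w, hw, rfl⟩
    simp only [Submodule.comap_coe, Set.mem_preimage, SetLike.mem_coe]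
    rw [rl_single]
    have hd : ∀ t, dist (Aff w t) (w 0) < δ := by
      intro t
      refine lt_of_le_of_lt ?_ hε
      rw [Subtype.dist_eq, ← Metric.mem_closedBall, Aff_val]
      refine (convex_closedBall (w 0).1 ε).sum_mem (fun i _ => t.2.1 i) t.2.2 (fun i _ => ?_)
      rw [Metric.mem_closedBall]
      exact hw.2 i 0
    rcases h (w 0) with h | h
    · exact Submodule.mem_sup_left (Finsupp.single_mem_supported _ _ fun t => h _ (hd t))
    · exact Submodule.mem_sup_right (Finsupp.single_mem_supported _ _ fun t => h _ (hd t))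
  exact this hc

lemma sd_iter_rl {m : ℕ} (σ : C(Dl m, M)) {k : ℕ} (c : LC m k) (r : ℕ) :
    (sd M k)^[r] (rl σ k c) = rl σ k ((Sd m k)^[r] c) := by
  induction r with
  | zero => rfl
  | succ r ih => rw [Function.iterate_succ_apply', ih, sd_rl, Function.iterate_succ_apply']

lemma sd_iter_sml {U V : Set M} (hU : IsOpen U) (hV : IsOpen V) (hUV : U ∪ V = Set.univ) {k : ℕ}
    (c : SC M k) : ∀ᶠ r in Filter.atTop, (sd M k)^[r] c ∈ sml U V k := by
  induction c using Finsupp.induction_linear with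
  | zero =>
    refine Filter.Eventually.of_forall fun r => ?_
    have : (sd M k)^[r] 0 = 0 := Function.iterate_fixed (map_zero _) r
    rw [this]; exact Submodule.zero_mem _
  | add f g hf hg =>
    filter_upwards [hf, hg] with r h1 h2
    rw [← Module.End.coe_pow] at *
    rw [map_add]
    exact Submodule.add_mem _ h1 h2
  | single σ a =>
    obtain ⟨δ, hδ, h⟩ := lebesgue_number_lemma_of_metric (s := (Set.univ : Set (Dl k)))
      (c := fun b : Bool => if b then σ ⁻¹' U else σ ⁻¹' V) isCompact_univ
      (by rintro (_|_)
          · exact hV.preimage σ.continuous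
          · exact hU.preimage σ.continuous)
      (by
        intro x _
        have : σ x ∈ U ∪ V := by rw [hUV]; trivial
        rw [Set.mem_iUnion]
        rcases this with h | h
        · exact ⟨true, h⟩
        · exact ⟨false, h⟩)
    have h' : ∀ x : Dl k, (∀ y : Dl k, dist y x < δ → σ y ∈ U) ∨ (∀ y : Dl k, dist y x < δ → σ y ∈ V) := by
      intro x
      obtain ⟨b, hb⟩ := h x trivial
      cases b
      · right; intro y hy; exact hb hy
      · left; intro y hy; exact hb hy
    have hlim : Filter.Tendsto (fun r : ℕ => ((k / (k+1) : ℝ))^r * 1) Filter.atTop (nhds 0) := by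
      simp only [mul_one]
      apply tendsto_pow_atTop_nhds_zero_of_lt_one (by positivity)
      rw [div_lt_one (by positivity)]; linarith
    filter_upwards [hlim.eventually (gt_mem_nhds hδ)] with r hr
    have e : (Finsupp.single σ a : SC M k) = a • rl σ k (Finsupp.single (vt k) 1) := by
      rw [← single_eq_rl]; simp
    rw [e, ← Module.End.coe_pow, map_smul, Module.End.coe_pow, sd_iter_rl]
    refine Submodule.smul_mem _ _ (fine_rl_sml σ h' hr ?_)
    refine Sd_iter_fine convex_univ zero_le_one ?_ r
    refine Finsupp.single_mem_supported _ _ ⟨fun _ => trivial, fun i j => ?_⟩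
    refine (Metric.dist_le_diam_of_mem (bounded_stdSimplex _) (vt k i).2 (vt k j).2).trans ?_
    exact diam_stdSimplex_le

lemma sup_stab {U V : Set M} {k l : ℕ} (f : SC M k →ₗ[ℚ] SC M l)
    (h : ∀ W : Set M, ∀ c ∈ inn W k, f c ∈ inn W l) {c : SC M k} (hc : c ∈ sml U V k) :
    f c ∈ sml U V l := by
  obtain ⟨y, hy, z, hz, rfl⟩ := Submodule.mem_sup.1 hc
  rw [map_add]
  exact Submodule.add_mem_sup (h U y hy) (h V z hz)

lemma iter_homot {U V : Set M} {k : ℕ} (c : SC M (k+1)) (hc : sbd M k c ∈ sml U V k) (r : ℕ) :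
    ∃ e, ∃ s ∈ sml U V (k+1), (sd M (k+1))^[r] c = c - sbd M (k+1) e - s := by
  induction r with
  | zero => exact ⟨0, 0, Submodule.zero_mem _, by simp⟩
  | succ r ih =>
    obtain ⟨e, s, hs, h⟩ := ih
    have h1 := sbd_th c
    refine ⟨th M (k+1) c + sd M (k+2) e, th M k (sbd M k c) + sd M (k+1) s,
      Submodule.add_mem _ (sup_stab _ (fun W c h => th_inn h) hc)
      (sup_stab _ (fun W c h => sd_inn h) hs), ?_⟩
    rw [Function.iterate_succ_apply', h, map_sub, map_sub, ← sbd_sd, map_add, h1]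
    abel

lemma small_simplices {U V : Set M} (hU : IsOpen U) (hV : IsOpen V) (hUV : U ∪ V = Set.univ) {k : ℕ}
    (c : SC M (k+1)) (hc : sbd M k c ∈ sml U V k) : ∃ e, c - sbd M (k+1) e ∈ sml U V (k+1) := by
  obtain ⟨r, hr⟩ := (sd_iter_sml hU hV hUV c).exists
  obtain ⟨e, s, hs, h⟩ := iter_homot c hc r
  refine ⟨e, ?_⟩
  have : c - sbd M (k+1) e = (sd M (k+1))^[r] c + s := by rw [h]; abel
  rw [this]
  exact Submodule.add_mem _ hr hs

/-- The subcomplex of chains in U. -/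
def subU (U : Set M) : SubCC (sing M).cc where
  S n := inn U n
  stab n x hx := sbd_inn hx

lemma subU_inf (U V : Set M) (n : ℕ) : ((subU U).inf (subU V)).S n = inn (U ∩ V) n := by
  show inn U n ⊓ inn V n = _
  unfold inn
  rw [← Finsupp.supported_inter]
  congr 1
  ext σ
  exact ⟨fun h t => ⟨h.1 t, h.2 t⟩, fun h => ⟨fun t => (h t).1, fun t => (h t).2⟩⟩

lemma mv_quo {U V : Set M} (hU : IsOpen U) (hV : IsOpen V) (hUV : U ∪ V = Set.univ) :
    (((subU U).sup (subU V)).cc.Fin ↔ (sing M).cc.Fin) ∧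
      ((sing M).cc.Fin → ((subU U).sup (subU V)).cc.chi = (sing M).cc.chi) := by
  refine SubCC.acyclic_quo _ (fun n x hx => small_simplices hU hV hUV x hx) (fun x => ⟨0, ?_⟩)
  obtain ⟨r, hr⟩ := (sd_iter_sml hU hV hUV (k := 0) x).exists
  have hid : sd M 0 = LinearMap.id := by
    refine Finsupp.lhom_ext' (fun w => LinearMap.ext_ring ?_)
    simp only [LinearMap.comp_apply, Finsupp.lsingle_apply, LinearMap.id_apply]
    rw [single_eq_rl, sd_rl]
    rfl
  have : (sd M 0)^[r] x = x := Function.iterate_fixed (by rw [hid]; rfl) r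
  rw [this] at hr
  rw [map_zero, sub_zero]
  exact hr

end

end

section
open CategoryTheory AlgebraicTopology Simplicial

section
variable (M : Type) [TopologicalSpace M]

/-- comparison in each degree -/
def cmpf (n : ℕ) : ((TopCat.toSSet.obj (TopCat.of M)).obj (Opposite.op ⦋n⦌)) ≃ C(Dl n, M) :=
  (TopCat.of M).toSSetObjEquiv (Opposite.op ⦋n⦌)

lemma cmpf_face (n : ℕ) (i : Fin (n+2)) (x : (TopCat.toSSet.obj (TopCat.of M)).obj (Opposite.op ⦋n+1⦌)) :
    cmpf M n ((TopCat.toSSet.obj (TopCat.of M)).δ i x) =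
      (cmpf M (n+1) x).comp (Aff fun j => vt (n+1) (i.succAbove j)) := by
  ext t
  have : (Aff fun j => vt (n+1) (i.succAbove j)) t = stdSimplex.map (i.succAbove) t := by
    apply Subtype.ext
    rw [Aff_val]
    ext a
    have e : (stdSimplex.map i.succAbove t).1 a = (FunOnFinite.linearMap ℝ ℝ i.succAbove t.1) a := rfl
    rw [e, FunOnFinite.linearMap_apply_apply, Finset.sum_apply]
    simp only [Pi.smul_apply, smul_eq_mul, vt, stdSimplex.vertex_coe, Pi.single_apply]
    rw [Finset.sum_filter]
    refine Finset.sum_congr rfl fun j _ => ?_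
    rw [mul_ite, mul_one, mul_zero]
    simp only [eq_comm]
  rw [ContinuousMap.comp_apply, this]
  rfl

lemma objD_single (X : SSet.{0}) (j : ℕ) (x : X.obj (Opposite.op ⦋j+1⦌)) :
    (AlternatingFaceMapComplex.objD (((SimplicialObject.whiskering _ _).obj (ModuleCat.free ℚ)).obj X) j).hom
      (Finsupp.single x (1 : ℚ)) =
    ∑ i : Fin (j+2), (-1 : ℤ) ^ (i : ℕ) • Finsupp.single (X.δ i x) (1 : ℚ) := by
  unfold AlternatingFaceMapComplex.objD
  rw [ModuleCat.hom_sum]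
  erw [LinearMap.sum_apply]
  refine Finset.sum_congr rfl fun i _ => ?_
  rw [ModuleCat.hom_zsmul]
  erw [LinearMap.smul_apply]
  congr 1
  exact ModuleCat.free_map_apply ..

lemma cmp_single (j : ℕ) (x : (TopCat.toSSet.obj (TopCat.of M)).obj (Opposite.op ⦋j+1⦌)) :
    sbd M j (Finsupp.mapDomain (cmpf M (j+1)) (Finsupp.single x 1)) =
        Finsupp.mapDomain (cmpf M j) (∑ i : Fin (j+2), (-1 : ℤ) ^ (i : ℕ) • Finsupp.single ((TopCat.toSSet.obj (TopCat.of M)).δ i x) (1 : ℚ)) := by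
  rw [Finsupp.mapDomain_single, sbd_single, Finsupp.mapDomain_finset_sum]
  refine Finset.sum_congr rfl fun i _ => ?_
  rw [← Finsupp.mapDomain.addMonoidHom_apply, map_zsmul]
  rw [Finsupp.mapDomain.addMonoidHom_apply, Finsupp.mapDomain_single, cmpf_face]
  rw [← Int.cast_smul_eq_zsmul ℚ]
  push_cast
  rfl

/-- the comparison map -/
def cmp : singularChainComplex M ⟶ (sing M).cc.ch where
  f n := ModuleCat.ofHom (Finsupp.lmapDomain ℚ ℚ (cmpf M n))
  comm' := by
    rintro i j h
    simp only [ComplexShape.down_Rel] at h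
    subst h
    rw [CC.ch_d]
    have e : (singularChainComplex M).d (j+1) j =
      AlternatingFaceMapComplex.objD (((SimplicialObject.whiskering _ _).obj (ModuleCat.free ℚ)).obj (TopCat.toSSet.obj (TopCat.of M))) j :=
      AlgebraicTopology.alternatingFaceMapComplex_obj_d _ _
    rw [e]
    apply ModuleCat.hom_ext
    refine Finsupp.lhom_ext' (fun x => LinearMap.ext_ring ?_)
    refine (cmp_single M j x).trans ?_
    exact congrArg (Finsupp.mapDomain (cmpf M j)) (objD_single _ j x).symm

lemma cmp_iso (n : ℕ) : Nonempty (HS M n ≅ (sing M).cc.ch.homology n) := by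
  have : ∀ n, IsIso ((cmp M).f n) := fun n => (ConcreteCategory.isIso_iff_bijective _).2 (by
    have e := ((Finsupp.domLCongr (M := ℚ) (R := ℚ) (cmpf M n)).bijective)
    have : (Finsupp.domLCongr (M := ℚ) (R := ℚ) (cmpf M n) : _ → _) = Finsupp.mapDomain (cmpf M n) := by
      funext c; exact Finsupp.equivMapDomain_eq_mapDomain _ _
    rw [this] at e
    exact e)
  have : IsIso (cmp M) := HomologicalComplex.Hom.isIso_of_components _
  exact ⟨(HomologicalComplex.homologyFunctor _ _ n).mapIso (asIso (cmp M))⟩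

end

end

section
open CategoryTheory AlgebraicTopology

section
variable {M : Type} [TopologicalSpace M]

lemma sing_fin (M : Type) [TopologicalSpace M] : (sing M).cc.Fin ↔ FH M :=
  ⟨fun h => gfin_congr (fun n => ⟨(cmp_iso M n).some.symm⟩) h, fun h => gfin_congr (cmp_iso M) h⟩

lemma sing_chi (M : Type) [TopologicalSpace M] : (sing M).cc.chi = eulerChar M :=
  (gchi_congr (cmp_iso M)).symm

/-- inclusion of simplices -/
def incS (U : Set M) (n : ℕ) (τ : C(Dl n, U)) : C(Dl n, M) := (⟨Subtype.val, continuous_subtype_val⟩ : C(U, M)).comp τ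

lemma incS_inj (U : Set M) (n : ℕ) : Function.Injective (incS U n) := by
  intro a b h
  ext t
  exact ContinuousMap.congr_fun h t

lemma incS_mem (U : Set M) (n : ℕ) (c : SC U n) : Finsupp.lmapDomain ℚ ℚ (incS U n) c ∈ inn U n := by
  unfold inn
  rw [Finsupp.mem_supported]
  intro τ hτ
  classical
  have := Finsupp.mapDomain_support hτ
  simp only [Finset.mem_image] at this
  obtain ⟨w, _, rfl⟩ := this
  intro t
  exact (w t).2

lemma incS_bd (U : Set M) (n : ℕ) (c : SC U (n+1)) :
    sbd M n (Finsupp.lmapDomain ℚ ℚ (incS U (n+1)) c) = Finsupp.lmapDomain ℚ ℚ (incS U n) (sbd U n c) := by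
  suffices h : sbd M n ∘ₗ Finsupp.lmapDomain ℚ ℚ (incS U (n+1)) = Finsupp.lmapDomain ℚ ℚ (incS U n) ∘ₗ sbd U n from
    LinearMap.congr_fun h c
  refine Finsupp.lhom_ext' (fun x => LinearMap.ext_ring ?_)
  simp only [LinearMap.comp_apply, Finsupp.lsingle_apply]
  rw [sbd_single, map_sum, Finsupp.lmapDomain_apply, Finsupp.mapDomain_single, sbd_single]
  refine Finset.sum_congr rfl fun i _ => ?_
  rw [map_smul, Finsupp.lmapDomain_apply, Finsupp.mapDomain_single]
  rfl

/-- chains in U as a subcomplex -/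
def incHom (U : Set M) (A : SubCC (sing M).cc) (h : ∀ n, A.S n = inn U n) : CCHom (sing U).cc A.cc where
  f n := LinearMap.codRestrict (A.S n) (Finsupp.lmapDomain ℚ ℚ (incS U n)) (fun c => by rw [h]; exact incS_mem U n c)
  comm n x := Subtype.ext (incS_bd U n x)

lemma incHom_bij (U : Set M) (A : SubCC (sing M).cc) (h : ∀ n, A.S n = inn U n) (n : ℕ) :
    Function.Bijective ((incHom U A h).f n) := by
  constructor
  · intro a b hab
    exact Finsupp.mapDomain_injective (incS_inj U n) (congrArg Subtype.val hab)
  · rintro ⟨c, hc⟩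
    have hc' : c ∈ inn U n := by rw [← h]; exact hc
    have : inn U n ≤ LinearMap.range (Finsupp.lmapDomain ℚ ℚ (incS U n)) := by
      unfold inn
      rw [Finsupp.supported_eq_span_single, Submodule.span_le]
      rintro _ ⟨σ, hσ, rfl⟩
      refine ⟨Finsupp.single (⟨fun t => ⟨σ t, hσ t⟩, by fun_prop⟩) 1, ?_⟩
      rw [Finsupp.lmapDomain_apply, Finsupp.mapDomain_single]
      rfl
    obtain ⟨y, hy⟩ := this hc'
    exact ⟨y, Subtype.ext hy⟩

lemma subU_fin (U : Set M) (A : SubCC (sing M).cc) (h : ∀ n, A.S n = inn U n) : A.cc.Fin ↔ FH U := by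
  rw [← sing_fin]
  exact ⟨fun hh => gfin_congr (fun n => ⟨(CC.iso_congr _ (incHom_bij U A h) n).some.symm⟩) hh,
    fun hh => gfin_congr (CC.iso_congr _ (incHom_bij U A h)) hh⟩

lemma subU_chi (U : Set M) (A : SubCC (sing M).cc) (h : ∀ n, A.S n = inn U n) : A.cc.chi = eulerChar U := by
  rw [← sing_chi]
  exact (gchi_congr (CC.iso_congr _ (incHom_bij U A h))).symm

lemma mvT_down {U V : Set M} (hU : IsOpen U) (hV : IsOpen V) (hUV : U ∪ V = Set.univ)
    (h : FH M) (h2 : FH V) (h3 : FH ↥(U ∩ V)) :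
    FH U ∧ eulerChar M + eulerChar ↥(U ∩ V) = eulerChar U + eulerChar V := by
  obtain ⟨q1, q2⟩ := mv_quo hU hV hUV
  have h' := (sing_fin M).2 h
  have := SubCC.mv_down (subU U) (subU V) (q1.2 h') ((subU_fin V _ fun _ => rfl).2 h2)
    ((subU_fin (U ∩ V) _ (subU_inf U V)).2 h3)
  rw [q2 h', subU_chi U (subU U) fun _ => rfl, subU_chi V (subU V) fun _ => rfl, subU_chi (U ∩ V) _ (subU_inf U V),
    sing_chi, subU_fin U (subU U) fun _ => rfl] at this
  exact this

lemma mvT_up {U V : Set M} (hU : IsOpen U) (hV : IsOpen V) (hUV : U ∪ V = Set.univ)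
    (h : FH U) (h2 : FH V) (h3 : FH ↥(U ∩ V)) :
    FH M ∧ eulerChar M + eulerChar ↥(U ∩ V) = eulerChar U + eulerChar V := by
  obtain ⟨q1, q2⟩ := mv_quo hU hV hUV
  have := SubCC.mv_up (subU U) (subU V) ((subU_fin U _ fun _ => rfl).2 h) ((subU_fin V _ fun _ => rfl).2 h2)
    ((subU_fin (U ∩ V) _ (subU_inf U V)).2 h3)
  have h' := q1.1 this.1
  rw [q2 h', subU_chi U (subU U) fun _ => rfl, subU_chi V (subU V) fun _ => rfl, subU_chi (U ∩ V) _ (subU_inf U V),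
    sing_chi, q1, sing_fin] at this
  exact this

lemma FH_homeo {X Y : Type} [TopologicalSpace X] [TopologicalSpace Y] (e : X ≃ₜ Y) :
    (FH X → FH Y) ∧ eulerChar X = eulerChar Y :=
  ⟨FH_congr e.toHomotopyEquiv, eulerChar_congr e.toHomotopyEquiv⟩

/-- subset of subset -/
def subsubHomeo (U W : Set M) (h : U ⊆ W) : ↥(Subtype.val ⁻¹' U : Set W) ≃ₜ ↥U where
  toFun x := ⟨x.1.1, x.2⟩
  invFun x := ⟨⟨x.1, h x.2⟩, x.2⟩
  left_inv x := rfl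
  right_inv x := rfl
  continuous_toFun := by fun_prop
  continuous_invFun := by fun_prop

/-- Mayer-Vietoris for open subsets. -/
lemma mvS_down {U V W : Set M} (hU : IsOpen U) (hV : IsOpen V) (hW : U ∪ V = W)
    (h : FH W) (h2 : FH V) (h3 : FH ↥(U ∩ V)) :
    FH U ∧ eulerChar W + eulerChar ↥(U ∩ V) = eulerChar U + eulerChar V := by
  subst hW
  have eU := FH_homeo (subsubHomeo U (U ∪ V) Set.subset_union_left)
  have eV := FH_homeo (subsubHomeo V (U ∪ V) Set.subset_union_right)
  have eI := FH_homeo (subsubHomeo (U ∩ V) (U ∪ V) (fun x hx => Or.inl hx.1))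
  have eV' := FH_homeo (subsubHomeo V (U ∪ V) Set.subset_union_right).symm
  have eI' := FH_homeo (subsubHomeo (U ∩ V) (U ∪ V) (fun x hx => Or.inl hx.1)).symm
  have := mvT_down (M := ↥(U ∪ V)) (U := Subtype.val ⁻¹' U) (V := Subtype.val ⁻¹' V)
    (hU.preimage continuous_subtype_val) (hV.preimage continuous_subtype_val)
    (Set.eq_univ_of_forall fun x => x.2) h (eV'.1 h2) (by rw [← Set.preimage_inter]; exact eI'.1 h3)
  refine ⟨eU.1 this.1, ?_⟩
  rw [← eU.2, ← eV.2, ← eI.2]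
  exact this.2

lemma mvS_up {U V W : Set M} (hU : IsOpen U) (hV : IsOpen V) (hW : U ∪ V = W)
    (h : FH U) (h2 : FH V) (h3 : FH ↥(U ∩ V)) :
    FH W ∧ eulerChar W + eulerChar ↥(U ∩ V) = eulerChar U + eulerChar V := by
  subst hW
  have eU := FH_homeo (subsubHomeo U (U ∪ V) Set.subset_union_left)
  have eV := FH_homeo (subsubHomeo V (U ∪ V) Set.subset_union_right)
  have eI := FH_homeo (subsubHomeo (U ∩ V) (U ∪ V) (fun x hx => Or.inl hx.1))
  have eU' := FH_homeo (subsubHomeo U (U ∪ V) Set.subset_union_left).symm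
  have eV' := FH_homeo (subsubHomeo V (U ∪ V) Set.subset_union_right).symm
  have eI' := FH_homeo (subsubHomeo (U ∩ V) (U ∪ V) (fun x hx => Or.inl hx.1)).symm
  have := mvT_up (M := ↥(U ∪ V)) (U := Subtype.val ⁻¹' U) (V := Subtype.val ⁻¹' V)
    (hU.preimage continuous_subtype_val) (hV.preimage continuous_subtype_val)
    (Set.eq_univ_of_forall fun x => x.2) (eU'.1 h) (eV'.1 h2) (by rw [← Set.preimage_inter]; exact eI'.1 h3)
  refine ⟨this.1, ?_⟩
  rw [← eU.2, ← eV.2, ← eI.2]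
  exact this.2

lemma FH_empty (X : Type) [TopologicalSpace X] [IsEmpty X] : FH X ∧ eulerChar X = 0 := by
  rw [← sing_fin, ← sing_chi]
  have : ∀ n, Subsingleton ((sing X).cc.X n) := fun n => by
    have : IsEmpty C(Dl n, X) := ⟨fun f => isEmptyElim (f (vt n 0))⟩
    show Subsingleton (SC X n)
    infer_instance
  exact CC.acyclic _ (fun n x _ => ⟨0, Subsingleton.elim _ _⟩) (fun x => ⟨0, Subsingleton.elim _ _⟩)

lemma CC.pointlike (K : CC) (hd : K.d 0 = 0) (h : ∀ n x, K.d n x = 0 → ∃ y, K.d (n+1) y = x)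
    [Module.Finite ℚ (K.X 0)] :
    K.Fin ∧ K.chi = Module.finrank ℚ (K.X 0) := by
  have key : ∀ n, Limits.IsZero (K.ch.homology (n+1)) := by
    intro n
    rw [← HomologicalComplex.exactAt_iff_isZero_homology]
    rw [HomologicalComplex.exactAt_iff' K.ch (n+2) (n+1) n (by simp) (by simp)]
    rw [ShortComplex.moduleCat_exact_iff]
    intro x hx
    obtain ⟨y, hy⟩ := h n x
      ((LinearMap.congr_fun (congrArg ModuleCat.Hom.hom (K.ch_d n)) x).symm.trans hx)
    exact ⟨y, (LinearMap.congr_fun (congrArg ModuleCat.Hom.hom (K.ch_d (n+1))) y).trans hy⟩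
  have hz : ∀ n, 1 ≤ n → Module.finrank ℚ (K.ch.homology n) = 0 := fun n hn => by
    obtain ⟨n, rfl⟩ : ∃ m, n = m + 1 := ⟨n - 1, by omega⟩
    have := ModuleCat.subsingleton_of_isZero (key n)
    exact Module.finrank_zero_of_subsingleton
  have h1 : IsIso (K.ch.homologyπ 0) := by
    refine K.ch.isIso_homologyπ 1 0 (by simp) ?_
    rw [CC.ch_d, hd]; rfl
  have h2 : IsIso (K.ch.iCycles 0) := by
    refine K.ch.isIso_iCycles 0 0 (by simp) ?_
    exact K.ch.shape _ _ (by simp)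
  let e : K.ch.homology 0 ≅ K.ch.X 0 := (asIso (K.ch.homologyπ 0)).symm ≪≫ asIso (K.ch.iCycles 0)
  have e' : K.ch.homology 0 ≃ₗ[ℚ] K.X 0 := e.toLinearEquiv
  refine ⟨⟨fun n => ?_, 1, hz⟩, ?_⟩
  · cases n with
    | zero => exact Module.Finite.equiv e'.symm
    | succ n =>
      have := ModuleCat.subsingleton_of_isZero (key n)
      infer_instance
  · show gchi _ = _
    rw [gchi_eq _ 1 hz]
    simp [e'.finrank_eq]

lemma sum_alt (n : ℕ) : ∑ i : Fin n, (-1 : ℚ) ^ (i : ℕ) = if Even n then 0 else 1 := by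
  rw [Fin.sum_univ_eq_sum_range (fun i => (-1 : ℚ)^i), neg_one_geom_sum]

lemma FH_unique (X : Type) [TopologicalSpace X] [Unique X] : FH X ∧ eulerChar X = 1 := by
  rw [← sing_fin, ← sing_chi]
  have hu : ∀ n (a b : C(Dl n, X)), a = b := fun n a b => by ext t; exact Subsingleton.elim _ _
  let c : ∀ n, C(Dl n, X) := fun n => ContinuousMap.const _ default
  have hs : ∀ n (x : SC X n), ∃ q : ℚ, x = q • Finsupp.single (c n) 1 := fun n x => by
    refine ⟨x (c n), ?_⟩
    ext a
    rw [hu n a (c n)]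
    simp
  have hb : ∀ n, sbd X n (Finsupp.single (c (n+1)) 1) = (if Even n then 0 else 1 : ℚ) • Finsupp.single (c n) 1 := by
    intro n
    rw [sbd_single]
    simp_rw [hu n _ (c n)]
    rw [← Finset.sum_smul, sum_alt]
    simp [Nat.even_add]
  have hf : Module.finrank ℚ (SC X 0) = 1 := by
    have : Unique C(Dl 0, X) := ⟨⟨c 0⟩, fun a => hu _ _ _⟩
    rw [LinearEquiv.finrank_eq (Finsupp.uniqueLinearEquiv ℚ ℚ (c 0))]
    simp
  have : Module.Finite ℚ ((sing X).cc.X 0) := Module.finite_of_finrank_eq_succ (n := 0) hf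
  have := CC.pointlike (sing X).cc ?_ ?_
  · rw [show Module.finrank ℚ ((sing X).cc.X 0) = 1 from hf] at this
    exact_mod_cast this
  · refine LinearMap.ext fun x => ?_
    obtain ⟨q, rfl⟩ := hs 1 x
    show sbd X 0 _ = 0
    rw [map_smul, hb]; simp
  · intro n x hx
    obtain ⟨q, rfl⟩ := hs (n+1) x
    have hx' : sbd X n (q • Finsupp.single (c (n+1)) 1) = 0 := hx
    rw [map_smul, hb] at hx'
    by_cases hn : Even n
    · have h5 : sbd X (n+1) (q • Finsupp.single (c (n+2)) 1) = q • Finsupp.single (c (n+1)) 1 := by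
        rw [map_smul, hb]
        simp [Nat.even_add_one, hn]
      exact ⟨_, h5⟩
    · refine ⟨0, ?_⟩
      rw [map_zero]
      have : q = 0 := by
        have := DFunLike.congr_fun hx' (c n)
        simpa [hn] using this
      rw [this, zero_smul]; rfl

end

end

section
open CategoryTheory AlgebraicTopology
set_option linter.unusedSectionVars false

lemma retract_he {E : Type} [NormedAddCommGroup E] [NormedSpace ℝ E] (Z : Set E) {Y : Type} [TopologicalSpace Y]
    (p : C(Z, Y)) (s : C(Y, Z)) (h : ∀ y, p (s y) = y)
    (hseg : ∀ z : Z, ∀ t : ℝ, 0 ≤ t → t ≤ 1 → (1 - t) • (z : E) + t • (s (p z) : E) ∈ Z) :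
    Nonempty (ContinuousMap.HomotopyEquiv Z Y) := by
  refine ⟨⟨p, s, ?_, ?_⟩⟩
  · refine ContinuousMap.Homotopic.symm ⟨⟨⟨fun q => ⟨(1 - (q.1 : ℝ)) • (q.2 : E) + (q.1 : ℝ) • (s (p q.2) : E),
      hseg q.2 q.1 q.1.2.1 q.1.2.2⟩, by fun_prop⟩, ?_, ?_⟩⟩
    · intro z; apply Subtype.ext; simp
    · intro z; apply Subtype.ext; simp
  · have : p.comp s = ContinuousMap.id Y := by ext y; exact h y
    rw [this]

section
variable {σ : Type} [DecidableEq σ] {V : Type} [NormedAddCommGroup V] [NormedSpace ℂ V]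

/-- arrangement complement -/
def AX (S : Finset σ) (a : σ → V →L[ℂ] ℂ) (b : σ → ℂ) : Set V := {x | ∀ i ∈ S, a i x + b i ≠ 0}

/-- restriction to a hyperplane, as a subset of `V` -/
def AY (S : Finset σ) (H : σ) (a : σ → V →L[ℂ] ℂ) (b : σ → ℂ) : Set V :=
  {x | a H x + b H = 0 ∧ x ∈ AX (S.erase H) a b}

/-- projection to the hyperplane -/
def prj (H : σ) (a : σ → V →L[ℂ] ℂ) (b : σ → ℂ) (v : V) (x : V) : V := x - (a H x + b H) • v

/-- tubular neighbourhood pieces -/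
def TC (S : Finset σ) (H : σ) (a : σ → V →L[ℂ] ℂ) (b : σ → ℂ) (v : V) (C : Set ℂ) : Set V :=
  {x | (∀ i ∈ S.erase H, ‖a H x + b H‖ * ‖a i v‖ < ‖a i (prj H a b v x) + b i‖) ∧ a H x + b H ∈ C}

variable {S : Finset σ} {H : σ} {a : σ → V →L[ℂ] ℂ} {b : σ → ℂ} {v : V}

lemma prj_cont : Continuous (prj H a b v) := by unfold prj; fun_prop

lemma prj_H (hv : a H v = 1) (x : V) : a H (prj H a b v x) + b H = 0 := by
  unfold prj; rw [map_sub, map_smul, hv]; simp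

lemma prj_add (x : V) (i : σ) : a i x + b i = (a i (prj H a b v x) + b i) + (a H x + b H) * a i v := by
  unfold prj; rw [map_sub, map_smul, smul_eq_mul]; ring

lemma prj_line (hv : a H v = 1) (y : V) (hy : a H y + b H = 0) (c : ℂ) :
    a H (y + c • v) + b H = c ∧ prj H a b v (y + c • v) = y := by
  have h1 : a H (y + c • v) + b H = c := by
    rw [map_add, map_smul, hv, smul_eq_mul, mul_one, add_right_comm, hy, zero_add]
  refine ⟨h1, ?_⟩
  unfold prj
  rw [h1]; abel

lemma AX_open : IsOpen (AX S a b) := by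
  have : AX S a b = ⋂ i ∈ S, {x | a i x + b i ≠ 0} := by ext x; simp [AX]
  rw [this]
  exact isOpen_biInter_finset fun i _ => isOpen_ne_fun (by fun_prop) continuous_const

lemma TC_open {C : Set ℂ} (hC : IsOpen C) : IsOpen (TC S H a b v C) := by
  have : TC S H a b v C = (⋂ i ∈ S.erase H, {x | ‖a H x + b H‖ * ‖a i v‖ < ‖a i (prj H a b v x) + b i‖}) ∩
    (fun x => a H x + b H) ⁻¹' C := by ext x; simp [TC]
  rw [this]
  refine (isOpen_biInter_finset fun i _ => ?_).inter (hC.preimage (by fun_prop))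
  have := prj_cont (H := H) (a := a) (b := b) (v := v)
  exact isOpen_lt (by fun_prop) (by fun_prop)

/-- the small radius -/
def rad (S : Finset σ) (H : σ) (a : σ → V →L[ℂ] ℂ) (b : σ → ℂ) (v : V) (y : V) : ℝ :=
  (1 + ∑ i ∈ S.erase H, ‖a i v‖ / ‖a i y + b i‖)⁻¹

lemma rad_pos (y : V) : 0 < rad S H a b v y := by
  unfold rad; positivity

lemma rad_lt {y : V} (hy : y ∈ AX (S.erase H) a b) {i : σ} (hi : i ∈ S.erase H) :
    rad S H a b v y * ‖a i v‖ < ‖a i y + b i‖ := by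
  have h0 : 0 < ‖a i y + b i‖ := norm_pos_iff.2 (hy i hi)
  unfold rad
  rw [inv_mul_lt_iff₀ (by positivity), ← div_lt_iff₀ h0]
  have := Finset.single_le_sum (f := fun i => ‖a i v‖ / ‖a i y + b i‖) (fun i _ => by positivity) hi
  linarith

lemma TC_he (hv : a H v = 1) {C : Set ℂ} (θ : ℂ) (hθ : ‖θ‖ ≤ 1) (h1 : ∀ r : ℝ, 0 < r → (r : ℂ) * θ ∈ C)
    (h2 : ∀ r : ℝ, 0 < r → ∀ z ∈ C, ∀ t : ℝ, 0 ≤ t → t ≤ 1 → (1 - t : ℂ) * z + t * (r * θ) ∈ C) :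
    Nonempty (ContinuousMap.HomotopyEquiv (TC S H a b v C) (AY S H a b)) := by
  letI : NormedSpace ℝ V := NormedSpace.restrictScalars ℝ ℂ V
  have hY : ∀ x ∈ TC S H a b v C, prj H a b v x ∈ AY S H a b := fun x hx => ⟨prj_H hv x, fun i hi h0 => by
    have := hx.1 i hi
    rw [h0, norm_zero] at this
    exact absurd this (not_lt.2 (by positivity))⟩
  have key : ∀ y ∈ AY S H a b, ∀ c ∈ C, (∀ i ∈ S.erase H, ‖c‖ * ‖a i v‖ < ‖a i y + b i‖) → y + c • v ∈ TC S H a b v C := by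
    intro y hy c hc hlt
    obtain ⟨e1, e2⟩ := prj_line (a := a) (b := b) hv y hy.1 c
    refine ⟨?_, ?_⟩
    · rw [e1, e2]; exact hlt
    · rw [e1]; exact hc
  have hr : ∀ y ∈ AY S H a b, ∀ i ∈ S.erase H, ‖(rad S H a b v y : ℂ) * θ‖ * ‖a i v‖ < ‖a i y + b i‖ := by
    intro y hy i hi
    refine lt_of_le_of_lt ?_ (rad_lt (v := v) hy.2 hi)
    rw [norm_mul, Complex.norm_real, Real.norm_of_nonneg (rad_pos y).le]
    exact mul_le_mul_of_nonneg_right (mul_le_of_le_one_right (rad_pos y).le hθ) (norm_nonneg _)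
  have hpc := prj_cont (H := H) (a := a) (b := b) (v := v)
  let p : C(TC S H a b v C, AY S H a b) := ⟨fun x => ⟨prj H a b v x, hY x x.2⟩, by fun_prop⟩
  have hrc : Continuous (fun y : AY S H a b => rad S H a b v (y : V)) := by
    unfold rad
    refine Continuous.inv₀ ?_ (fun y => ?_)
    · refine continuous_const.add (continuous_finsetSum _ fun i hi => ?_)
      refine Continuous.div continuous_const (by fun_prop) (fun y => ?_)
      exact norm_ne_zero_iff.2 (y.2.2 i hi)
    · have : 0 < 1 + ∑ i ∈ S.erase H, ‖a i v‖ / ‖a i y + b i‖ := by positivity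
      exact this.ne'
  let s : C(AY S H a b, TC S H a b v C) := ⟨fun y => ⟨(y : V) + ((rad S H a b v y : ℂ) * θ) • v,
    key y y.2 _ (h1 _ (rad_pos _)) (hr y y.2)⟩, by
      have : Continuous (fun y : AY S H a b => ((rad S H a b v (y:V) : ℝ) : ℂ)) := Complex.continuous_ofReal.comp hrc
      fun_prop⟩
  refine retract_he (TC S H a b v C) p s ?_ ?_
  · intro y
    exact Subtype.ext (prj_line hv y.1 y.2.1 _).2
  · intro x t ht0 ht1
    set y := prj H a b v x with hy
    set c := a H x.1 + b H with hc
    set e := (rad S H a b v y : ℂ) * θ with he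
    have hx : (x : V) = y + c • v := by rw [hy, prj]; simp [hc]
    have hyY := hY x x.2
    have : (1 - t) • (x : V) + t • (s (p x) : V) = y + ((1 - t : ℂ) * c + t * e) • v := by
      have e1 : (s (p x) : V) = y + e • v := rfl
      have e2 : ∀ (r : ℝ) (z : V), r • z = (r : ℂ) • z := fun r z => rfl
      rw [e1, hx, e2, e2]
      clear_value e c y
      push_cast
      module
    rw [this]
    refine key y hyY _ (h2 _ (rad_pos _) _ x.2.2 t ht0 ht1) (fun i hi => ?_)
    have b1 := x.2.1 i hi
    have b2 := hr y hyY i hi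
    rw [← hc] at b1
    have n1 : ‖(1 - t : ℂ) * c + t * e‖ ≤ (1 - t) * ‖c‖ + t * ‖e‖ := by
      refine (norm_add_le _ _).trans (le_of_eq ?_)
      rw [norm_mul, norm_mul, ← Complex.ofReal_one, ← Complex.ofReal_sub, Complex.norm_real, Complex.norm_real,
        Real.norm_of_nonneg ht0, Real.norm_of_nonneg (by linarith)]
    refine lt_of_le_of_lt (mul_le_mul_of_nonneg_right n1 (norm_nonneg _)) ?_
    have : ((1 - t) * ‖c‖ + t * ‖e‖) * ‖a i v‖ = (1 - t) * (‖c‖ * ‖a i v‖) + t * (‖e‖ * ‖a i v‖) := by ring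
    rw [this]
    rcases eq_or_lt_of_le ht0 with h0 | h0
    · rw [← h0]; simpa using b1
    · have q1 : (1 - t) * (‖c‖ * ‖a i v‖) ≤ (1 - t) * ‖a i y + b i‖ :=
        mul_le_mul_of_nonneg_left b1.le (by linarith)
      have q2 : t * (‖e‖ * ‖a i v‖) < t * ‖a i y + b i‖ := mul_lt_mul_of_pos_left b2 h0
      linarith

lemma TC_FH (hv : a H v = 1) (h : FH (AY S H a b)) {C : Set ℂ} (θ : ℂ) (hθ : ‖θ‖ ≤ 1) (h1 : ∀ r : ℝ, 0 < r → (r : ℂ) * θ ∈ C)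
    (h2 : ∀ r : ℝ, 0 < r → ∀ z ∈ C, ∀ t : ℝ, 0 ≤ t → t ≤ 1 → (1 - t : ℂ) * z + t * (r * θ) ∈ C) :
    FH (TC S H a b v C) ∧ eulerChar (TC S H a b v C) = eulerChar (AY S H a b) := by
  obtain ⟨e⟩ := TC_he (S := S) (b := b) hv θ hθ h1 h2
  exact ⟨FH_congr e.symm h, eulerChar_congr e⟩

lemma TC_inter (C D : Set ℂ) : TC S H a b v C ∩ TC S H a b v D = TC S H a b v (C ∩ D) := by
  ext x
  exact ⟨fun h => ⟨h.1.1, h.1.2, h.2.2⟩, fun h => ⟨⟨h.1, h.2.1⟩, ⟨h.1, h.2.2⟩⟩⟩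

lemma TC_union (C D : Set ℂ) : TC S H a b v C ∪ TC S H a b v D = TC S H a b v (C ∪ D) := by
  ext x
  constructor
  · rintro (h | h)
    · exact ⟨h.1, Or.inl h.2⟩
    · exact ⟨h.1, Or.inr h.2⟩
  · rintro ⟨h, h' | h'⟩
    · exact Or.inl ⟨h, h'⟩
    · exact Or.inr ⟨h, h'⟩

lemma TC_univ (hv : a H v = 1) (h : FH (AY S H a b)) : FH (TC S H a b v Set.univ) ∧
    eulerChar (TC S H a b v Set.univ) = eulerChar (AY S H a b) :=
  TC_FH hv h 0 (by simp) (fun _ _ => trivial) (fun _ _ _ _ _ _ _ => trivial)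

lemma slit1 (r : ℝ) (hr : 0 < r) (z : ℂ) (hz : z ∈ Complex.slitPlane) (t : ℝ) (h0 : 0 ≤ t) (h1 : t ≤ 1) :
    (1 - t : ℂ) * z + t * r ∈ Complex.slitPlane := by
  rw [Complex.mem_slitPlane_iff] at *
  simp only [Complex.add_re, Complex.mul_re, Complex.sub_re, Complex.one_re, Complex.ofReal_re, Complex.sub_im,
    Complex.one_im, Complex.ofReal_im, Complex.add_im, Complex.mul_im]
  rcases eq_or_lt_of_le h1 with rfl | h1
  · left; simpa using hr
  · rcases hz with hz | hz
    · left
      have : 0 < (1 - t) * z.re := mul_pos (by linarith) hz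
      have : 0 ≤ t * r := by positivity
      linarith
    · right
      have : (1 - t) * z.im ≠ 0 := mul_ne_zero (by linarith) hz
      simpa using this

lemma TC_punct (hv : a H v = 1) (h : FH (AY S H a b)) : FH (TC S H a b v {0}ᶜ) ∧
    eulerChar (TC S H a b v {0}ᶜ) = 0 := by
  have hA := TC_FH (S := S) (b := b) hv h (C := Complex.slitPlane) 1 (by simp)
    (fun r hr => by simp [hr]) (fun r hr z hz t h0 h1 => by rw [mul_one]; exact slit1 r hr z hz t h0 h1)
  have hB := TC_FH (S := S) (b := b) hv h (C := {z | -z ∈ Complex.slitPlane}) (-1) (by simp)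
    (fun r hr => by simp [hr]) (fun r hr z hz t h0 h1 => by
      have := slit1 r hr (-z) hz t h0 h1
      show -_ ∈ Complex.slitPlane
      convert this using 1; ring)
  have hC := TC_FH (S := S) (b := b) hv h (C := {z | 0 < z.im}) Complex.I (by simp)
    (fun r hr => by simp [hr]) (fun r hr z hz t h0 h1 => by
      simp only [Set.mem_ofPred_eq] at *
      simp only [Complex.mul_re, Complex.sub_re, Complex.one_re, Complex.ofReal_re, Complex.sub_im,
        Complex.one_im, Complex.ofReal_im, Complex.add_im, Complex.mul_im, Complex.I_re, Complex.I_im]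
      rcases eq_or_lt_of_le h1 with rfl | h1
      · simpa using hr
      · have : 0 < (1 - t) * z.im := mul_pos (by linarith) hz
        have : 0 ≤ t * r := by positivity
        linarith)
  have hD := TC_FH (S := S) (b := b) hv h (C := {z | z.im < 0}) (-Complex.I) (by simp)
    (fun r hr => by simp [hr]) (fun r hr z hz t h0 h1 => by
      simp only [Set.mem_ofPred_eq] at *
      simp only [Complex.mul_re, Complex.sub_re, Complex.one_re, Complex.ofReal_re, Complex.sub_im,
        Complex.one_im, Complex.ofReal_im, Complex.add_im, Complex.mul_im, Complex.I_re, Complex.I_im, Complex.neg_re, Complex.neg_im]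
      rcases eq_or_lt_of_le h1 with rfl | h1
      · simpa using hr
      · have : (1 - t) * z.im < 0 := mul_neg_of_pos_of_neg (by linarith) hz
        have : 0 ≤ t * r := by positivity
        linarith)
  have oA : IsOpen Complex.slitPlane := Complex.isOpen_slitPlane
  have oB : IsOpen {z : ℂ | -z ∈ Complex.slitPlane} := oA.preimage continuous_neg
  have oC : IsOpen {z : ℂ | 0 < z.im} := isOpen_lt continuous_const Complex.continuous_im
  have oD : IsOpen {z : ℂ | z.im < 0} := isOpen_lt Complex.continuous_im continuous_const
  have hE : IsEmpty ↥(TC S H a b v {z | 0 < z.im} ∩ TC S H a b v {z | z.im < 0}) :=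
    ⟨fun x => by
      have q1 : 0 < (a H x.1 + b H).im := x.2.1.2
      have q2 : (a H x.1 + b H).im < 0 := x.2.2.2
      linarith⟩
  have e0 := FH_empty ↥(TC S H a b v {z | 0 < z.im} ∩ TC S H a b v {z | z.im < 0})
  have m1 := mvS_up (TC_open oC) (TC_open oD) (TC_union _ _) hC.1 hD.1 e0.1
  have i1 : TC S H a b v Complex.slitPlane ∩ TC S H a b v {z | -z ∈ Complex.slitPlane} =
      TC S H a b v ({z | 0 < z.im} ∪ {z | z.im < 0}) := by
    rw [TC_inter]; congr 1
    ext z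
    simp only [Set.mem_inter_iff, Set.mem_union, Set.mem_ofPred_eq, Complex.mem_slitPlane_iff, Complex.neg_re, Complex.neg_im]
    constructor
    · rintro ⟨p, q⟩
      by_contra hc
      push Not at hc
      have : z.im = 0 := by linarith [hc.1, hc.2]
      simp [this] at p q
      linarith
    · rintro (p | p)
      · exact ⟨Or.inr p.ne', Or.inr (by simpa using p.ne')⟩
      · exact ⟨Or.inr p.ne, Or.inr (by simpa using p.ne)⟩
  have i2 : TC S H a b v Complex.slitPlane ∪ TC S H a b v {z | -z ∈ Complex.slitPlane} = TC S H a b v {0}ᶜ := by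
    rw [TC_union]; congr 1
    ext z
    simp only [Set.mem_union, Set.mem_ofPred_eq, Complex.mem_slitPlane_iff, Complex.neg_re, Complex.neg_im, Set.mem_compl_iff,
      Set.mem_singleton_iff]
    constructor
    · rintro h rfl; simp at h
    · intro h
      by_contra hc
      push Not at hc
      apply h
      apply Complex.ext
      · simp; linarith [hc.1.1, hc.2.1]
      · simp [hc.1.2]
  have m2 := mvS_up (TC_open oA) (TC_open oB) i2 hA.1 hB.1 (by rw [i1]; exact m1.1)
  refine ⟨m2.1, ?_⟩
  have e1 := m2.2
  rw [i1] at e1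
  linarith [m1.2, e0.2, hA.2, hB.2, hC.2, hD.2]

/-- Deletion-restriction. -/
lemma delres (hH : H ∈ S) (hv : a H v = 1) (hY : FH (AY S H a b)) (hX : FH (AX (S.erase H) a b)) :
    FH (AX S a b) ∧ eulerChar (AX S a b) = eulerChar (AX (S.erase H) a b) - eulerChar (AY S H a b) := by
  have hT := TC_univ (S := S) (b := b) hv hY
  have hP := TC_punct (S := S) (b := b) hv hY
  have sub : TC S H a b v Set.univ ⊆ AX (S.erase H) a b := by
    intro x hx i hi h0
    have h1 := hx.1 i hi
    rw [prj_add (H := H) (v := v)] at h0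
    rw [← norm_mul] at h1
    rw [add_eq_zero_iff_eq_neg.1 h0, norm_neg] at h1
    exact lt_irrefl _ h1
  have i1 : AX S a b ∩ TC S H a b v Set.univ = TC S H a b v {0}ᶜ := by
    ext x
    constructor
    · rintro ⟨h1, h2⟩
      exact ⟨h2.1, h1 H hH⟩
    · rintro ⟨h1, h2⟩
      have h3 : x ∈ TC S H a b v Set.univ := ⟨h1, trivial⟩
      refine ⟨fun i hi => ?_, h3⟩
      by_cases e : i = H
      · rw [e]; exact h2
      · exact sub h3 i (Finset.mem_erase.2 ⟨e, hi⟩)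
  have i2 : AX S a b ∪ TC S H a b v Set.univ = AX (S.erase H) a b := by
    ext x
    constructor
    · rintro (h | h)
      · exact fun i hi => h i (Finset.mem_of_mem_erase hi)
      · exact sub h
    · intro h
      by_cases h0 : a H x + b H = 0
      · right
        refine ⟨fun i hi => ?_, trivial⟩
        have := h i hi
        unfold prj
        rw [h0]
        simpa using this
      · left
        intro i hi
        by_cases e : i = H
        · rw [e]; exact h0
        · exact h i (Finset.mem_erase.2 ⟨e, hi⟩)
  have m := mvS_down AX_open (TC_open isOpen_univ) i2 hX hT.1 (by rw [i1]; exact hP.1)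
  refine ⟨m.1, ?_⟩
  have := m.2
  rw [i1, hP.2, hT.2] at this
  linarith

lemma delres_coloop (hH : H ∈ S) (hv : a H v = 1) (hY : FH (AY S H a b)) (h0 : ∀ i ∈ S.erase H, a i v = 0) :
    FH (AX S a b) ∧ eulerChar (AX S a b) = 0 := by
  have hP := TC_punct (S := S) (b := b) hv hY
  have : TC S H a b v {0}ᶜ = AX S a b := by
    ext x
    have hi' : ∀ i ∈ S.erase H, a i (prj H a b v x) + b i = a i x + b i := fun i hi => by
      unfold prj; rw [map_sub, map_smul, h0 i hi]; simp
    constructor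
    · rintro ⟨h1, h2⟩ i hi
      by_cases e : i = H
      · rw [e]; exact h2
      · have hi := Finset.mem_erase.2 ⟨e, hi⟩
        have := h1 i hi
        rw [hi' i hi, h0 i hi] at this
        simpa using this
    · intro h
      refine ⟨fun i hi => ?_, h H hH⟩
      rw [hi' i hi, h0 i hi]
      simpa using h i (Finset.mem_of_mem_erase hi)
  rw [← this]
  exact hP

end

end

section
open CategoryTheory AlgebraicTopology
set_option linter.unusedSectionVars false

lemma extend_integral {A C : Type} [CommRing A] [CommRing C] [Algebra A C] [Algebra.IsIntegral A C]
    (hinj : Function.Injective (algebraMap A C)) (e : A →+* ℂ) (he : Function.Surjective e) :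
    ∃ φ : C →+* ℂ, φ.comp (algebraMap A C) = e := by
  have hmax : (RingHom.ker e).IsMaximal := RingHom.ker_isMaximal_of_surjective e he
  obtain ⟨Q, hQ, hQc⟩ := Ideal.exists_ideal_over_maximal_of_isIntegral (S := C) (RingHom.ker e)
    (by rw [(RingHom.injective_iff_ker_eq_bot _).1 hinj]; exact bot_le)
  letI : Field (C ⧸ Q) := Ideal.Quotient.field Q
  let q : A →+* C ⧸ Q := (Ideal.Quotient.mk Q).comp (algebraMap A C)
  have hq : ∀ a, e a = 0 → q a = 0 := fun a ha => by
    refine Ideal.Quotient.eq_zero_iff_mem.2 ?_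
    have : a ∈ Q.comap (algebraMap A C) := by rw [hQc]; exact ha
    exact this
  let f : ℂ →+* C ⧸ Q := (Ideal.Quotient.lift (RingHom.ker e) q hq).comp
    (RingHom.quotientKerEquivOfSurjective he).symm.toRingHom
  have hf : f.comp e = q := by
    ext a
    have : (RingHom.quotientKerEquivOfSurjective he).symm (e a) = Ideal.Quotient.mk _ a := by
      rw [RingEquiv.symm_apply_eq]; rfl
    show (Ideal.Quotient.lift (RingHom.ker e) q hq) ((RingHom.quotientKerEquivOfSurjective he).symm (e a)) = q a
    rw [this]; rfl
  have hintg : q.IsIntegral := RingHom.IsIntegral.trans _ _ (algebraMap_isIntegral_iff.2 inferInstance)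
    (RingHom.isIntegral_of_surjective _ Ideal.Quotient.mk_surjective)
  have hfi : f.IsIntegral := RingHom.IsIntegral.tower_top e f (by rw [hf]; exact hintg)
  letI : Algebra ℂ (C ⧸ Q) := f.toAlgebra
  have : Algebra.IsIntegral ℂ (C ⧸ Q) := ⟨fun x => hfi x⟩
  have : Algebra.IsAlgebraic ℂ (C ⧸ Q) := inferInstance
  let ψ : (C ⧸ Q) →ₐ[ℂ] ℂ := IsAlgClosed.lift
  refine ⟨ψ.toRingHom.comp (Ideal.Quotient.mk Q), ?_⟩
  ext a
  have h1 : f (e a) = q a := RingHom.congr_fun hf a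
  have h2 : ψ (algebraMap ℂ (C ⧸ Q) (e a)) = e a := ψ.commutes (e a)
  have h3 : algebraMap ℂ (C ⧸ Q) (e a) = f (e a) := rfl
  rw [h3, h1] at h2
  exact h2

set_option maxHeartbeats 2000000 in
lemma elim {A τ : Type} [CommRing A] [IsDomain A] [Finite τ] (Ps : Set (MvPolynomial τ A)) :
    ∃ g : A, g ≠ 0 ∧
      ((∀ e : A →+* ℂ, Function.Surjective e → e g ≠ 0 → ∃ z : τ → ℂ, ∀ p ∈ Ps, MvPolynomial.eval₂ e z p = 0) ∨
       (∀ e : A →+* ℂ, e g ≠ 0 → ¬ ∃ z : τ → ℂ, ∀ p ∈ Ps, MvPolynomial.eval₂ e z p = 0)) := by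
  classical
  let K := FractionRing A
  let Ω := AlgebraicClosure K
  let I : Ideal (MvPolynomial τ A) := Ideal.span Ps
  by_cases h : I.map (MvPolynomial.map (algebraMap A K)) = ⊤
  · letI := MvPolynomial.algebraMvPolynomial (R := A) (S := K) (σ := τ)
    have h1 : (1 : MvPolynomial τ K) ∈ I.map (algebraMap (MvPolynomial τ A) (MvPolynomial τ K)) := by
      have : algebraMap (MvPolynomial τ A) (MvPolynomial τ K) = MvPolynomial.map (algebraMap A K) := rfl
      rw [this, h]; trivial
    rw [IsLocalization.mem_map_algebraMap_iff ((nonZeroDivisors A).map (MvPolynomial.C (σ := τ)))] at h1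
    obtain ⟨⟨p, s⟩, hs⟩ := h1
    obtain ⟨g, hg, hgs⟩ := s.2
    rw [one_mul] at hs
    have hsp : (s : MvPolynomial τ A) = p := by
      have : Function.Injective (algebraMap (MvPolynomial τ A) (MvPolynomial τ K)) :=
        MvPolynomial.map_injective _ (IsFractionRing.injective A K)
      exact this hs
    refine ⟨g, nonZeroDivisors.ne_zero hg, Or.inr ?_⟩
    rintro e heg ⟨z, hz⟩
    apply heg
    have hI : I ≤ RingHom.ker (MvPolynomial.eval₂Hom e z) := Ideal.span_le.2 fun q hq => hz q hq
    have := hI p.2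
    rw [← hsp, ← hgs, RingHom.mem_ker] at this
    simpa using this
  · obtain ⟨J, hJ, hIJ⟩ := Ideal.exists_le_maximal _ h
    obtain ⟨x, hx⟩ := MvPolynomial.eq_vanishingIdeal_singleton_of_isMaximal Ω hJ
    have hx0 : ∀ p ∈ Ps, MvPolynomial.eval₂ ((algebraMap K Ω).comp (algebraMap A K)) x p = 0 := by
      intro p hp
      have h1 : MvPolynomial.map (algebraMap A K) p ∈ J := hIJ (Ideal.mem_map_of_mem _ (Ideal.subset_span hp))
      rw [hx, MvPolynomial.mem_vanishingIdeal_singleton_iff] at h1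
      rw [MvPolynomial.aeval_def, MvPolynomial.eval₂_map] at h1
      exact h1
    have : Fintype τ := Fintype.ofFinite τ
    have hinjΩ : Function.Injective (algebraMap A Ω) := by
      rw [IsScalarTower.algebraMap_eq A K Ω]
      exact (algebraMap K Ω).injective.comp (IsFractionRing.injective A K)
    have : Algebra.IsAlgebraic A Ω :=
      (IsFractionRing.comap_isAlgebraic_iff (A := A) (K := K) (C := Ω)).mpr inferInstance
    obtain ⟨r, hr0, hr⟩ := Algebra.IsAlgebraic.exists_integral_multiples A (A := Ω) (Finset.univ.image x)
    refine ⟨r, hr0, Or.inl ?_⟩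
    intro e he her
    let C := integralClosure A Ω
    have hinjC : Function.Injective (algebraMap A C) := by
      intro a b hab
      exact hinjΩ (congrArg (Subtype.val) hab)
    obtain ⟨φ, hφ⟩ := extend_integral (C := C) hinjC e he
    let rC : C := algebraMap A C r
    let D := Localization.Away rC
    have hφr : IsUnit (φ rC) := by
      have : φ rC = e r := RingHom.congr_fun hφ r
      rw [this]; exact her.isUnit
    let ψ : D →+* ℂ := IsLocalization.Away.lift rC hφr
    let j : C →+* Ω := C.val.toRingHom
    have hjr : IsUnit (j rC) := by
      have : j rC = algebraMap A Ω r := rfl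
      rw [this]
      exact (by rw [Ne, map_eq_zero_iff _ hinjΩ]; exact hr0 : algebraMap A Ω r ≠ 0).isUnit
    let jD : D →+* Ω := IsLocalization.Away.lift rC hjr
    have hjD : Function.Injective jD := by
      have hj : Function.Injective j := Subtype.val_injective
      rw [injective_iff_map_eq_zero]
      intro y hy
      obtain ⟨c, s, rfl⟩ := IsLocalization.exists_mk'_eq (Submonoid.powers rC) y
      have h2 : jD (IsLocalization.mk' D c s * algebraMap C D s) = j c := by
        rw [IsLocalization.mk'_spec]; exact IsLocalization.Away.lift_eq rC hjr c
      rw [map_mul, hy, zero_mul] at h2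
      have : c = 0 := hj (by rw [← h2, map_zero])
      rw [this, IsLocalization.mk'_zero]
    have hintg : ∀ t, IsIntegral A (r • x t) := fun t => hr _ (Finset.mem_image_of_mem _ (Finset.mem_univ t))
    let w : τ → D := fun t => IsLocalization.mk' D (⟨r • x t, hintg t⟩ : C) ⟨rC, Submonoid.mem_powers rC⟩
    have hw : ∀ t, jD (w t) = x t := by
      intro t
      have h2 : jD (w t * algebraMap C D rC) = j (⟨r • x t, hintg t⟩ : C) := by
        have : w t * algebraMap C D rC = algebraMap C D ⟨r • x t, hintg t⟩ := IsLocalization.mk'_spec D _ _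
        rw [this]; exact IsLocalization.Away.lift_eq rC hjr _
      have h3 : jD (algebraMap C D rC) = j rC := IsLocalization.Away.lift_eq rC hjr _
      rw [map_mul, h3] at h2
      have h4 : j (⟨r • x t, hintg t⟩ : C) = x t * j rC := by
        show r • x t = x t * algebraMap A Ω r
        rw [Algebra.smul_def, mul_comm]
      rw [h4] at h2
      exact hjr.mul_right_cancel h2
    let al : A →+* D := (algebraMap C D).comp (algebraMap A C)
    refine ⟨fun t => ψ (w t), fun p hp => ?_⟩
    have h5 : MvPolynomial.eval₂ al w p = 0 := by
      apply hjD
      rw [map_zero, MvPolynomial.hom_eval₂, ← hx0 p hp]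
      have : jD.comp al = (algebraMap K Ω).comp (algebraMap A K) := by
        rw [← IsScalarTower.algebraMap_eq]
        ext a
        show jD (algebraMap C D (algebraMap A C a)) = _
        rw [show jD (algebraMap C D (algebraMap A C a)) = j (algebraMap A C a) from IsLocalization.Away.lift_eq rC hjr _]
        rfl
      rw [this]
      congr 1
      funext t; exact hw t
    have h6 := congrArg ψ h5
    rw [map_zero, MvPolynomial.hom_eval₂] at h6
    have : ψ.comp al = e := by
      rw [← hφ]
      ext a
      exact IsLocalization.Away.lift_eq rC hφr _
    rw [this] at h6
    exact h6

end

section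
open CategoryTheory AlgebraicTopology
set_option linter.unusedSectionVars false

section genericity

lemma gen_and {σ : Type} [Fintype σ] [DecidableEq σ] {P Q : (σ → ℂ) → Prop}
    (hP : Generically P) (hQ : Generically Q) : Generically (fun u => P u ∧ Q u) := by
  obtain ⟨g, hg, hgP⟩ := hP
  obtain ⟨h, hh, hhQ⟩ := hQ
  refine ⟨g * h, mul_ne_zero hg hh, fun u hu => ?_⟩
  rw [map_mul] at hu
  exact ⟨hgP u (left_ne_zero_of_mul hu), hhQ u (right_ne_zero_of_mul hu)⟩

lemma gen_mono {σ : Type} [Fintype σ] [DecidableEq σ] {P Q : (σ → ℂ) → Prop}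
    (hP : Generically P) (h : ∀ u, P u → Q u) : Generically Q := by
  obtain ⟨g, hg, hgP⟩ := hP
  exact ⟨g, hg, fun u hu => h u (hgP u hu)⟩

lemma gen_true {σ : Type} [Fintype σ] [DecidableEq σ] {P : (σ → ℂ) → Prop} (h : ∀ u, P u) :
    Generically P := ⟨1, one_ne_zero, fun u _ => h u⟩

lemma gen_all {σ : Type} [Fintype σ] [DecidableEq σ] {κ : Type} [Finite κ] {P : κ → (σ → ℂ) → Prop}
    (h : ∀ k, Generically (P k)) : Generically (fun u => ∀ k, P k u) := by
  classical
  have : Fintype κ := Fintype.ofFinite κ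
  choose g hg hgP using h
  refine ⟨∏ k, g k, Finset.prod_ne_zero_iff.2 fun k _ => hg k, fun u hu k => hgP k u ?_⟩
  rw [map_prod] at hu
  exact Finset.prod_ne_zero_iff.1 hu k (Finset.mem_univ k)

lemma gen_open {σ : Type} [Fintype σ] [DecidableEq σ] {P : (σ → ℂ) → Prop}
    (hP : Generically P) {U : Set (σ → ℂ)} (hU : IsOpen U) (hne : U.Nonempty) : ∃ u ∈ U, P u := by
  obtain ⟨g, hg, hgP⟩ := hP
  by_contra hcon
  push Not at hcon
  apply hg
  obtain ⟨u0, hu0⟩ := hne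
  obtain ⟨ε, hε, hb⟩ := Metric.isOpen_iff.1 hU u0 hu0
  refine MvPolynomial.funext_set (fun i => Metric.ball (u0 i) ε) (fun i => ?_) ?_
  · exact (infinite_of_mem_nhds (u0 i) (Metric.ball_mem_nhds _ hε))
  · intro u hu
    rw [map_zero]
    by_contra hne
    refine hcon u (hb ?_) (hgP u hne)
    rw [Metric.mem_ball, dist_pi_lt_iff hε]
    intro i
    exact hu i (Set.mem_univ i)

/-- polynomial functions of parameters and unknowns -/
def IsPoly {σ τ : Type} (f : (σ → ℂ) → (τ → ℂ) → ℂ) : Prop :=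
  ∃ p : MvPolynomial τ (MvPolynomial σ ℂ), ∀ u z,
    MvPolynomial.eval₂ (MvPolynomial.eval u) z p = f u z

lemma isPoly_const {σ τ : Type} (c : ℂ) : IsPoly (fun (_ : σ → ℂ) (_ : τ → ℂ) => c) :=
  ⟨MvPolynomial.C (MvPolynomial.C c), fun u z => by simp⟩
lemma isPoly_par {σ τ : Type} (i : σ) : IsPoly (fun (u : σ → ℂ) (_ : τ → ℂ) => u i) :=
  ⟨MvPolynomial.C (MvPolynomial.X i), fun u z => by simp⟩
lemma isPoly_var {σ τ : Type} (i : τ) : IsPoly (fun (_ : σ → ℂ) (z : τ → ℂ) => z i) :=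
  ⟨MvPolynomial.X i, fun u z => by simp⟩
lemma IsPoly.add {σ τ : Type} {f g : (σ → ℂ) → (τ → ℂ) → ℂ} (hf : IsPoly f) (hg : IsPoly g) :
    IsPoly (fun u z => f u z + g u z) := by
  obtain ⟨p, hp⟩ := hf
  obtain ⟨q, hq⟩ := hg
  exact ⟨p + q, fun u z => by rw [MvPolynomial.eval₂_add, hp, hq]⟩
lemma IsPoly.mul {σ τ : Type} {f g : (σ → ℂ) → (τ → ℂ) → ℂ} (hf : IsPoly f) (hg : IsPoly g) :
    IsPoly (fun u z => f u z * g u z) := by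
  obtain ⟨p, hp⟩ := hf
  obtain ⟨q, hq⟩ := hg
  exact ⟨p * q, fun u z => by rw [MvPolynomial.eval₂_mul, hp, hq]⟩
lemma IsPoly.sub {σ τ : Type} {f g : (σ → ℂ) → (τ → ℂ) → ℂ} (hf : IsPoly f) (hg : IsPoly g) :
    IsPoly (fun u z => f u z - g u z) := by
  obtain ⟨p, hp⟩ := hf
  obtain ⟨q, hq⟩ := hg
  refine ⟨p - q, fun u z => ?_⟩
  have := (MvPolynomial.eval₂Hom (MvPolynomial.eval u) z).map_sub p q
  simp only [MvPolynomial.coe_eval₂Hom] at this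
  rw [this, hp, hq]
lemma isPoly_sum {σ τ κ : Type} (s : Finset κ) {f : κ → (σ → ℂ) → (τ → ℂ) → ℂ}
    (hf : ∀ k, IsPoly (f k)) : IsPoly (fun u z => ∑ k ∈ s, f k u z) := by
  choose p hp using hf
  refine ⟨∑ k ∈ s, p k, fun u z => ?_⟩
  rw [MvPolynomial.eval₂_sum]
  exact Finset.sum_congr rfl fun k _ => hp k u z

lemma elim_poly {σ τ J : Type} [Fintype σ] [DecidableEq σ] [Finite τ]
    (f : J → (σ → ℂ) → (τ → ℂ) → ℂ) (hf : ∀ j, IsPoly (f j)) :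
    Generically (fun u => ∃ z, ∀ j, f j u z = 0) ∨ Generically (fun u => ¬ ∃ z, ∀ j, f j u z = 0) := by
  choose p hp using hf
  obtain ⟨g, hg, h | h⟩ := elim (Set.range p)
  · left
    refine ⟨g, hg, fun u hu => ?_⟩
    obtain ⟨z, hz⟩ := h (MvPolynomial.eval u) (fun c => ⟨MvPolynomial.C c, by simp⟩) hu
    exact ⟨z, fun j => by rw [← hp]; exact hz _ ⟨j, rfl⟩⟩
  · right
    refine ⟨g, hg, fun u hu => ?_⟩
    rintro ⟨z, hz⟩
    refine h (MvPolynomial.eval u) hu ⟨z, ?_⟩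
    rintro _ ⟨j, rfl⟩
    rw [hp]; exact hz j

end genericity

section crit
variable {σ : Type} [Fintype σ] [DecidableEq σ] {V : Type} [NormedAddCommGroup V] [NormedSpace ℂ V]

def Crit (S : Finset σ) (a : σ → V →L[ℂ] ℂ) (b : σ → ℂ) (u : σ → ℂ) : Set V :=
  {x | x ∈ AX S a b ∧ ∀ v, ∑ i ∈ S, u i * a i v / (a i x + b i) = 0}

def NonDeg (S : Finset σ) (a : σ → V →L[ℂ] ℂ) (b : σ → ℂ) (u : σ → ℂ) (x : V) : Prop :=
  ∀ v, (∀ w, ∑ i ∈ S, u i * a i v * a i w / (a i x + b i) ^ 2 = 0) → v = 0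

def GoodCount (S : Finset σ) (a : σ → V →L[ℂ] ℂ) (b : σ → ℂ) (N : ℕ) (u : σ → ℂ) : Prop :=
  (Crit S a b u).encard = N ∧ ∀ x ∈ Crit S a b u, NonDeg S a b u x

variable [FiniteDimensional ℂ V]

lemma basis_expand {m : ℕ} (e : Module.Basis (Fin m) ℂ V) (f : V →L[ℂ] ℂ) (z : Fin m → ℂ) :
    f (∑ j, z j • e j) = ∑ j, z j * f (e j) := by
  simp

lemma crit_basis {m : ℕ} (e : Module.Basis (Fin m) ℂ V) (c : σ → ℂ) (S : Finset σ) (a : σ → V →L[ℂ] ℂ)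
    (h : ∀ j, ∑ i ∈ S, c i * a i (e j) = 0) (v : V) : ∑ i ∈ S, c i * a i v = 0 := by
  have : (∑ i ∈ S, c i • (a i : V →ₗ[ℂ] ℂ)) = 0 := e.ext fun j => by simpa using h j
  simpa using LinearMap.congr_fun this v

lemma exists_dual {m : ℕ} (e : Module.Basis (Fin m) ℂ V) {v : V} (hv : v ≠ 0) :
    ∃ c : Fin m → ℂ, ∑ j, c j * e.repr v j = 1 := by
  have : ∃ j, e.repr v j ≠ 0 := by
    by_contra hcon
    push Not at hcon
    exact hv (e.repr.map_eq_zero_iff.1 (Finsupp.ext hcon))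
  obtain ⟨j, hj⟩ := this
  refine ⟨Pi.single j (e.repr v j)⁻¹, ?_⟩
  rw [Finset.sum_eq_single j]
  · simp [hj]
  · intro k _ hk; simp [hk]
  · simp

/-- the condition "there are `k` distinct critical points" is generically true or generically false -/
lemma crit_dich (S : Finset σ) (a : σ → V →L[ℂ] ℂ) (b : σ → ℂ) (k : ℕ) :
    Generically (fun u => ∃ x : Fin k → V, Function.Injective x ∧ ∀ p, x p ∈ Crit S a b u) ∨
    Generically (fun u => ¬ ∃ x : Fin k → V, Function.Injective x ∧ ∀ p, x p ∈ Crit S a b u) := by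
  classical
  obtain ⟨m, e⟩ : ∃ m, Nonempty (Module.Basis (Fin m) ℂ V) := ⟨_, ⟨Module.finBasis ℂ V⟩⟩
  obtain ⟨e⟩ := e
  let τ := (Fin k × Fin m) ⊕ ((Fin k × σ) ⊕ (Fin k × Fin k × Fin m))
  let X : Fin k → Fin m → τ := fun p j => Sum.inl (p, j)
  let W : Fin k → σ → τ := fun p i => Sum.inr (Sum.inl (p, i))
  let D : Fin k → Fin k → Fin m → τ := fun p q j => Sum.inr (Sum.inr (p, q, j))
  let f : ((Fin k × S) ⊕ ((Fin k × Fin m) ⊕ {pq : Fin k × Fin k // pq.1 ≠ pq.2})) → (σ → ℂ) → (τ → ℂ) → ℂ :=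
    fun t u z => match t with
    | Sum.inl (p, i) => z (W p i) * (∑ j, z (X p j) * a i (e j) + b i) - 1
    | Sum.inr (Sum.inl (p, j)) => ∑ i ∈ S, u i * z (W p i) * a i (e j)
    | Sum.inr (Sum.inr pq) => ∑ j, z (D pq.1.1 pq.1.2 j) * (z (X pq.1.1 j) - z (X pq.1.2 j)) - 1
  have hf : ∀ t, IsPoly (f t) := by
    rintro (⟨p, i⟩ | ⟨p, j⟩ | pq)
    · exact ((isPoly_var _).mul ((isPoly_sum _ fun j => (isPoly_var _).mul (isPoly_const _)).add
        (isPoly_const _))).sub (isPoly_const _)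
    · exact isPoly_sum _ fun i => ((isPoly_par _).mul (isPoly_var _)).mul (isPoly_const _)
    · exact (isPoly_sum _ fun j => (isPoly_var _).mul ((isPoly_var _).sub (isPoly_var _))).sub (isPoly_const _)
  have key : ∀ u, (∃ z, ∀ t, f t u z = 0) ↔
      ∃ x : Fin k → V, Function.Injective x ∧ ∀ p, x p ∈ Crit S a b u := by
    intro u
    constructor
    · rintro ⟨z, hz⟩
      refine ⟨fun p => ∑ j, z (X p j) • e j, ?_, ?_⟩
      · intro p q hpq
        by_contra hne
        have h1 := hz (Sum.inr (Sum.inr ⟨(p, q), hne⟩))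
        have h2 : ∀ j, z (X p j) = z (X q j) := by
          intro j
          have := congrArg (fun v => e.repr v j) hpq
          simpa [Finsupp.single_apply] using this
        simp [f, h2] at h1
      · intro p
        have hw : ∀ i ∈ S, z (W p i) * (a i (∑ j, z (X p j) • e j) + b i) = 1 := by
          intro i hi
          have := hz (Sum.inl (p, ⟨i, hi⟩))
          rw [basis_expand]
          exact sub_eq_zero.1 this
        have hAX : (∑ j, z (X p j) • e j) ∈ AX S a b := fun i hi h0 => by
          have := hw i hi
          rw [h0, mul_zero] at this
          exact zero_ne_one this
        refine ⟨hAX, ?_⟩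
        intro v
        have := crit_basis e (fun i => u i * z (W p i)) S a (fun j => hz (Sum.inr (Sum.inl (p, j)))) v
        rw [← this]
        refine Finset.sum_congr rfl fun i hi => ?_
        have h3 := hAX i hi
        rw [div_eq_iff h3]
        linear_combination (- u i * a i v) * hw i hi
    · rintro ⟨x, hx, hc⟩
      have : ∀ p q, ∃ c : Fin m → ℂ, p ≠ q → ∑ j, c j * e.repr (x p - x q) j = 1 := by
        intro p q
        by_cases h : p = q
        · exact ⟨0, fun h' => absurd h h'⟩
        · obtain ⟨c, hc⟩ := exists_dual e (sub_ne_zero.2 (fun h' => h (hx h')))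
          exact ⟨c, fun _ => hc⟩
      choose c hcc using this
      let z : τ → ℂ := fun t => match t with
        | Sum.inl (p, j) => e.repr (x p) j
        | Sum.inr (Sum.inl (p, i)) => (a i (x p) + b i)⁻¹
        | Sum.inr (Sum.inr (p, q, j)) => c p q j
      have hax : ∀ p i, ∑ j, e.repr (x p) j * a i (e j) = a i (x p) := by
        intro p i
        conv_rhs => rw [← e.sum_repr (x p), basis_expand]
      refine ⟨z, ?_⟩
      rintro (⟨p, i⟩ | ⟨p, j⟩ | pq)
      · show (a i (x p) + b i)⁻¹ * (∑ j, e.repr (x p) j * a i (e j) + b i) - 1 = 0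
        rw [hax, inv_mul_cancel₀ ((hc p).1 i i.2), sub_self]
      · show ∑ i ∈ S, u i * (a i (x p) + b i)⁻¹ * a i (e j) = 0
        rw [← (hc p).2 (e j)]
        refine Finset.sum_congr rfl fun i hi => ?_
        rw [div_eq_mul_inv]; ring
      · show ∑ j, c pq.1.1 pq.1.2 j * (e.repr (x pq.1.1) j - e.repr (x pq.1.2) j) - 1 = 0
        rw [← hcc _ _ pq.2, sub_eq_zero]
        simp
  have := elim_poly f hf
  simpa only [key] using this

/-- the condition "there is a degenerate critical point" is generically true or generically false -/
lemma deg_dich (S : Finset σ) (a : σ → V →L[ℂ] ℂ) (b : σ → ℂ) :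
    Generically (fun u => ∃ x ∈ Crit S a b u, ¬ NonDeg S a b u x) ∨
    Generically (fun u => ¬ ∃ x ∈ Crit S a b u, ¬ NonDeg S a b u x) := by
  classical
  obtain ⟨m, e⟩ : ∃ m, Nonempty (Module.Basis (Fin m) ℂ V) := ⟨_, ⟨Module.finBasis ℂ V⟩⟩
  obtain ⟨e⟩ := e
  let τ := Fin m ⊕ (σ ⊕ (Fin m ⊕ Fin m))
  let X : Fin m → τ := fun j => Sum.inl j
  let W : σ → τ := fun i => Sum.inr (Sum.inl i)
  let Y : Fin m → τ := fun j => Sum.inr (Sum.inr (Sum.inl j))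
  let D : Fin m → τ := fun j => Sum.inr (Sum.inr (Sum.inr j))
  let f : (S ⊕ (Fin m ⊕ (Fin m ⊕ Unit))) → (σ → ℂ) → (τ → ℂ) → ℂ :=
    fun t u z => match t with
    | Sum.inl i => z (W i) * (∑ j, z (X j) * a i (e j) + b i) - 1
    | Sum.inr (Sum.inl j) => ∑ i ∈ S, u i * z (W i) * a i (e j)
    | Sum.inr (Sum.inr (Sum.inl j)) => ∑ i ∈ S, u i * (z (W i) * z (W i)) * (∑ j', z (Y j') * a i (e j')) * a i (e j)
    | Sum.inr (Sum.inr (Sum.inr _)) => ∑ j, z (D j) * z (Y j) - 1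
  have hf : ∀ t, IsPoly (f t) := by
    rintro (i | j | j | _)
    · exact ((isPoly_var _).mul ((isPoly_sum _ fun j => (isPoly_var _).mul (isPoly_const _)).add
        (isPoly_const _))).sub (isPoly_const _)
    · exact isPoly_sum _ fun i => ((isPoly_par _).mul (isPoly_var _)).mul (isPoly_const _)
    · exact isPoly_sum _ fun i => (((isPoly_par _).mul ((isPoly_var _).mul (isPoly_var _))).mul
        (isPoly_sum _ fun j => (isPoly_var _).mul (isPoly_const _))).mul (isPoly_const _)
    · exact (isPoly_sum _ fun j => (isPoly_var _).mul (isPoly_var _)).sub (isPoly_const _)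
  have key : ∀ u, (∃ z, ∀ t, f t u z = 0) ↔ ∃ x ∈ Crit S a b u, ¬ NonDeg S a b u x := by
    intro u
    constructor
    · rintro ⟨z, hz⟩
      have hw : ∀ i ∈ S, z (W i) * (a i (∑ j, z (X j) • e j) + b i) = 1 := by
        intro i hi
        have := hz (Sum.inl ⟨i, hi⟩)
        rw [basis_expand]
        exact sub_eq_zero.1 this
      have hAX : (∑ j, z (X j) • e j) ∈ AX S a b := fun i hi h0 => by
        have := hw i hi
        rw [h0, mul_zero] at this
        exact zero_ne_one this
      have hwi : ∀ i ∈ S, z (W i) = (a i (∑ j, z (X j) • e j) + b i)⁻¹ := fun i hi =>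
        eq_inv_of_mul_eq_one_left (hw i hi)
      refine ⟨∑ j, z (X j) • e j, ⟨hAX, ?_⟩, ?_⟩
      · intro v
        have := crit_basis e (fun i => u i * z (W i)) S a (fun j => hz (Sum.inr (Sum.inl j))) v
        rw [← this]
        refine Finset.sum_congr rfl fun i hi => ?_
        rw [hwi i hi, div_eq_mul_inv]; ring
      · intro hnd
        have hv := hnd (∑ j, z (Y j) • e j) (by
          intro w
          have := crit_basis e (fun i => u i * (z (W i) * z (W i)) * (∑ j', z (Y j') * a i (e j'))) S a
            (fun j => hz (Sum.inr (Sum.inr (Sum.inl j)))) w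
          rw [← this]
          refine Finset.sum_congr rfl fun i hi => ?_
          rw [hwi i hi, div_eq_mul_inv, basis_expand, ← inv_pow]; ring)
        have h2 : ∀ j, z (Y j) = 0 := by
          intro j
          have := congrArg (fun v => e.repr v j) hv
          simpa [Finsupp.single_apply] using this
        have h1 := hz (Sum.inr (Sum.inr (Sum.inr ())))
        simp [f, h2] at h1
    · rintro ⟨x, hc, hnd⟩
      unfold NonDeg at hnd
      push Not at hnd
      obtain ⟨y, hy, hy0⟩ := hnd
      obtain ⟨c, hcc⟩ := exists_dual e hy0
      let z : τ → ℂ := fun t => match t with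
        | Sum.inl j => e.repr x j
        | Sum.inr (Sum.inl i) => (a i x + b i)⁻¹
        | Sum.inr (Sum.inr (Sum.inl j)) => e.repr y j
        | Sum.inr (Sum.inr (Sum.inr j)) => c j
      have hax : ∀ x i, ∑ j, e.repr x j * a i (e j) = a i x := by
        intro x i
        conv_rhs => rw [← e.sum_repr x, basis_expand]
      refine ⟨z, ?_⟩
      rintro (i | j | j | _)
      · show (a i x + b i)⁻¹ * (∑ j, e.repr x j * a i (e j) + b i) - 1 = 0
        rw [hax, inv_mul_cancel₀ (hc.1 i i.2), sub_self]
      · show ∑ i ∈ S, u i * (a i x + b i)⁻¹ * a i (e j) = 0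
        rw [← hc.2 (e j)]
        refine Finset.sum_congr rfl fun i hi => ?_
        rw [div_eq_mul_inv]; ring
      · show ∑ i ∈ S, u i * ((a i x + b i)⁻¹ * (a i x + b i)⁻¹) * (∑ j', e.repr y j' * a i (e j')) * a i (e j) = 0
        rw [← hy (e j)]
        refine Finset.sum_congr rfl fun i hi => ?_
        rw [hax, div_eq_mul_inv, ← inv_pow]; ring
      · show ∑ j, c j * e.repr y j - 1 = 0
        rw [hcc, sub_self]
  have := elim_poly f hf
  simpa only [key] using this

lemma encard_ge_iff {X : Type} (s : Set X) (k : ℕ) :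
    (k : ℕ∞) ≤ s.encard ↔ ∃ x : Fin k → X, Function.Injective x ∧ ∀ p, x p ∈ s := by
  constructor
  · intro h
    obtain ⟨t, hts, htk⟩ := Set.exists_subset_encard_eq h
    have hfin : t.Finite := Set.finite_of_encard_eq_coe htk
    have hc : hfin.toFinset.card = k := by
      rw [hfin.encard_eq_coe_toFinset_card] at htk
      exact_mod_cast htk
    let e := (hfin.toFinset.equivFinOfCardEq hc).symm
    refine ⟨fun p => (e p).1, fun p q h => e.injective (Subtype.ext h), fun p => ?_⟩
    exact hts (hfin.mem_toFinset.1 (e p).2)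
  · rintro ⟨x, hx, hs⟩
    have h1 : (Set.range x).encard = k := by
      rw [← Set.image_univ, hx.encard_image]; simp
    rw [← h1]
    exact Set.encard_le_encard (Set.range_subset_iff.2 hs)

lemma gen_count (S : Finset σ) (a : σ → V →L[ℂ] ℂ) (b : σ → ℂ) (N : ℕ) {U : Set (σ → ℂ)}
    (hU : IsOpen U) (hne : U.Nonempty) (h : ∀ u ∈ U, GoodCount S a b N u) :
    Generically (GoodCount S a b N) := by
  have h1 : Generically (fun u => (N : ℕ∞) ≤ (Crit S a b u).encard) := by
    simp only [encard_ge_iff]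
    rcases crit_dich S a b N with h' | h'
    · exact h'
    · obtain ⟨u, hu, hu'⟩ := gen_open h' hU hne
      rw [← encard_ge_iff, (h u hu).1] at hu'
      exact absurd le_rfl hu'
  have h2 : Generically (fun u => ¬ ((N + 1 : ℕ) : ℕ∞) ≤ (Crit S a b u).encard) := by
    simp only [encard_ge_iff]
    rcases crit_dich S a b (N + 1) with h' | h'
    · obtain ⟨u, hu, hu'⟩ := gen_open h' hU hne
      rw [← encard_ge_iff, (h u hu).1] at hu'
      have : N + 1 ≤ N := by exact_mod_cast hu'
      omega
    · exact h'
  have h3 : Generically (fun u => ¬ ∃ x ∈ Crit S a b u, ¬ NonDeg S a b u x) := by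
    rcases deg_dich S a b with h' | h'
    · obtain ⟨u, hu, x, hx, hx'⟩ := gen_open h' hU hne
      exact absurd ((h u hu).2 x hx) hx'
    · exact h'
  refine gen_mono (gen_and h1 (gen_and h2 h3)) ?_
  rintro u ⟨h1, h2, h3⟩
  refine ⟨le_antisymm ?_ h1, fun x hx => ?_⟩
  · rw [not_le] at h2
    exact Order.le_of_lt_add_one (by exact_mod_cast h2)
  · by_contra hcon
    exact h3 ⟨x, hx, hcon⟩

end crit

end

section
open CategoryTheory AlgebraicTopology
set_option linter.unusedSectionVars false

section ift
open Filter Topology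
variable {V E E' : Type} [NormedAddCommGroup V] [NormedSpace ℂ V] [FiniteDimensional ℂ V]
  [NormedAddCommGroup E] [NormedSpace ℂ E] [FiniteDimensional ℂ E]
  [NormedAddCommGroup E'] [NormedSpace ℂ E'] [FiniteDimensional ℂ E']

lemma ift_local (F : V × E → E') (z : V) (u0 : E) (hC : ContDiffAt ℂ 1 F (z, u0))
    (hfin : Module.finrank ℂ V = Module.finrank ℂ E') (h0 : F (z, u0) = 0)
    (hinj : ∀ v, fderiv ℂ F (z, u0) (v, 0) = 0 → v = 0) (O : Set V) (hO : O ∈ 𝓝 z) :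
    ∃ B : Set V, IsOpen B ∧ z ∈ B ∧ B ⊆ O ∧ ∀ᶠ u in 𝓝 u0, (∃ x ∈ B, F (x, u) = 0) ∧
      (∀ x ∈ B, ∀ y ∈ B, F (x, u) = 0 → F (y, u) = 0 → x = y) ∧
      (∀ x ∈ B, ∀ v, fderiv ℂ F (x, u) (v, 0) = 0 → v = 0) := by
  have : CompleteSpace V := FiniteDimensional.complete ℂ V
  have : CompleteSpace E := FiniteDimensional.complete ℂ E
  let Φ : V × E → E' × E := fun q => (F q, q.2)
  have hF : HasStrictFDerivAt F (fderiv ℂ F (z, u0)) (z, u0) := hC.hasStrictFDerivAt (by norm_num)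
  let D : V × E →L[ℂ] E' × E := (fderiv ℂ F (z, u0)).prod (ContinuousLinearMap.snd ℂ V E)
  have hΦ : HasStrictFDerivAt Φ D (z, u0) := hF.prodMk hasStrictFDerivAt_snd
  have hDinj : Function.Injective D := by
    rw [injective_iff_map_eq_zero]
    rintro ⟨v, e⟩ h
    have h1 : e = 0 := congrArg Prod.snd h
    subst h1
    have h2 : fderiv ℂ F (z, u0) (v, 0) = 0 := congrArg Prod.fst h
    rw [hinj v h2]; rfl
  let De : (V × E) ≃L[ℂ] (E' × E) :=
    (LinearEquiv.ofInjectiveOfFinrankEq (D : V × E →ₗ[ℂ] E' × E) hDinj (by simp [hfin])).toContinuousLinearEquiv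
  have hDe : (De : V × E →L[ℂ] E' × E) = D := by ext q <;> rfl
  have hΦ' : HasStrictFDerivAt Φ (De : V × E →L[ℂ] E' × E) (z, u0) := by rw [hDe]; exact hΦ
  have hcont : ContinuousAt (fun q => (fderiv ℂ F q).comp (ContinuousLinearMap.inl ℂ V E)) (z, u0) := by
    have h1 : ContinuousAt (fderiv ℂ F) (z, u0) := (hC.fderiv_right (m := 0) (by norm_num)).continuousAt
    exact h1.clm_comp continuousAt_const
  have hopen : ∀ᶠ q in 𝓝 (z, u0), Function.Injective ((fderiv ℂ F q).comp (ContinuousLinearMap.inl ℂ V E)) := by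
    refine hcont.eventually (p := fun T : V →L[ℂ] E' => Function.Injective T) ?_
    apply (ContinuousLinearMap.isOpen_injective (𝕜 := ℂ) (E := V) (F := E')).mem_nhds
    show Function.Injective _
    rw [injective_iff_map_eq_zero]
    intro v hv
    exact hinj v hv
  have hall := (hΦ'.eventually_left_inverse.and hopen)
  rw [nhds_prod_eq] at hall
  obtain ⟨B1, hB1, C1, hC1, hBC⟩ := Filter.mem_prod_iff.1 hall
  obtain ⟨B, hBs, hBo, hzB⟩ := mem_nhds_iff.1 (inter_mem hB1 hO)
  refine ⟨B, hBo, hzB, fun x hx => (hBs hx).2, ?_⟩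
  have hΦ0 : Φ (z, u0) = (0, u0) := by simp [Φ, h0]
  have htend : Tendsto (fun u : E => ((0 : E'), u)) (𝓝 u0) (𝓝 (Φ (z, u0))) := by
    rw [hΦ0]; exact (Continuous.prodMk_right (0 : E')).tendsto u0
  let g := HasStrictFDerivAt.localInverse Φ De (z, u0) hΦ'
  have e1 := htend.eventually hΦ'.eventually_right_inverse
  have e2 := (hΦ'.localInverse_tendsto.comp htend).eventually
    (prod_mem_nhds (hBo.mem_nhds hzB) (Filter.univ_mem (f := 𝓝 u0)))
  filter_upwards [e1, e2, hC1] with u h1 h2 h3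
  refine ⟨⟨_, h2.1, ?_⟩, ?_, ?_⟩
  · have h5 : (g (0, u)).2 = u := congrArg Prod.snd h1
    have h6 : F (g (0, u)) = 0 := congrArg Prod.fst h1
    have h7 : ((g (0, u)).1, u) = g (0, u) := Prod.ext rfl h5.symm
    exact (congrArg F h7).trans h6
  · intro x hx y hy hx0 hy0
    have g1 := (@hBC (x, u) ⟨(hBs hx).1, h3⟩).1
    have g2 := (@hBC (y, u) ⟨(hBs hy).1, h3⟩).1
    have g3 : Φ (x, u) = Φ (y, u) := by simp [Φ, hx0, hy0]
    rw [g3, g2] at g1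
    exact (congrArg Prod.fst g1).symm
  · intro x hx v hv
    have g1 := (@hBC (x, u) ⟨(hBs hx).1, h3⟩).2
    exact (injective_iff_map_eq_zero _).1 g1 v hv

lemma count_abs (Ω : Set V) (hΩ : IsOpen Ω) (F : V × E → E') (u0 : E)
    (hC : ∀ x ∈ Ω, ContDiffAt ℂ 1 F (x, u0))
    (hfin : Module.finrank ℂ V = Module.finrank ℂ E') (N : ℕ)
    (hN : {x | x ∈ Ω ∧ F (x, u0) = 0}.encard = N)
    (hinj : ∀ x ∈ Ω, F (x, u0) = 0 → ∀ v, fderiv ℂ F (x, u0) (v, 0) = 0 → v = 0)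
    (P : E → Prop)
    (hprop : ∀ l : Ultrafilter (V × E), Tendsto Prod.snd (l : Filter (V × E)) (𝓝 u0) →
      (∀ᶠ q in (l : Filter (V × E)), q.1 ∈ Ω ∧ F q = 0 ∧ P q.2) →
      ∃ z ∈ Ω, Tendsto Prod.fst (l : Filter (V × E)) (𝓝 z)) :
    ∀ᶠ u in 𝓝 u0, P u → {x | x ∈ Ω ∧ F (x, u) = 0}.encard = N ∧
      ∀ x ∈ Ω, F (x, u) = 0 → ∀ v, fderiv ℂ F (x, u) (v, 0) = 0 → v = 0 := by
  set Z : Set V := {x | x ∈ Ω ∧ F (x, u0) = 0} with hZ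
  have hZf : Z.Finite := Set.finite_of_encard_eq_coe hN
  obtain ⟨U, hU, hdisj⟩ := hZf.t2_separation
  have hloc : ∀ z : Z, ∃ B : Set V, IsOpen B ∧ z.1 ∈ B ∧ B ⊆ U z.1 ∩ Ω ∧ ∀ᶠ u in 𝓝 u0,
      (∃ x ∈ B, F (x, u) = 0) ∧
      (∀ x ∈ B, ∀ y ∈ B, F (x, u) = 0 → F (y, u) = 0 → x = y) ∧
      (∀ x ∈ B, ∀ v, fderiv ℂ F (x, u) (v, 0) = 0 → v = 0) := fun z =>
    ift_local F z.1 u0 (hC _ z.2.1) hfin z.2.2 (hinj _ z.2.1 z.2.2) _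
      (((hU z.1).2.inter hΩ).mem_nhds ⟨(hU z.1).1, z.2.1⟩)
  choose B hBo hzB hBs hB using hloc
  have : Finite Z := hZf
  have hBall := eventually_all.2 hB
  have hOo : IsOpen (⋃ z, B z) := isOpen_iUnion hBo
  have hcover : ∀ᶠ u in 𝓝 u0, P u → ∀ x ∈ Ω, F (x, u) = 0 → x ∈ ⋃ z, B z := by
    by_contra hcon
    rw [Filter.not_eventually] at hcon
    let bad : Set (V × E) := {q | q.1 ∈ Ω ∧ F q = 0 ∧ P q.2 ∧ q.1 ∉ ⋃ z, B z}
    have hne : (comap Prod.snd (𝓝 u0) ⊓ 𝓟 bad).NeBot := by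
      rw [inf_principal_neBot_iff]
      intro s hs
      obtain ⟨t, ht, hts⟩ := mem_comap.1 hs
      obtain ⟨u, hu1, hu2⟩ := (hcon.and_eventually ht).exists
      push Not at hu1
      obtain ⟨hP, x, hx, hx0, hxB⟩ := hu1
      exact ⟨(x, u), hts hu2, hx, hx0, hP, hxB⟩
    let l : Ultrafilter (V × E) := Ultrafilter.of (comap Prod.snd (𝓝 u0) ⊓ 𝓟 bad)
    have hl : (l : Filter (V × E)) ≤ comap Prod.snd (𝓝 u0) ⊓ 𝓟 bad := Ultrafilter.of_le _
    have hl1 : Tendsto Prod.snd (l : Filter (V × E)) (𝓝 u0) := tendsto_iff_comap.2 (hl.trans inf_le_left)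
    have hl2 : ∀ᶠ q in (l : Filter (V × E)), q ∈ bad := hl.trans inf_le_right (mem_principal_self _)
    obtain ⟨z, hz, hlz⟩ := hprop l hl1 (hl2.mono fun q hq => ⟨hq.1, hq.2.1, hq.2.2.1⟩)
    have hlq : Tendsto (fun q : V × E => q) (l : Filter (V × E)) (𝓝 (z, u0)) := by
      rw [nhds_prod_eq]; exact hlz.prodMk hl1
    have hF0 : Tendsto F (l : Filter (V × E)) (𝓝 (F (z, u0))) := (hC z hz).continuousAt.tendsto.comp hlq
    have hF0' : Tendsto F (l : Filter (V × E)) (𝓝 0) :=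
      tendsto_const_nhds.congr' (hl2.mono fun q hq => hq.2.1.symm)
    have hz0 : F (z, u0) = 0 := tendsto_nhds_unique hF0 hF0'
    have hzO : z ∈ ⋃ z, B z := Set.mem_iUnion.2 ⟨⟨z, hz, hz0⟩, hzB _⟩
    obtain ⟨q, hq1, hq2⟩ := ((hlz.eventually (hOo.mem_nhds hzO)).and hl2).exists
    exact hq2.2.2.2 hq1
  filter_upwards [hBall, hcover] with u hu hcov hP
  have hcov := hcov hP
  refine ⟨?_, ?_⟩
  · choose x hxB hx0 using fun z => (hu z).1
    have hset : {x | x ∈ Ω ∧ F (x, u) = 0} = Set.range x := by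
      ext y
      constructor
      · rintro ⟨hy, hy0⟩
        obtain ⟨z, hz⟩ := Set.mem_iUnion.1 (hcov y hy hy0)
        exact ⟨z, (hu z).2.1 _ (hxB z) _ hz (hx0 z) hy0⟩
      · rintro ⟨z, rfl⟩
        exact ⟨(hBs z (hxB z)).2, hx0 z⟩
    have hxinj : Function.Injective x := by
      intro z w hzw
      by_contra hne
      have hd := hdisj z.2 w.2 (fun h => hne (Subtype.ext h))
      refine Set.disjoint_left.1 hd (hBs z (hxB z)).1 ?_
      rw [hzw]; exact (hBs w (hxB w)).1
    rw [hset, ← Set.image_univ, hxinj.encard_image, Set.encard_univ, ← hN]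
    rfl
  · intro x hx hx0
    obtain ⟨z, hz⟩ := Set.mem_iUnion.1 (hcov x hx hx0)
    exact (hu z).2.2 x hz

end ift

end

section
open CategoryTheory AlgebraicTopology
set_option linter.unusedSectionVars false

section proper
open Filter Topology

lemma ultra_dich {Q : Type} (l : Ultrafilter Q) (r : Q → ℂ) :
    (∃ c, Tendsto r (l : Filter Q) (𝓝 c)) ∨ Tendsto (fun q => (r q)⁻¹) (l : Filter Q) (𝓝 0) := by
  by_cases h : ∃ R : ℝ, ∀ᶠ q in (l : Filter Q), ‖r q‖ ≤ R
  · left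
    obtain ⟨R, hR⟩ := h
    have hc : IsCompact (Metric.closedBall (0 : ℂ) R) := isCompact_closedBall 0 R
    obtain ⟨c, -, hc⟩ := isCompact_iff_ultrafilter_le_nhds.1 hc (l.map r) (by
      rw [le_principal_iff]
      show ∀ᶠ q in (l : Filter Q), r q ∈ Metric.closedBall (0 : ℂ) R
      exact hR.mono fun q hq => by simpa using hq)
    exact ⟨c, hc⟩
  · right
    push Not at h
    apply Filter.tendsto_inv₀_cobounded.comp
    rw [← tendsto_norm_atTop_iff_cobounded, tendsto_atTop]
    intro R
    have := h R
    exact this.mono fun q hq => hq.le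

lemma lim_mem {Q M κ : Type} [NormedAddCommGroup M] [NormedSpace ℂ M] [FiniteDimensional ℂ M] [Finite κ]
    (l : Filter Q) [l.NeBot] (α : κ → M →L[ℂ] ℂ) (y : Q → M) (c : κ → ℂ)
    (h : ∀ i, Tendsto (fun q => α i (y q)) l (𝓝 (c i))) : ∃ w, ∀ i, α i w = c i := by
  have : Fintype κ := Fintype.ofFinite κ
  let A : M →L[ℂ] (κ → ℂ) := ContinuousLinearMap.pi α
  have hcl : IsClosed (Set.range A) := by
    have := Submodule.closed_of_finiteDimensional (LinearMap.range (A : M →ₗ[ℂ] (κ → ℂ)))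
    rwa [LinearMap.coe_range] at this
  have ht : Tendsto (fun q => A (y q)) l (𝓝 c) := tendsto_pi_nhds.2 h
  obtain ⟨w, hw⟩ := hcl.mem_of_tendsto ht (Eventually.of_forall fun q => ⟨y q, rfl⟩)
  exact ⟨w, fun i => congrFun hw i⟩

lemma lim_inj {Q M κ : Type} [NormedAddCommGroup M] [NormedSpace ℂ M] [FiniteDimensional ℂ M] [Finite κ]
    (l : Filter Q) [l.NeBot] (α : κ → M →L[ℂ] ℂ) (hα : ∀ v, (∀ i, α i v = 0) → v = 0)
    (y : Q → M) (c : κ → ℂ)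
    (h : ∀ i, Tendsto (fun q => α i (y q)) l (𝓝 (c i))) :
    ∃ w, (∀ i, α i w = c i) ∧ Tendsto y l (𝓝 w) := by
  have : Fintype κ := Fintype.ofFinite κ
  obtain ⟨w, hw⟩ := lim_mem l α y c h
  refine ⟨w, hw, ?_⟩
  let A : M →L[ℂ] (κ → ℂ) := ContinuousLinearMap.pi α
  have hemb : IsClosedEmbedding (A : M →ₗ[ℂ] (κ → ℂ)) := by
    apply LinearMap.isClosedEmbedding_of_injective
    rw [LinearMap.ker_eq_bot']
    intro v hv
    exact hα v fun i => congrFun hv i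
  rw [hemb.isInducing.tendsto_nhds_iff]
  have : (A : M →ₗ[ℂ] (κ → ℂ)) w = c := funext hw
  rw [this]
  exact tendsto_pi_nhds.2 h

variable {σ : Type} [Fintype σ] [DecidableEq σ] {V : Type} [NormedAddCommGroup V] [NormedSpace ℂ V]
  [FiniteDimensional ℂ V]

/-- homogenised forms -/
def hα (a : σ → V →L[ℂ] ℂ) (b : σ → ℂ) : Option σ → (ℂ × V) →L[ℂ] ℂ
  | none => ContinuousLinearMap.fst ℂ ℂ V
  | some i => (a i).comp (ContinuousLinearMap.snd ℂ ℂ V) + b i • ContinuousLinearMap.fst ℂ ℂ V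

/-- homogenised weights -/
def hU (S : Finset σ) (u : σ → ℂ) : Option σ → ℂ
  | none => - ∑ i ∈ S, u i
  | some i => u i

lemma hα_none (a : σ → V →L[ℂ] ℂ) (b : σ → ℂ) (y : ℂ × V) : hα a b none y = y.1 := rfl
lemma hα_some (a : σ → V →L[ℂ] ℂ) (b : σ → ℂ) (i : σ) (y : ℂ × V) : hα a b (some i) y = a i y.2 + b i * y.1 := rfl

lemma hcrit {S : Finset σ} {a : σ → V →L[ℂ] ℂ} {b : σ → ℂ} {u : σ → ℂ} {x : V}
    (hx : x ∈ Crit S a b u) (y : ℂ × V) :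
    ∑ i ∈ Finset.insertNone S, hU S u i * hα a b i y / hα a b i (1, x) = 0 := by
  rw [Finset.sum_insertNone]
  have h1 : ∀ i ∈ S, hU S u (some i) * hα a b (some i) y / hα a b (some i) (1, x)
      = u i * a i (y.2 - y.1 • x) / (a i x + b i) + y.1 * u i := by
    intro i hi
    have h2 := hx.1 i hi
    simp only [hU, hα_some, mul_one, map_sub, map_smul, smul_eq_mul]
    field_simp
    ring
  rw [Finset.sum_congr rfl h1, Finset.sum_add_distrib, hx.2, ← Finset.mul_sum]
  simp only [hU, hα_none]
  ring

lemma crit_proper {Q : Type} (l : Ultrafilter Q) (T : Finset σ) (H : σ) (hH : H ∉ T)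
    (a : σ → V →L[ℂ] ℂ) (b : σ → ℂ) (x : Q → V) (u : Q → σ → ℂ) (u0 : σ → ℂ)
    (hu : Tendsto u (l : Filter Q) (𝓝 u0)) (hu0 : u0 H = 0)
    (hsub : ∀ B ⊆ T, B.Nonempty → ∑ i ∈ B, u0 i ≠ 0)
    (hess : ∀ v, (∀ i ∈ T, a i v = 0) → v = 0)
    (hcr : ∀ᶠ q in (l : Filter Q), x q ∈ Crit (insert H T) a b (u q)) :
    ∃ z ∈ AX T a b, Tendsto x (l : Filter Q) (𝓝 z) := by
  classical
  let α := hα a b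
  let L : Option σ → Q → ℂ := fun i q => α i (1, x q)
  have hLne : ∀ᶠ q in (l : Filter Q), ∀ i ∈ Finset.insertNone (insert H T), L i q ≠ 0 := by
    filter_upwards [hcr] with q hq i hi
    match i, hi with
    | none, _ => exact one_ne_zero
    | some i, hi =>
      have := hq.1 i (Finset.some_mem_insertNone.1 hi)
      show a i (x q) + b i * 1 ≠ 0
      rwa [mul_one]
  have hmin : ∀ᶠ q in (l : Filter Q), ∃ i0 ∈ (↑(Finset.insertNone T) : Set (Option σ)),
      ∀ i ∈ Finset.insertNone T, ‖L i0 q‖ ≤ ‖L i q‖ := Eventually.of_forall fun q => by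
    obtain ⟨i0, h0, h1⟩ := Finset.exists_min_image (Finset.insertNone T) (fun i => ‖L i q‖)
      ⟨none, Finset.none_mem_insertNone⟩
    exact ⟨i0, h0, h1⟩
  rw [Ultrafilter.eventually_exists_mem_iff (Finset.finite_toSet _)] at hmin
  obtain ⟨i0, hi0, hmin⟩ := hmin
  have hi0 : i0 ∈ Finset.insertNone T := hi0
  have hsubN : Finset.insertNone T ⊆ Finset.insertNone (insert H T) := by
    intro i hi
    match i, hi with
    | none, _ => exact Finset.none_mem_insertNone
    | some i, hi => exact Finset.some_mem_insertNone.2 (Finset.mem_insert_of_mem (Finset.some_mem_insertNone.1 hi))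
  let y : Q → ℂ × V := fun q => (L i0 q)⁻¹ • ((1 : ℂ), x q)
  let r : Option σ → Q → ℂ := fun i q => α i (y q)
  have hr : ∀ i q, r i q = (L i0 q)⁻¹ * L i q := fun i q => by
    show α i ((L i0 q)⁻¹ • ((1 : ℂ), x q)) = _
    rw [map_smul]; rfl
  have hr1 : ∀ᶠ q in (l : Filter Q), ∀ i ∈ Finset.insertNone T, 1 ≤ ‖r i q‖ := by
    filter_upwards [hmin, hLne] with q h1 h2 i hi
    rw [hr, norm_mul, norm_inv]
    have h3 : 0 < ‖L i0 q‖ := norm_pos_iff.2 (h2 i0 (hsubN hi0))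
    have h4 := h1 i hi
    rw [inv_mul_eq_div, le_div_iff₀ h3, one_mul]; exact h4
  let Bd : Option σ → Prop := fun i => ∃ c, Tendsto (r i) (l : Filter Q) (𝓝 c)
  have hc : ∀ i, ∃ c, Bd i → Tendsto (r i) (l : Filter Q) (𝓝 c) := fun i => by
    by_cases h : Bd i
    · obtain ⟨c, hc⟩ := h; exact ⟨c, fun _ => hc⟩
    · exact ⟨0, fun h' => absurd h' h⟩
  choose c hc using hc
  obtain ⟨w, hw⟩ := lim_mem (κ := {i // Bd i}) (l : Filter Q) (fun i => α i.1) y (fun i => c i.1)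
    (fun i => hc i.1 i.2)
  have hw : ∀ i, Bd i → α i w = c i := fun i hi => hw ⟨i, hi⟩
  have hcne : ∀ i ∈ Finset.insertNone T, Bd i → c i ≠ 0 := by
    intro i hi hb h0
    have h1 : Tendsto (fun q => ‖r i q‖) (l : Filter Q) (𝓝 ‖c i‖) := (hc i hb).norm
    have h2 := ge_of_tendsto h1 (hr1.mono fun q hq => hq i hi)
    rw [h0, norm_zero] at h2
    linarith
  have hui : ∀ i, Tendsto (fun q => u q i) (l : Filter Q) (𝓝 (u0 i)) := fun i => tendsto_pi_nhds.1 hu i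
  have hUi : ∀ i, Tendsto (fun q => hU (insert H T) (u q) i) (l : Filter Q) (𝓝 (hU (insert H T) u0 i)) := by
    intro i
    match i with
    | none => exact (tendsto_finsetSum _ fun i _ => hui i).neg
    | some i => exact hui i
  have hterm : ∀ i ∈ Finset.insertNone T,
      Tendsto (fun q => hU (insert H T) (u q) i * α i w / r i q) (l : Filter Q)
        (𝓝 (if Bd i then hU (insert H T) u0 i else 0)) := by
    intro i hi
    by_cases hb : Bd i
    · rw [if_pos hb]
      have h1 := ((hUi i).mul_const (α i w)).div (hc i hb) (hcne i hi hb)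
      rw [hw i hb, mul_div_cancel_right₀ _ (hcne i hi hb)] at h1
      rw [hw i hb]
      exact h1
    · rw [if_neg hb]
      have h1 : Tendsto (fun q => (r i q)⁻¹) (l : Filter Q) (𝓝 0) := (ultra_dich l (r i)).resolve_left hb
      have h2 := ((hUi i).mul_const (α i w)).mul h1
      rw [mul_zero] at h2
      exact h2
  have htermH : Tendsto (fun q => hU (insert H T) (u q) (some H) * α (some H) w / r (some H) q) (l : Filter Q) (𝓝 0) := by
    have hU0 : Tendsto (fun q => hU (insert H T) (u q) (some H)) (l : Filter Q) (𝓝 0) := by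
      have := hUi (some H)
      rwa [show hU (insert H T) u0 (some H) = 0 from hu0] at this
    by_cases hb : Bd (some H)
    · by_cases h0 : c (some H) = 0
      · rw [hw _ hb, h0]
        simp
      · have h1 := (hU0.mul_const (α (some H) w)).div (hc _ hb) h0
        rw [zero_mul, zero_div] at h1
        exact h1
    · have h1 := (ultra_dich l (r (some H))).resolve_left hb
      have h2 := (hU0.mul_const (α (some H) w)).mul h1
      rw [mul_zero] at h2
      exact h2
  have hsum0 : ∀ᶠ q in (l : Filter Q), hU (insert H T) (u q) (some H) * α (some H) w / r (some H) q +
      ∑ i ∈ Finset.insertNone T, hU (insert H T) (u q) i * α i w / r i q = 0 := by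
    filter_upwards [hcr, hLne] with q h1 h2
    have h3 := hcrit h1 w
    have h4 : ∀ i, hU (insert H T) (u q) i * α i w / r i q =
        L i0 q * (hU (insert H T) (u q) i * α i w / L i q) := by
      intro i
      have := h2 i0 (hsubN hi0)
      rw [hr, div_eq_mul_inv, mul_inv, inv_inv]
      ring
    simp only [h4]
    rw [Finset.sum_insertNone, Finset.sum_insert hH] at h3
    rw [Finset.sum_insertNone, ← Finset.mul_sum]
    linear_combination L i0 q * h3
  have hlim : (0 : ℂ) = 0 + ∑ i ∈ Finset.insertNone T, (if Bd i then hU (insert H T) u0 i else 0) := by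
    refine tendsto_nhds_unique (tendsto_const_nhds.congr' (hsum0.mono fun q hq => hq.symm)) ?_
    exact htermH.add (tendsto_finsetSum _ hterm)
  rw [zero_add, Finset.sum_insertNone, ← Finset.sum_filter] at hlim
  have hU0n : hU (insert H T) u0 none = - ∑ i ∈ T, u0 i := by
    show - ∑ i ∈ insert H T, u0 i = _
    rw [Finset.sum_insert hH, hu0, zero_add]
  have hi0b : Bd i0 := ⟨1, tendsto_const_nhds.congr' (hLne.mono fun q hq => by
    rw [hr, inv_mul_cancel₀ (hq i0 (hsubN hi0))])⟩
  have hnb : Bd none := by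
    by_contra hnb
    rw [if_neg hnb, zero_add] at hlim
    refine hsub _ (Finset.filter_subset _ T) ?_ hlim.symm
    match i0, hi0, hi0b with
    | none, _, h => exact absurd h hnb
    | some j, hj, h => exact ⟨j, Finset.mem_filter.2 ⟨Finset.some_mem_insertNone.1 hj, h⟩⟩
  rw [if_pos hnb, hU0n, ← Finset.sum_filter_add_sum_filter_not T (fun i => Bd (some i))] at hlim
  have hall : ∀ i ∈ T, Bd (some i) := by
    by_contra hcon
    push Not at hcon
    obtain ⟨i, hi, hib⟩ := hcon
    refine hsub (T.filter fun i => ¬ Bd (some i)) (Finset.filter_subset _ T) ⟨i, Finset.mem_filter.2 ⟨hi, hib⟩⟩ ?_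
    have hlim' : (0:ℂ) = -(∑ i ∈ T with Bd (some i), u0 i + ∑ i ∈ T with ¬Bd (some i), u0 i) +
      ∑ i ∈ T with Bd (some i), u0 i := hlim
    linear_combination hlim'
  have hcn := hcne none Finset.none_mem_insertNone hnb
  have hli : ∀ i ∈ T, Tendsto (fun q => a i (x q)) (l : Filter Q) (𝓝 (c (some i) / c none - b i)) := by
    intro i hi
    have h1 := ((hc _ (hall i hi)).div (hc _ hnb) hcn).sub_const (b i)
    refine h1.congr' ?_
    filter_upwards [hLne] with q hq
    have h3 := hq i0 (hsubN hi0)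
    show r (some i) q / r none q - b i = _
    rw [hr, hr]
    have h4 : L none q = 1 := rfl
    have h5 : L (some i) q = a i (x q) + b i * 1 := rfl
    rw [h4, h5]
    field_simp
    ring
  obtain ⟨z, hz, hzt⟩ := lim_inj (κ := T) (l : Filter Q) (fun i => a i.1)
    (fun v hv => hess v fun i hi => hv ⟨i, hi⟩) x (fun i => c (some i.1) / c none - b i.1) (fun i => hli i.1 i.2)
  refine ⟨z, ?_, hzt⟩
  intro i hi
  rw [hz ⟨i, hi⟩, sub_add_cancel]
  exact div_ne_zero (hcne _ (Finset.some_mem_insertNone.2 hi) (hall i hi)) hcn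

end proper

end

section
open CategoryTheory AlgebraicTopology
set_option linter.unusedSectionVars false

section step
open Filter Topology

lemma gen_sums {σ : Type} [Fintype σ] [DecidableEq σ] :
    Generically (fun u : σ → ℂ => ∀ B : Finset σ, B.Nonempty → ∑ i ∈ B, u i ≠ 0) := by
  apply gen_all
  intro B
  by_cases hB : B.Nonempty
  · refine ⟨∑ i ∈ B, MvPolynomial.X i, ?_, fun u hu _ => by simpa using hu⟩
    obtain ⟨i, hi⟩ := hB
    intro h
    have := congrArg (MvPolynomial.eval (Pi.single i (1 : ℂ))) h
    simp [hi, Pi.single_apply] at this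
  · exact gen_true fun u h => absurd h hB

variable {σ : Type} [Fintype σ] [DecidableEq σ] {V : Type} [NormedAddCommGroup V] [NormedSpace ℂ V]
  [FiniteDimensional ℂ V]

lemma sum_surj (T : Finset σ) (a : σ → V →L[ℂ] ℂ) (hess : ∀ v, (∀ i ∈ T, a i v = 0) → v = 0)
    (ξ : Module.Dual ℂ V) : ∃ c : σ → ℂ, ∀ v, ∑ i ∈ T, c i * a i v = ξ v := by
  let f : V →ₗ[ℂ] (T → ℂ) := LinearMap.pi fun i => (a i.1 : V →ₗ[ℂ] ℂ)
  have hf : Function.Injective f := by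
    rw [injective_iff_map_eq_zero]
    intro v hv
    exact hess v fun i hi => congrFun hv ⟨i, hi⟩
  obtain ⟨η, hη⟩ := LinearMap.dualMap_surjective_of_injective hf ξ
  refine ⟨fun i => if h : i ∈ T then η (Pi.single ⟨i, h⟩ 1) else 0, fun v => ?_⟩
  rw [← hη]
  show _ = η (f v)
  rw [LinearMap.pi_apply_eq_sum_univ η, ← Finset.sum_coe_sort T]
  refine Finset.sum_congr rfl fun i _ => ?_
  beta_reduce
  rw [dif_pos i.2, smul_eq_mul, mul_comm]
  congr 2
  funext j
  simp [Pi.single_apply, eq_comm]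

lemma avoid (T : Finset σ) (H : σ) (a : σ → V →L[ℂ] ℂ) (b : σ → ℂ)
    (hess : ∀ v, (∀ i ∈ T, a i v = 0) → v = 0) (v0 p0 : V) (hv0 : a H v0 = 1) (hp0 : a H p0 + b H = 0)
    (P : (σ → ℂ) → Prop) (hP : Generically P) :
    ∃ u, P u ∧ ∀ x ∈ Crit T a b u, a H x + b H ≠ 0 := by
  obtain ⟨g, hg, hgP⟩ := hP
  let W : Submodule ℂ V := LinearMap.ker (a H : V →ₗ[ℂ] ℂ)
  let φ : (σ → ℂ) →ₗ[ℂ] Module.Dual ℂ V := ∑ i ∈ T, (LinearMap.proj i).smulRight (a i : V →ₗ[ℂ] ℂ)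
  have hφ : ∀ c v, φ c v = ∑ i ∈ T, c i * a i v := fun c v => by simp [φ]
  have hφs : LinearMap.range φ = ⊤ := by
    rw [LinearMap.range_eq_top]
    intro ξ
    obtain ⟨c, hc⟩ := sum_surj T a hess ξ
    exact ⟨c, LinearMap.ext fun v => by rw [hφ, hc]⟩
  let K := LinearMap.ker φ
  have hKdim : Module.finrank ℂ V + Module.finrank ℂ K = Fintype.card σ := by
    have := φ.finrank_range_add_finrank_ker
    rwa [hφs, finrank_top, Subspace.dual_finrank_eq, Module.finrank_fintype_fun_eq_card] at this
  have hWdim : 1 + Module.finrank ℂ W = Module.finrank ℂ V := by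
    have := (a H : V →ₗ[ℂ] ℂ).finrank_range_add_finrank_ker
    have h2 : LinearMap.range (a H : V →ₗ[ℂ] ℂ) = ⊤ := by
      rw [LinearMap.range_eq_top]
      intro c
      exact ⟨c • v0, by simp [hv0]⟩
    rwa [h2, finrank_top, Module.finrank_self] at this
  let f : W × K → (σ → ℂ) := fun q i => if i ∈ T then (a i (p0 + q.1) + b i) * (q.2 : σ → ℂ) i else (q.2 : σ → ℂ) i
  have hf : ContDiff ℝ 1 f := by
    rw [contDiff_pi]
    intro i
    have h1 : ContDiff ℝ 1 (fun q : W × K => (q.2 : σ → ℂ) i) := by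
      have : (fun q : W × K => (q.2 : σ → ℂ) i) =
        ((ContinuousLinearMap.proj (R := ℂ) (φ := fun _ : σ => ℂ) i).comp (K.subtypeL.comp (ContinuousLinearMap.snd ℂ W K))).restrictScalars ℝ := rfl
      rw [this]; exact ContinuousLinearMap.contDiff _
    have h2 : ContDiff ℝ 1 (fun q : W × K => a i (p0 + q.1) + b i) := by
      have : (fun q : W × K => a i (p0 + q.1) + b i) = fun q =>
        (((a i).comp (W.subtypeL.comp (ContinuousLinearMap.fst ℂ W K))).restrictScalars ℝ) q + (a i p0 + b i) := by
        funext q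
        show a i (p0 + q.1) + b i = a i q.1 + (a i p0 + b i)
        rw [map_add]; ring
      rw [this]; exact (ContinuousLinearMap.contDiff _).add contDiff_const
    by_cases hi : i ∈ T
    · simp only [f, if_pos hi]; exact h2.mul h1
    · simp only [f, if_neg hi]; exact h1
  have hd := hf.dense_compl_range_of_finrank_lt_finrank (by
    rw [finrank_real_of_complex, finrank_real_of_complex, Module.finrank_prod, Module.finrank_fintype_fun_eq_card]
    omega)
  have hopen : IsOpen {u : σ → ℂ | MvPolynomial.eval u g ≠ 0} :=
    isOpen_ne_fun (MvPolynomial.continuous_eval g) continuous_const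
  have hne : {u : σ → ℂ | MvPolynomial.eval u g ≠ 0}.Nonempty := by
    by_contra hcon
    rw [Set.not_nonempty_iff_eq_empty] at hcon
    apply hg
    apply MvPolynomial.funext
    intro u
    by_contra hu
    have : u ∈ {u : σ → ℂ | MvPolynomial.eval u g ≠ 0} := by simpa using hu
    rw [hcon] at this; exact this
  obtain ⟨u, hu1, hu2⟩ := hd.inter_open_nonempty _ hopen hne
  refine ⟨u, hgP u hu1, ?_⟩
  intro x hx hxH
  apply hu2
  have hxW : x - p0 ∈ W := by
    show a H (x - p0) = 0
    rw [map_sub]; linear_combination hxH - hp0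
  let c : σ → ℂ := fun i => if i ∈ T then u i / (a i x + b i) else u i
  have hcK : c ∈ K := by
    rw [LinearMap.mem_ker]
    ext v
    rw [hφ, LinearMap.zero_apply, ← hx.2 v]
    refine Finset.sum_congr rfl fun i hi => ?_
    simp only [c, if_pos hi]; ring
  refine ⟨(⟨x - p0, hxW⟩, ⟨c, hcK⟩), ?_⟩
  funext i
  by_cases hi : i ∈ T
  · simp only [f, c, if_pos hi]
    rw [add_sub_cancel, mul_div_cancel₀ _ (hx.1 i hi)]
  · simp only [f, c, if_neg hi]

/-- the modified system -/
def FF (T : Finset σ) (H : σ) (a : σ → V →L[ℂ] ℂ) (b : σ → ℂ) (v0 : V) (q : V × (σ → ℂ)) : V →L[ℂ] ℂ :=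
  ∑ i ∈ T, (q.2 i / (a i q.1 + b i)) • ((a i - a i v0 • a H) + ((a H q.1 + b H) * a i v0) • a H) + q.2 H • a H

lemma FF_apply (T : Finset σ) (H : σ) (a : σ → V →L[ℂ] ℂ) (b : σ → ℂ) (v0 : V) (q : V × (σ → ℂ)) (w : V) :
    FF T H a b v0 q w = ∑ i ∈ T, (q.2 i / (a i q.1 + b i)) * ((a i w - a i v0 * a H w) + ((a H q.1 + b H) * a i v0) * a H w) + q.2 H * a H w := by
  simp [FF, mul_add]

lemma FF_zero_iff (T : Finset σ) (H : σ) (a : σ → V →L[ℂ] ℂ) (b : σ → ℂ) (v0 : V) (hv0 : a H v0 = 1)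
    (x : V) (u : σ → ℂ) :
    FF T H a b v0 (x, u) = 0 ↔ (∀ w, a H w = 0 → ∑ i ∈ T, u i * a i w / (a i x + b i) = 0) ∧
      u H + (a H x + b H) * ∑ i ∈ T, u i * a i v0 / (a i x + b i) = 0 := by
  have hW : ∀ w, a H w = 0 → FF T H a b v0 (x, u) w = ∑ i ∈ T, u i * a i w / (a i x + b i) := by
    intro w hw
    rw [FF_apply, hw, mul_zero, add_zero]
    refine Finset.sum_congr rfl fun i _ => ?_
    ring
  have hv : FF T H a b v0 (x, u) v0 = u H + (a H x + b H) * ∑ i ∈ T, u i * a i v0 / (a i x + b i) := by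
    rw [FF_apply, hv0, mul_one, add_comm, Finset.mul_sum]
    congr 1
    refine Finset.sum_congr rfl fun i _ => ?_
    ring
  constructor
  · intro h
    refine ⟨fun w hw => ?_, ?_⟩
    · rw [← hW w hw, h]; rfl
    · rw [← hv, h]; rfl
  · rintro ⟨h1, h2⟩
    ext w
    have hd : w = (w - a H w • v0) + a H w • v0 := by abel
    have h3 : a H (w - a H w • v0) = 0 := by simp [hv0]
    rw [hd, map_add, map_smul, hv, h2, hW _ h3, h1 _ h3]
    simp

lemma FF_contDiffAt (T : Finset σ) (H : σ) (a : σ → V →L[ℂ] ℂ) (b : σ → ℂ) (v0 : V)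
    {x : V} (hx : x ∈ AX T a b) (u : σ → ℂ) : ContDiffAt ℂ 1 (FF T H a b v0) (x, u) := by
  have hl : ∀ i, ContDiff ℂ 1 (fun q : V × (σ → ℂ) => a i q.1 + b i) := fun i =>
    ((a i).contDiff.comp contDiff_fst).add contDiff_const
  have hu : ∀ i, ContDiff ℂ 1 (fun q : V × (σ → ℂ) => q.2 i) := fun i =>
    (contDiff_apply ℂ ℂ i).comp contDiff_snd
  unfold FF
  refine ContDiffAt.add (ContDiffAt.sum fun i hi => ?_) ?_
  · refine ContDiffAt.smul ((hu i).contDiffAt.div (hl i).contDiffAt (hx i hi)) ?_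
    exact contDiffAt_const.add (((hl H).contDiffAt.mul contDiffAt_const).smul contDiffAt_const)
  · exact (hu H).contDiffAt.smul contDiffAt_const

lemma FF_fderiv (T : Finset σ) (H : σ) (a : σ → V →L[ℂ] ℂ) (b : σ → ℂ) (v0 : V)
    {x : V} (hx : x ∈ AX T a b) (u : σ → ℂ) (v w : V) :
    fderiv ℂ (FF T H a b v0) (x, u) (v, 0) w =
      ∑ i ∈ T, (-(u i * a i v / (a i x + b i) ^ 2) * ((a i w - a i v0 * a H w) + ((a H x + b H) * a i v0) * a H w)
        + (u i / (a i x + b i)) * ((a H v * a i v0) * a H w)) := by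
  have h1 : HasFDerivAt (FF T H a b v0) (fderiv ℂ (FF T H a b v0) (x, u)) (x, u) :=
    ((FF_contDiffAt T H a b v0 hx u).differentiableAt (by norm_num)).hasFDerivAt
  have hline : HasDerivAt (fun s : ℂ => (x + s • v, u)) (v, (0 : σ → ℂ)) 0 := by
    have h := ((hasDerivAt_id (0 : ℂ)).smul_const v).const_add x
    rw [one_smul] at h
    exact h.prodMk (hasDerivAt_const 0 u)
  have h2 : HasDerivAt (fun s : ℂ => FF T H a b v0 (x + s • v, u)) (fderiv ℂ (FF T H a b v0) (x, u) (v, 0)) 0 := by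
    have h1' : HasFDerivAt (FF T H a b v0) (fderiv ℂ (FF T H a b v0) (x, u)) ((fun s : ℂ => (x + s • v, u)) 0) := by
      simpa using h1
    exact h1'.comp_hasDerivAt (0 : ℂ) hline
  have h3 : HasDerivAt (fun s : ℂ => FF T H a b v0 (x + s • v, u) w) (fderiv ℂ (FF T H a b v0) (x, u) (v, 0) w) 0 :=
    ((ContinuousLinearMap.apply ℂ ℂ w : (V →L[ℂ] ℂ) →L[ℂ] ℂ).hasFDerivAt.comp_hasDerivAt (0 : ℂ) h2)
  have hl : ∀ i, HasDerivAt (fun s : ℂ => a i (x + s • v) + b i) (a i v) 0 := by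
    intro i
    have : (fun s : ℂ => a i (x + s • v) + b i) = fun s => s * a i v + (a i x + b i) := by
      funext s; simp; ring
    rw [this]
    have := ((hasDerivAt_id (0 : ℂ)).mul_const (a i v)).add_const (a i x + b i)
    simpa using this
  refine h3.unique ?_
  simp only [FF_apply]
  have hsum : HasDerivAt (fun s : ℂ => ∑ i ∈ T, (u i / (a i (x + s • v) + b i)) * ((a i w - a i v0 * a H w) + ((a H (x + s • v) + b H) * a i v0) * a H w)) (∑ i ∈ T, (-(u i * a i v / (a i x + b i) ^ 2) * ((a i w - a i v0 * a H w) + ((a H x + b H) * a i v0) * a H w)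
        + (u i / (a i x + b i)) * ((a H v * a i v0) * a H w))) 0 := by
    apply HasDerivAt.fun_sum
    intro i hi
    have hne : a i (x + (0 : ℂ) • v) + b i ≠ 0 := by simpa using hx i hi
    have g1 := (hasDerivAt_const (0 : ℂ) (u i)).div (hl i) hne
    have g2 := (((hl H).mul_const (a i v0)).mul_const (a H w)).const_add (a i w - a i v0 * a H w)
    have g3 := g1.mul g2
    simp only [zero_smul, add_zero, Pi.div_apply] at g3
    exact g3.congr_deriv (by field_simp [hx i hi]; ring)
  exact hsum.add_const _

lemma crit_congr {T : Finset σ} {a : σ → V →L[ℂ] ℂ} {b : σ → ℂ} {u u' : σ → ℂ} (h : ∀ i ∈ T, u i = u' i)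
    {N : ℕ} (hg : GoodCount T a b N u) : GoodCount T a b N u' := by
  have h1 : Crit T a b u = Crit T a b u' := by
    ext x
    refine and_congr Iff.rfl (forall_congr' fun v => ?_)
    rw [Finset.sum_congr rfl fun i hi => by rw [h i hi]]
  refine ⟨h1 ▸ hg.1, fun x hx v hv => hg.2 x (h1 ▸ hx) v fun w => ?_⟩
  rw [← hv w]
  exact Finset.sum_congr rfl fun i hi => by rw [h i hi]

end step

end

section
open CategoryTheory AlgebraicTopology
set_option linter.unusedSectionVars false

section step2
open Filter Topology
variable {σ : Type} [Fintype σ] [DecidableEq σ] {V : Type} [NormedAddCommGroup V] [NormedSpace ℂ V]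
  [FiniteDimensional ℂ V]

/-- kernel of a form -/
def KerW (f : V →L[ℂ] ℂ) : Submodule ℂ V := LinearMap.ker (f : V →ₗ[ℂ] ℂ)

lemma mem_KerW (f : V →L[ℂ] ℂ) (w : V) : w ∈ KerW f ↔ f w = 0 := Iff.rfl

def ra (a : σ → V →L[ℂ] ℂ) (H : σ) : σ → (KerW (a H)) →L[ℂ] ℂ := fun i => (a i).comp (KerW (a H)).subtypeL
def rb (a : σ → V →L[ℂ] ℂ) (b : σ → ℂ) (p0 : V) : σ → ℂ := fun i => a i p0 + b i

lemma ra_apply (a : σ → V →L[ℂ] ℂ) (H i : σ) (w : KerW (a H)) : ra a H i w = a i w := rfl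

lemma ra_add (a : σ → V →L[ℂ] ℂ) (b : σ → ℂ) (H i : σ) (p0 : V) (w : KerW (a H)) :
    ra a H i w + rb a b p0 i = a i (p0 + w) + b i := by
  rw [ra_apply, rb, map_add]; ring

lemma FF_fderiv' (T : Finset σ) (H : σ) (a : σ → V →L[ℂ] ℂ) (b : σ → ℂ) (v0 : V)
    {x : V} (hx : x ∈ AX T a b) (u : σ → ℂ) (v w : V) :
    fderiv ℂ (FF T H a b v0) (x, u) (v, 0) w =
      -(∑ i ∈ T, u i * a i v * a i w / (a i x + b i) ^ 2) + a H w * (1 - (a H x + b H)) *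
        (∑ i ∈ T, u i * a i v * a i v0 / (a i x + b i) ^ 2)
      + a H v * a H w * ∑ i ∈ T, u i * a i v0 / (a i x + b i) := by
  rw [FF_fderiv T H a b v0 hx, Finset.mul_sum, Finset.mul_sum, ← Finset.sum_neg_distrib,
    ← Finset.sum_add_distrib, ← Finset.sum_add_distrib]
  refine Finset.sum_congr rfl fun i hi => ?_
  ring

lemma crit_insert_iff (T : Finset σ) (H : σ) (hH : H ∉ T) (a : σ → V →L[ℂ] ℂ) (b : σ → ℂ) (v0 : V)
    (hv0 : a H v0 = 1) (u : σ → ℂ) (hu : u H ≠ 0) (x : V) :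
    (x ∈ AX T a b ∧ FF T H a b v0 (x, u) = 0) ↔ x ∈ Crit (insert H T) a b u := by
  rw [FF_zero_iff T H a b v0 hv0]
  constructor
  · rintro ⟨hx, h1, h2⟩
    have ht : a H x + b H ≠ 0 := by
      intro ht
      rw [ht, zero_mul, add_zero] at h2
      exact hu h2
    refine ⟨fun i hi => ?_, fun w => ?_⟩
    · rcases Finset.mem_insert.1 hi with rfl | hi
      · exact ht
      · exact hx i hi
    · rw [Finset.sum_insert hH]
      have h3 := h1 (w - a H w • v0) (by simp [hv0])
      have h4 : ∑ i ∈ T, u i * a i (w - a H w • v0) / (a i x + b i)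
          = ∑ i ∈ T, u i * a i w / (a i x + b i) - a H w * ∑ i ∈ T, u i * a i v0 / (a i x + b i) := by
        rw [Finset.mul_sum, ← Finset.sum_sub_distrib]
        refine Finset.sum_congr rfl fun i _ => ?_
        simp only [map_sub, map_smul, smul_eq_mul]; ring
      rw [h4] at h3
      have h5 : ∑ i ∈ T, u i * a i w / (a i x + b i) = a H w * ∑ i ∈ T, u i * a i v0 / (a i x + b i) := by
        linear_combination h3
      rw [h5]
      field_simp
      linear_combination a H w * h2
  · rintro ⟨hx, h⟩
    have ht := hx H (Finset.mem_insert_self _ _)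
    refine ⟨fun i hi => hx i (Finset.mem_insert_of_mem hi), fun w hw => ?_, ?_⟩
    · have := h w
      rw [Finset.sum_insert hH, hw] at this
      simpa using this
    · have := h v0
      rw [Finset.sum_insert hH, hv0] at this
      field_simp at this
      linear_combination this

lemma zeros_u0 (T : Finset σ) (H : σ) (a : σ → V →L[ℂ] ℂ) (b : σ → ℂ) (v0 p0 : V)
    (hv0 : a H v0 = 1) (hp0 : a H p0 + b H = 0) (u : σ → ℂ) (hu : u H = 0)
    (hav : ∀ x ∈ Crit T a b u, a H x + b H ≠ 0) :
    {x | x ∈ AX T a b ∧ FF T H a b v0 (x, u) = 0} = Crit T a b u ∪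
      (fun w : KerW (a H) => p0 + (w : V)) '' Crit T (ra a H) (rb a b p0) u := by
  have hW : ∀ w : KerW (a H), w ∈ Crit T (ra a H) (rb a b p0) u ↔ p0 + (w : V) ∈ AX T a b ∧
      ∀ v, a H v = 0 → ∑ i ∈ T, u i * a i v / (a i (p0 + w) + b i) = 0 := by
    intro w
    refine and_congr ?_ ?_
    · refine forall₂_congr fun i _ => ?_
      rw [ra_add]
    · simp only [ra_add]
      simp only [ra_apply]
      constructor
      · intro h v hv; exact h ⟨v, hv⟩
      · intro h v; exact h v v.2
  ext x
  have : x ∈ {x | x ∈ AX T a b ∧ FF T H a b v0 (x, u) = 0} ↔ (x ∈ AX T a b ∧ FF T H a b v0 (x, u) = 0) := Iff.rfl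
  rw [this, FF_zero_iff T H a b v0 hv0, hu, zero_add, mul_eq_zero]
  constructor
  · rintro ⟨hx, h1, h2 | h2⟩
    · right
      refine ⟨⟨x - p0, ?_⟩, ?_, by simp⟩
      · rw [mem_KerW, map_sub]; linear_combination h2 - hp0
      · rw [hW]
        simp only [add_sub_cancel]
        exact ⟨hx, h1⟩
    · left
      refine ⟨hx, fun w => ?_⟩
      have h3 := h1 (w - a H w • v0) (by simp [hv0])
      have h4 : ∑ i ∈ T, u i * a i (w - a H w • v0) / (a i x + b i)
          = ∑ i ∈ T, u i * a i w / (a i x + b i) - a H w * ∑ i ∈ T, u i * a i v0 / (a i x + b i) := by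
        rw [Finset.mul_sum, ← Finset.sum_sub_distrib]
        refine Finset.sum_congr rfl fun i _ => ?_
        simp only [map_sub, map_smul, smul_eq_mul]; ring
      rw [h4, h2] at h3
      simpa using h3
  · rintro (h | ⟨w, hw, rfl⟩)
    · exact ⟨h.1, fun w _ => h.2 w, Or.inr (h.2 v0)⟩
    · have h := (hW w).1 hw
      refine ⟨h.1, h.2, Or.inl ?_⟩
      have := w.2
      rw [mem_KerW] at this
      rw [map_add, this]; linear_combination hp0

lemma step_local (T : Finset σ) (H : σ) (hH : H ∉ T) (a : σ → V →L[ℂ] ℂ) (b : σ → ℂ)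
    (hess : ∀ v, (∀ i ∈ T, a i v = 0) → v = 0) (v0 p0 : V)
    (hv0 : a H v0 = 1) (hp0 : a H p0 + b H = 0) (N1 N2 : ℕ) (u0 : σ → ℂ) (hu0 : u0 H = 0)
    (hav : ∀ x ∈ Crit T a b u0, a H x + b H ≠ 0)
    (hsub : ∀ B ⊆ T, B.Nonempty → ∑ i ∈ B, u0 i ≠ 0)
    (h1 : GoodCount T a b N1 u0) (h2 : GoodCount T (ra a H) (rb a b p0) N2 u0) :
    ∀ᶠ u in 𝓝 u0, u H ≠ 0 → GoodCount (insert H T) a b (N1 + N2) u := by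
  have hz := zeros_u0 T H a b v0 p0 hv0 hp0 u0 hu0 hav
  have hinjW : Function.Injective (fun w : KerW (a H) => p0 + (w : V)) :=
    fun w w' h => Subtype.ext (add_left_cancel h)
  have key := count_abs (AX T a b) AX_open (FF T H a b v0) u0
    (fun x hx => FF_contDiffAt T H a b v0 hx u0)
    (by rw [← (LinearMap.toContinuousLinearMap : (V →ₗ[ℂ] ℂ) ≃ₗ[ℂ] (V →L[ℂ] ℂ)).finrank_eq]
        exact (Subspace.dual_finrank_eq (K := ℂ) (V := V)).symm) (N1 + N2)
    (by
      rw [hz, Set.encard_union_eq, hinjW.encard_image, h1.1, h2.1]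
      · push_cast; rfl
      · rw [Set.disjoint_left]
        rintro x hx ⟨w, -, rfl⟩
        apply hav _ hx
        have := w.2
        rw [mem_KerW] at this
        rw [map_add, this]; linear_combination hp0)
    (by
      intro x hx hF v hv
      have hFv : ∀ w, _ := fun w => (FF_fderiv' T H a b v0 hx u0 v w).symm.trans
        (by rw [hv]; rfl : _ = (0 : ℂ))
      by_cases hxc : x ∈ Crit T a b u0
      · have ht := hav x hxc
        apply h1.2 x hxc v
        have hg := hxc.2 v0
        have hG0 := hFv v0
        rw [hg, hv0] at hG0
        have hG : ∑ i ∈ T, u0 i * a i v * a i v0 / (a i x + b i) ^ 2 = 0 := by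
          have : (a H x + b H) * ∑ i ∈ T, u0 i * a i v * a i v0 / (a i x + b i) ^ 2 = 0 := by
            linear_combination -hG0
          exact (mul_eq_zero.1 this).resolve_left ht
        intro w
        have := hFv w
        rw [hg, hG] at this
        linear_combination -this
      · have hx' : x ∈ {x | x ∈ AX T a b ∧ FF T H a b v0 (x, u0) = 0} := ⟨hx, hF⟩
        rw [hz] at hx'
        rcases hx' with hx' | ⟨w0, hw0, hxw⟩
        · exact absurd hx' hxc
        have hxw : p0 + (w0 : V) = x := hxw
        have hw0' : a H (w0 : V) = 0 := w0.2
        have ht : a H x + b H = 0 := by rw [← hxw, map_add, hw0']; linear_combination hp0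
        have hz2 := (FF_zero_iff T H a b v0 hv0 x u0).1 hF
        have hg : ∑ i ∈ T, u0 i * a i v0 / (a i x + b i) ≠ 0 := by
          intro hg
          apply hxc
          refine ⟨hx, fun w => ?_⟩
          have h3 := hz2.1 (w - a H w • v0) (by simp [hv0])
          have h4 : ∑ i ∈ T, u0 i * a i (w - a H w • v0) / (a i x + b i)
              = ∑ i ∈ T, u0 i * a i w / (a i x + b i) - a H w * ∑ i ∈ T, u0 i * a i v0 / (a i x + b i) := by
            rw [Finset.mul_sum, ← Finset.sum_sub_distrib]
            refine Finset.sum_congr rfl fun i _ => ?_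
            simp only [map_sub, map_smul, smul_eq_mul]; ring
          rw [h4, hg] at h3
          simpa using h3
        have hav0 : a H v = 0 := by
          have := hFv v0
          rw [ht, hv0] at this
          have h5 : a H v * ∑ i ∈ T, u0 i * a i v0 / (a i x + b i) = 0 := by linear_combination this
          exact (mul_eq_zero.1 h5).resolve_right hg
        have := h2.2 w0 hw0 ⟨v, hav0⟩ (by
          intro w
          have h6 := hFv w
          have hw : a H (w : V) = 0 := w.2
          rw [hw, hav0] at h6
          simp only [ra_add]
          simp only [ra_apply, hxw]
          linear_combination -h6)
        exact congrArg Subtype.val this)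
    (fun u => u H ≠ 0)
    (by
      intro l hl hev
      exact crit_proper l T H hH a b Prod.fst Prod.snd u0 hl hu0 hsub hess
        (hev.mono fun q hq => (crit_insert_iff T H hH a b v0 hv0 q.2 hq.2.2 q.1).1 ⟨hq.1, hq.2.1⟩))
  filter_upwards [key] with u hu huH
  obtain ⟨k1, k2⟩ := hu huH
  have hset : {x | x ∈ AX T a b ∧ FF T H a b v0 (x, u) = 0} = Crit (insert H T) a b u :=
    Set.ext fun x => crit_insert_iff T H hH a b v0 hv0 u huH x
  refine ⟨hset ▸ k1, fun x hx v hv => ?_⟩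
  have hx' := (crit_insert_iff T H hH a b v0 hv0 u huH x).2 hx
  refine k2 x hx'.1 hx'.2 v ?_
  have ht := hx.1 H (Finset.mem_insert_self _ _)
  have hz2 := ((FF_zero_iff T H a b v0 hv0 x u).1 hx'.2).2
  have hvw : ∀ w, ∑ i ∈ T, u i * a i v * a i w / (a i x + b i) ^ 2 = - (u H * a H v * a H w / (a H x + b H) ^ 2) := by
    intro w
    have := hv w
    rw [Finset.sum_insert hH] at this
    linear_combination this
  ext w
  rw [FF_fderiv' T H a b v0 hx'.1, hvw, hvw, hv0]
  have hg : ∑ i ∈ T, u i * a i v0 / (a i x + b i) = - u H / (a H x + b H) := by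
    field_simp
    linear_combination hz2
  rw [hg]
  simp only [zero_apply]
  field_simp
  ring

lemma count_step (T : Finset σ) (H : σ) (hH : H ∉ T) (a : σ → V →L[ℂ] ℂ) (b : σ → ℂ)
    (hess : ∀ v, (∀ i ∈ T, a i v = 0) → v = 0) (v0 p0 : V)
    (hv0 : a H v0 = 1) (hp0 : a H p0 + b H = 0) (N1 N2 : ℕ)
    (h1 : Generically (GoodCount T a b N1)) (h2 : Generically (GoodCount T (ra a H) (rb a b p0) N2)) :
    Generically (GoodCount (insert H T) a b (N1 + N2)) := by
  obtain ⟨u1, ⟨⟨g1, g2⟩, g3⟩, g4⟩ := avoid T H a b hess v0 p0 hv0 hp0 _ (gen_and (gen_and h1 h2) gen_sums)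
  let u0 := Function.update u1 H 0
  have hu : ∀ i ∈ T, u1 i = u0 i := fun i hi => by
    have : i ≠ H := fun h => hH (h ▸ hi)
    simp [u0, this]
  have hu0 : u0 H = 0 := by simp [u0]
  have hcr : Crit T a b u0 = Crit T a b u1 := by
    ext x
    refine and_congr Iff.rfl (forall_congr' fun v => ?_)
    rw [Finset.sum_congr rfl fun i hi => by rw [← hu i hi]]
  have key := step_local T H hH a b hess v0 p0 hv0 hp0 N1 N2 u0 hu0 (by rwa [hcr])
    (fun B hB hne => by
      rw [Finset.sum_congr rfl fun i hi => (hu i (hB hi)).symm]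
      exact g3 B hne) (crit_congr hu g1) (crit_congr hu g2)
  obtain ⟨U, hU, hUo, hmem⟩ := eventually_nhds_iff.1 key
  refine gen_count (insert H T) a b (N1 + N2) (U := U ∩ {u | u H ≠ 0})
    (hUo.inter (isOpen_ne_fun (continuous_apply H) continuous_const)) ?_ (fun u hu => hU u hu.1 hu.2)
  have hcont : Tendsto (fun s : ℂ => Function.update u0 H s) (𝓝 0) (𝓝 u0) := by
    have : Continuous (fun s : ℂ => Function.update u0 H s) := continuous_const.update H continuous_id
    have h := this.tendsto 0
    have h' : Function.update u0 H 0 = u0 := by rw [← hu0]; exact Function.update_eq_self H u0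
    simpa only [h'] using h
  have h3 : ∀ᶠ s in 𝓝[≠] (0 : ℂ), Function.update u0 H s ∈ U ∧ s ≠ 0 :=
    ((hcont.mono_left nhdsWithin_le_nhds).eventually (hUo.mem_nhds hmem)).and
      eventually_mem_nhdsWithin
  obtain ⟨s, hs1, hs2⟩ := h3.exists
  refine ⟨_, hs1, ?_⟩
  show Function.update u0 H s H ≠ 0
  simpa using hs2

end step2

end

section
open CategoryTheory AlgebraicTopology
set_option linter.unusedSectionVars false

section induct
open Filter Topology
variable {σ : Type} [Fintype σ] [DecidableEq σ]

def AYhomeo {V : Type} [NormedAddCommGroup V] [NormedSpace ℂ V] [FiniteDimensional ℂ V] (S : Finset σ) (H : σ) (a : σ → V →L[ℂ] ℂ)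
    (b : σ → ℂ) (p0 : V) (hp0 : a H p0 + b H = 0) :
    AX (S.erase H) (ra a H) (rb a b p0) ≃ₜ AY S H a b where
  toFun w := ⟨p0 + ((w : KerW (a H)) : V), by
    have h := (w : KerW (a H)).2
    rw [mem_KerW] at h
    rw [map_add, h]; linear_combination hp0, fun i hi => by
    rw [← ra_add]; exact w.2 i hi⟩
  invFun x := ⟨⟨(x : V) - p0, by
    have h := x.2.1
    rw [mem_KerW, map_sub]; linear_combination h - hp0⟩, fun i hi => by
      rw [ra_add, add_sub_cancel]; exact x.2.2 i hi⟩
  left_inv w := by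
    apply Subtype.ext; apply Subtype.ext; simp
  right_inv x := by
    apply Subtype.ext; simp
  continuous_toFun := by fun_prop
  continuous_invFun := by fun_prop

def MainClaim (V : Type) [NormedAddCommGroup V] [NormedSpace ℂ V] (S : Finset σ)
    (a : σ → V →L[ℂ] ℂ) (b : σ → ℂ) : Prop :=
  FH (AX S a b) ∧ ∃ N : ℕ, (N : ℤ) = (-1) ^ (Module.finrank ℂ V) * eulerChar (AX S a b) ∧
    Generically (GoodCount S a b N)

lemma main_remove {V : Type} [NormedAddCommGroup V] [NormedSpace ℂ V] (S : Finset σ) (H : σ)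
    (a : σ → V →L[ℂ] ℂ) (b : σ → ℂ) (ha : a H = 0) (hb : b H ≠ 0) (hH : H ∈ S)
    (h : MainClaim V (S.erase H) a b) : MainClaim V S a b := by
  have hX : AX S a b = AX (S.erase H) a b := by
    ext x
    constructor
    · intro hx i hi; exact hx i (Finset.mem_of_mem_erase hi)
    · intro hx i hi
      by_cases hiH : i = H
      · subst hiH; rw [ha]; simpa using hb
      · exact hx i (Finset.mem_erase.2 ⟨hiH, hi⟩)
  have hs : ∀ f : σ → ℂ, f H = 0 → ∑ i ∈ S, f i = ∑ i ∈ S.erase H, f i := fun f hf => by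
    rw [← Finset.add_sum_erase _ _ hH, hf, zero_add]
  have hC : ∀ u, Crit S a b u = Crit (S.erase H) a b u := by
    intro u
    ext x
    refine and_congr (by rw [hX]) (forall_congr' fun v => ?_)
    rw [hs _ (by simp [ha])]
  obtain ⟨h1, N, h2, h3⟩ := h
  refine ⟨hX ▸ h1, N, hX ▸ h2, gen_mono h3 fun u hu => ⟨by rw [hC]; exact hu.1, fun x hx v hv => ?_⟩⟩
  refine hu.2 x (hC u ▸ hx) v fun w => ?_
  rw [← hv w, hs _ (by simp [ha])]

theorem main_induct (n : ℕ) : ∀ (V : Type) [NormedAddCommGroup V] [NormedSpace ℂ V] [FiniteDimensional ℂ V]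
    (S : Finset σ) (a : σ → V →L[ℂ] ℂ) (b : σ → ℂ), S.card = n →
    (∀ v, (∀ i ∈ S, a i v = 0) → v = 0) → MainClaim V S a b := by
  induction n with
  | zero =>
    intro V _ _ _ S a b hS hess
    rw [Finset.card_eq_zero] at hS
    subst hS
    have hsub : ∀ v : V, v = 0 := fun v => hess v (by simp)
    haveI : Subsingleton V := ⟨fun x y => by rw [hsub x, hsub y]⟩
    haveI : Unique (AX (∅ : Finset σ) a b) :=
      { default := ⟨0, fun i hi => absurd hi (by simp)⟩
        uniq := fun x => Subtype.ext (hsub _) }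
    obtain ⟨g1, g2⟩ := FH_unique (AX (∅ : Finset σ) a b)
    refine ⟨g1, 1, ?_, gen_true fun u => ⟨?_, fun x _ v _ => hsub v⟩⟩
    · rw [g2, Module.finrank_zero_of_subsingleton]; simp
    · have : Crit (∅ : Finset σ) a b u = {0} := by
        ext x
        simp only [Set.mem_singleton_iff, hsub x, iff_true]
        exact ⟨fun i hi => absurd hi (by simp), fun v => by simp⟩
      rw [this]; simp
  | succ n ih =>
    intro V _ _ _ S a b hS hess
    have hne : S.Nonempty := Finset.card_pos.1 (by omega)
    by_cases hz : ∃ H ∈ S, a H = 0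
    · obtain ⟨H, hH, ha⟩ := hz
      by_cases hb : b H = 0
      · have hX : AX S a b = ∅ := by
          ext x
          simp only [Set.mem_empty_iff_false, iff_false]
          intro hx
          exact hx H hH (by simp [ha, hb])
        haveI : IsEmpty (AX S a b) := by rw [hX]; infer_instance
        obtain ⟨g1, g2⟩ := FH_empty (AX S a b)
        have hC : ∀ u, Crit S a b u = ∅ := fun u => by
          ext x
          simp only [Set.mem_empty_iff_false, iff_false]
          intro hx
          exact hx.1 H hH (by simp [ha, hb])
        refine ⟨g1, 0, by rw [g2]; simp, gen_true fun u => ⟨by rw [hC]; simp, fun x hx => ?_⟩⟩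
        rw [hC] at hx; exact absurd hx (by simp)
      · refine main_remove S H a b ha hb hH (ih V _ a b ?_ fun v hv => hess v fun i hi => ?_)
        · rw [Finset.card_erase_of_mem hH, hS]; rfl
        · by_cases hiH : i = H
          · subst hiH; rw [ha]; rfl
          · exact hv i (Finset.mem_erase.2 ⟨hiH, hi⟩)
    · push Not at hz
      obtain ⟨H, hH⟩ := hne
      have hexv : ∃ v, a H v ≠ 0 := by
        by_contra hcon
        push Not at hcon
        exact hz H hH (ContinuousLinearMap.ext hcon)
      have hcard : (S.erase H).card = n := by rw [Finset.card_erase_of_mem hH, hS]; rfl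
      have key : ∀ v0, a H v0 = 1 → ∃ p0, a H p0 + b H = 0 ∧ MainClaim (KerW (a H)) (S.erase H) (ra a H) (rb a b p0)
          ∧ Module.finrank ℂ V = Module.finrank ℂ (KerW (a H)) + 1 := by
        intro v0 hv0
        refine ⟨(-b H) • v0, by simp [hv0], ?_, ?_⟩
        · refine ih (KerW (a H)) _ _ _ hcard fun w hw => Subtype.ext (hess w fun i hi => ?_)
          by_cases hiH : i = H
          · subst hiH; exact w.2
          · exact hw i (Finset.mem_erase.2 ⟨hiH, hi⟩)
        · have h1 := (a H : V →ₗ[ℂ] ℂ).finrank_range_add_finrank_ker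
          have h2 : LinearMap.range (a H : V →ₗ[ℂ] ℂ) = ⊤ := by
            rw [LinearMap.range_eq_top]
            intro c
            exact ⟨c • v0, by simp [hv0]⟩
          rw [h2, finrank_top, Module.finrank_self] at h1
          rw [← h1, add_comm]; rfl
      by_cases hco : ∀ v, (∀ i ∈ S.erase H, a i v = 0) → v = 0
      · obtain ⟨v1, hv1⟩ := hexv
        have hv0 : a H ((a H v1)⁻¹ • v1) = 1 := by simp [hv1]
        obtain ⟨p0, hp0, ⟨f1, N2, e2, c2⟩, hdim⟩ := key _ hv0
        obtain ⟨f2, N1, e1, c1⟩ := ih V (S.erase H) a b hcard hco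
        obtain ⟨y1, y2⟩ := FH_homeo (AYhomeo S H a b p0 hp0)
        obtain ⟨z1, z2⟩ := delres hH hv0 (y1 f1) f2
        refine ⟨z1, N1 + N2, ?_, ?_⟩
        · rw [z2, ← y2]; push_cast; rw [e1, e2, hdim, pow_succ]; ring
        · have := count_step (S.erase H) H (Finset.notMem_erase _ _) a b hco _ p0 hv0 hp0 N1 N2 c1 c2
          rwa [Finset.insert_erase hH] at this
      · push Not at hco
        obtain ⟨v1, hv1, hv1'⟩ := hco
        have hne1 : a H v1 ≠ 0 := by
          intro h
          refine hv1' (hess v1 fun i hi => ?_)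
          by_cases hiH : i = H
          · subst hiH; exact h
          · exact hv1 i (Finset.mem_erase.2 ⟨hiH, hi⟩)
        have hv0 : a H ((a H v1)⁻¹ • v1) = 1 := by simp [hne1]
        have h0 : ∀ i ∈ S.erase H, a i ((a H v1)⁻¹ • v1) = 0 := fun i hi => by
          rw [map_smul, hv1 i hi, smul_zero]
        obtain ⟨p0, hp0, ⟨f1, N2, e2, c2⟩, hdim⟩ := key _ hv0
        obtain ⟨y1, y2⟩ := FH_homeo (AYhomeo S H a b p0 hp0)
        obtain ⟨z1, z2⟩ := delres_coloop hH hv0 (y1 f1) h0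
        refine ⟨z1, 0, by rw [z2]; simp, gen_mono gen_sums fun u hu => ?_⟩
        have hC : Crit S a b u = ∅ := by
          ext x
          simp only [Set.mem_empty_iff_false, iff_false]
          intro hx
          have h3 := hx.2 ((a H v1)⁻¹ • v1)
          rw [← Finset.add_sum_erase _ _ hH, hv0, Finset.sum_eq_zero fun i hi => by rw [h0 i hi]; simp] at h3
          have h4 := hx.1 H hH
          have h5 := hu {H} (by simp)
          simp only [Finset.sum_singleton] at h5
          rw [add_zero, mul_one] at h3
          exact (div_ne_zero h5 h4) h3
        refine ⟨by rw [hC]; simp, fun x hx => ?_⟩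
        rw [hC] at hx; exact absurd hx (by simp)

end induct

end

section
open CategoryTheory AlgebraicTopology
set_option linter.unusedSectionVars false

section assembly
open Topology
variable {σ : Type} [Fintype σ] [DecidableEq σ] {m : ℕ}

/-- row space map restricted to the columns in `S` -/
def rsp {ρ : Type} [Fintype ρ] (M : Matrix ρ σ ℂ) (S : Finset σ) : (ρ → ℂ) →ₗ[ℂ] (σ → ℂ) :=
  Matrix.mulVecLin (Matrix.of fun i r => if i ∈ S then M r i else 0)

lemma rsp_apply {ρ : Type} [Fintype ρ] (M : Matrix ρ σ ℂ) (S : Finset σ) (x : ρ → ℂ) (i : σ) :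
    rsp M S x i = if i ∈ S then ∑ r, x r * M r i else 0 := by
  simp only [rsp, Matrix.mulVecLin_apply, Matrix.mulVec, dotProduct, Matrix.of_apply]
  split_ifs
  · exact Finset.sum_congr rfl fun r _ => mul_comm _ _
  · simp

lemma rsp_rank {ρ : Type} [Fintype ρ] (M : Matrix ρ σ ℂ) (S : Finset σ) :
    Module.finrank ℂ (LinearMap.range (rsp M S)) =
      Module.finrank ℂ (Submodule.span ℂ ((fun i => fun r => M r i) '' (S : Set σ))) := by
  have h := Matrix.rank_eq_finrank_span_row (Matrix.of fun i r => if i ∈ S then M r i else 0)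
  have h2 : Submodule.span ℂ (Set.range (Matrix.of fun i r => if i ∈ S then M r i else 0).row) =
      Submodule.span ℂ ((fun i => fun r => M r i) '' (S : Set σ)) := by
    apply le_antisymm
    · rw [Submodule.span_le]
      rintro _ ⟨i, rfl⟩
      by_cases hi : i ∈ S
      · apply Submodule.subset_span
        refine ⟨i, hi, ?_⟩
        funext r
        simp [Matrix.row, hi]
      · have : (Matrix.of fun i r => if i ∈ S then M r i else 0).row i = 0 := by
          funext r; simp [Matrix.row, hi]
        rw [this]; exact Submodule.zero_mem _
    · rw [Submodule.span_le]
      rintro _ ⟨i, hi, rfl⟩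
      have hi : i ∈ S := hi
      apply Submodule.subset_span
      refine ⟨i, ?_⟩
      funext r
      simp [Matrix.row, hi]
  rw [← h2, ← h]
  rfl

/-- `L` without its first row -/
def Ash (L : Matrix (Fin (m+1)) σ ℂ) : Matrix (Fin m) σ ℂ := fun k i => L k.succ i

def b0 (L : Matrix (Fin (m+1)) σ ℂ) (S : Finset σ) : σ → ℂ := fun i => if i ∈ S then L 0 i else 0

lemma rsp_cons (L : Matrix (Fin (m+1)) σ ℂ) (S : Finset σ) (w : Fin (m+1) → ℂ) :
    rsp L S w = w 0 • b0 L S + rsp (Ash L) S (fun k => w k.succ) := by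
  funext i
  rw [rsp_apply, Pi.add_apply, Pi.smul_apply, rsp_apply, b0]
  split_ifs
  · rw [Fin.sum_univ_succ]; rfl
  · simp

lemma rk_iff (L : Matrix (Fin (m+1)) σ ℂ) (S : Finset σ) :
    rkA ℂ L (S : Set σ) = rkL ℂ L (S : Set σ) ↔ b0 L S ∈ LinearMap.range (rsp (Ash L) S) := by
  have hA : rkA ℂ L (S : Set σ) = Module.finrank ℂ (LinearMap.range (rsp (Ash L) S)) := (rsp_rank _ _).symm
  have hL : rkL ℂ L (S : Set σ) = Module.finrank ℂ (LinearMap.range (rsp L S)) := (rsp_rank _ _).symm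
  have hle : LinearMap.range (rsp (Ash L) S) ≤ LinearMap.range (rsp L S) := by
    rintro _ ⟨x, rfl⟩
    refine ⟨Fin.cons 0 x, ?_⟩
    rw [rsp_cons]; simp
  rw [hA, hL]
  constructor
  · intro h
    rw [Submodule.eq_of_le_of_finrank_eq hle h]
    refine ⟨Fin.cons 1 0, ?_⟩
    rw [rsp_cons]
    have : (fun k : Fin m => (Fin.cons 1 0 : Fin (m+1) → ℂ) k.succ) = 0 := by funext k; simp
    rw [this, map_zero]; simp
  · intro h
    have : LinearMap.range (rsp L S) ≤ LinearMap.range (rsp (Ash L) S) := by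
      rintro _ ⟨w, rfl⟩
      rw [rsp_cons]
      exact Submodule.add_mem _ (Submodule.smul_mem _ _ h) ⟨_, rfl⟩
    rw [le_antisymm hle this]

lemma rsp_dual {ρ : Type} [Fintype ρ] [DecidableEq ρ] (M : Matrix ρ σ ℂ) (S : Finset σ) (t : σ → ℂ)
    (h : ∀ c : σ → ℂ, (∀ r, ∑ i ∈ S, c i * M r i = 0) → ∑ i ∈ S, c i * t i = 0) :
    ∃ w : ρ → ℂ, ∀ i ∈ S, t i = ∑ r, w r * M r i := by
  let t' : σ → ℂ := fun i => if i ∈ S then t i else 0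
  have key : t' ∈ LinearMap.range (rsp M S) := by
    by_contra hcon
    obtain ⟨f, hf, hle⟩ := Submodule.exists_le_ker_of_notMem hcon
    apply hf
    let c : σ → ℂ := fun i => f fun j => if i = j then 1 else 0
    have hc : ∀ x, f x = ∑ i, c i * x i := fun x => by
      rw [LinearMap.pi_apply_eq_sum_univ f]
      exact Finset.sum_congr rfl fun i _ => by rw [smul_eq_mul, mul_comm]
    have hc' : ∀ g : σ → ℂ, ∑ i, c i * (if i ∈ S then g i else 0) = ∑ i ∈ S, c i * g i := fun g => by
      simp [mul_ite]
    rw [hc, hc']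
    apply h
    intro r
    have := hle ⟨Pi.single r 1, rfl⟩
    rw [LinearMap.mem_ker, hc] at this
    simp only [rsp_apply] at this
    rw [hc'] at this
    rw [← this]
    refine Finset.sum_congr rfl fun i _ => ?_
    simp [Pi.single_apply]
  obtain ⟨w, hw⟩ := key
  refine ⟨w, fun i hi => ?_⟩
  have := congrFun hw i
  simp only [rsp_apply, t', if_pos hi] at this
  exact this.symm

lemma recip_of_van (L : Matrix (Fin (m+1)) σ ℂ) (S : Finset σ) (y : σ → ℂ) (hy : ∀ i ∈ S, y i ≠ 0)
    (Z : Set (σ → ℂ)) (hyZ : y ∈ zarClosure ℂ Z)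
    (hZ : ∀ z ∈ Z, ∃ (c : ℂ) (x : Fin m → ℂ), ∀ i ∈ S, ell ℂ L x i ≠ 0 ∧ z i = c / ell ℂ L x i) :
    ∃ w : Fin (m+1) → ℂ, ∀ i ∈ S, (y i)⁻¹ = ∑ r, w r * L r i := by
  refine rsp_dual L S (fun i => (y i)⁻¹) fun c hc => ?_
  have h := hyZ (∑ i ∈ S, MvPolynomial.C (c i) * ∏ k ∈ S.erase i, MvPolynomial.X k) (by
    intro z hz
    obtain ⟨c0, x, hx⟩ := hZ z hz
    simp only [map_sum, map_mul, map_prod, MvPolynomial.eval_C, MvPolynomial.eval_X]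
    by_cases hS : S = ∅
    · subst hS; simp
    have h1 : ∀ i ∈ S, c i * ∏ k ∈ S.erase i, z k =
        (c i * ell ℂ L x i) * (c0 ^ (S.card - 1) * ∏ k ∈ S, (ell ℂ L x k)⁻¹) := by
      intro i hi
      have h2 : ∏ k ∈ S.erase i, z k = c0 ^ (S.card - 1) * ∏ k ∈ S.erase i, (ell ℂ L x k)⁻¹ := by
        rw [Finset.prod_congr rfl fun k hk => (hx k (Finset.mem_of_mem_erase hk)).2]
        simp only [div_eq_mul_inv]
        rw [Finset.prod_mul_distrib, Finset.prod_const, Finset.card_erase_of_mem hi]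
      rw [h2, ← Finset.mul_prod_erase _ _ hi]
      have := (hx i hi).1
      field_simp
    rw [Finset.sum_congr rfl h1, ← Finset.sum_mul]
    have h3 : ∑ i ∈ S, c i * ell ℂ L x i = 0 := by
      have h4 : ∀ i, c i * ell ℂ L x i = c i * L 0 i + ∑ j : Fin m, x j * (c i * L j.succ i) := by
        intro i
        rw [ell, mul_add, Finset.mul_sum]
        congr 1
        exact Finset.sum_congr rfl fun j _ => by ring
      simp only [h4]
      rw [Finset.sum_add_distrib, hc 0, Finset.sum_comm, zero_add]
      refine Finset.sum_eq_zero fun j _ => ?_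
      rw [← Finset.mul_sum, hc j.succ, mul_zero]
    rw [h3, zero_mul])
  simp only [map_sum, map_mul, map_prod, MvPolynomial.eval_C, MvPolynomial.eval_X] at h
  have h5 : ∀ i ∈ S, c i * ∏ k ∈ S.erase i, y k = (∏ k ∈ S, y k) * (c i * (y i)⁻¹) := by
    intro i hi
    rw [← Finset.mul_prod_erase _ _ hi]
    have := hy i hi
    field_simp
  rw [Finset.sum_congr rfl h5, ← Finset.mul_sum] at h
  exact (mul_eq_zero.1 h).resolve_left (Finset.prod_ne_zero_iff.2 hy)

/-- The stratum of solutions. -/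
def Str (L : Matrix (Fin (m+1)) σ ℂ) (S : Finset σ) (u : σ → ℂ) : Set (Pn σ) :=
  {p | p ∈ LuSet L u ∧ p ∈ Ustratum (S : Set σ) ∧ ∃ w : Fin (m+1) → ℂ, ∀ i ∈ S, (p.rep i)⁻¹ = ∑ r, w r * L r i}

lemma str_of_sub (L : Matrix (Fin (m+1)) σ ℂ) (S : Finset σ) (u : σ → ℂ) :
    LuSet L u ∩ RLsubOpen L (S : Set σ) ⊆ Str L S u := by
  rintro p ⟨h1, h2, h3⟩
  refine ⟨h1, h3, recip_of_van L S p.rep (fun i hi => (h3 i).2 hi) _ h2 ?_⟩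
  rintro z ⟨c, x, hx, rfl⟩
  refine ⟨c, x, fun i hi => ⟨hx i hi, ?_⟩⟩
  rw [Set.indicator_of_mem (show i ∈ (S : Set σ) from hi)]

lemma str_of_RL (L : Matrix (Fin (m+1)) σ ℂ) (u : σ → ℂ) :
    LuSet L u ∩ RL L ⊆ ⋃ S : Finset σ, Str L S u := by
  rintro p ⟨h1, h2⟩
  classical
  rw [Set.mem_iUnion]
  let S : Finset σ := Finset.univ.filter fun i => p.rep i ≠ 0
  have hS : ∀ i, p.rep i ≠ 0 ↔ i ∈ S := fun i => by simp [S]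
  refine ⟨S, h1, hS, recip_of_van L S p.rep (fun i hi => (hS i).2 hi) _ h2 ?_⟩
  rintro z ⟨c, x, hx, rfl⟩
  exact ⟨c, x, fun i hi => ⟨hx i, rfl⟩⟩

lemma str_nonempty {L : Matrix (Fin (m+1)) σ ℂ} {S : Finset σ} {u : σ → ℂ} {p : Pn σ} (hp : p ∈ Str L S u) :
    S.Nonempty := by
  by_contra h
  rw [Finset.not_nonempty_iff_eq_empty] at h
  subst h
  apply p.rep_nonzero
  funext i
  by_contra hi
  exact absurd ((hp.2.1 i).1 hi) (by simp)

lemma str_Lu {L : Matrix (Fin (m+1)) σ ℂ} {S : Finset σ} {u : σ → ℂ} {y : σ → ℂ} (hy : ∀ i, y i ≠ 0 → i ∈ S)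
    (k : Fin m) : ∑ i : σ, L k.succ i * u i * y i = ∑ i ∈ S, L k.succ i * u i * y i := by
  symm
  apply Finset.sum_subset (Finset.subset_univ S)
  intro i _ hi
  by_contra hne
  exact hi (hy i fun h => hne (by rw [h, mul_zero]))

/-- pairing -/
lemma str_pair {L : Matrix (Fin (m+1)) σ ℂ} {S : Finset σ} {u : σ → ℂ} {p : Pn σ} (hp : p ∈ Str L S u)
    (x : Fin m → ℂ) : ∑ i ∈ S, u i * p.rep i * ∑ k, x k * L k.succ i = 0 := by
  have h1 : ∀ k : Fin m, ∑ i ∈ S, L k.succ i * u i * p.rep i = 0 := fun k => by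
    rw [← str_Lu (fun i hi => (hp.2.1 i).1 hi)]; exact hp.1 k
  simp only [Finset.mul_sum]
  rw [Finset.sum_comm]
  refine Finset.sum_eq_zero fun k _ => ?_
  rw [← mul_zero (x k), ← h1 k, Finset.mul_sum]
  exact Finset.sum_congr rfl fun i _ => by ring

lemma str_w0 {L : Matrix (Fin (m+1)) σ ℂ} {S : Finset σ} {u : σ → ℂ} {p : Pn σ} (hp : p ∈ Str L S u)
    (w : Fin (m+1) → ℂ) (hw : ∀ i ∈ S, (p.rep i)⁻¹ = ∑ r, w r * L r i) :
    ∑ i ∈ S, u i = w 0 * ∑ i ∈ S, u i * p.rep i * L 0 i := by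
  have h := str_pair hp (fun k => w k.succ)
  rw [Finset.mul_sum, ← sub_eq_zero, ← Finset.sum_sub_distrib, ← h]
  refine Finset.sum_congr rfl fun i hi => ?_
  have h1 := hw i hi
  rw [Fin.sum_univ_succ] at h1
  have h2 : ∑ k : Fin m, w k.succ * L k.succ i = (p.rep i)⁻¹ - w 0 * L 0 i := by rw [h1]; ring
  have hne : p.rep i ≠ 0 := (hp.2.1 i).2 hi
  rw [h2]
  field_simp

lemma str_empty (L : Matrix (Fin (m+1)) σ ℂ) (S : Finset σ) (u : σ → ℂ)
    (hu : ∀ B : Finset σ, B.Nonempty → ∑ i ∈ B, u i ≠ 0)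
    (hb : b0 L S ∈ LinearMap.range (rsp (Ash L) S)) : Str L S u = ∅ := by
  ext p
  simp only [Set.mem_empty_iff_false, iff_false]
  intro hp
  obtain ⟨w, hw⟩ := hp.2.2
  apply hu S (str_nonempty hp)
  rw [str_w0 hp w hw]
  obtain ⟨x, hx⟩ := hb
  have h := str_pair hp x
  have h2 : ∑ i ∈ S, u i * p.rep i * L 0 i = 0 := by
    rw [← h]
    refine Finset.sum_congr rfl fun i hi => ?_
    have := congrFun hx i
    simp only [rsp_apply, b0, if_pos hi] at this
    rw [← this]; rfl
  rw [h2, mul_zero]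

end assembly

end

section
open CategoryTheory AlgebraicTopology
set_option linter.unusedSectionVars false

section assembly2
open Topology
variable {σ : Type} [Fintype σ] [DecidableEq σ] {m : ℕ}

/-- the space `ℂ^d / K_I` -/
abbrev VI (L : Matrix (Fin (m+1)) σ ℂ) (S : Finset σ) : Submodule ℂ (σ → ℂ) := LinearMap.range (rsp (Ash L) S)

def aI (L : Matrix (Fin (m+1)) σ ℂ) (S : Finset σ) (i : σ) : VI L S →L[ℂ] ℂ :=
  (ContinuousLinearMap.proj (R := ℂ) (φ := fun _ : σ => ℂ) i).comp (VI L S).subtypeL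

lemma aI_apply (L : Matrix (Fin (m+1)) σ ℂ) (S : Finset σ) (i : σ) (v : VI L S) : aI L S i v = (v : σ → ℂ) i := rfl

def bI (L : Matrix (Fin (m+1)) σ ℂ) : σ → ℂ := fun i => L 0 i

lemma VI_off (L : Matrix (Fin (m+1)) σ ℂ) (S : Finset σ) (v : VI L S) {i : σ} (hi : i ∉ S) : (v : σ → ℂ) i = 0 := by
  obtain ⟨x, hx⟩ := v.2
  rw [← hx, rsp_apply, if_neg hi]

lemma aI_ess (L : Matrix (Fin (m+1)) σ ℂ) (S : Finset σ) (v : VI L S) (h : ∀ i ∈ S, aI L S i v = 0) : v = 0 := by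
  apply Subtype.ext
  funext i
  by_cases hi : i ∈ S
  · exact h i hi
  · exact VI_off L S v hi

def prI (L : Matrix (Fin (m+1)) σ ℂ) (S : Finset σ) : (Fin m → ℂ) →ₗ[ℂ] VI L S := (rsp (Ash L) S).rangeRestrict

lemma prI_apply (L : Matrix (Fin (m+1)) σ ℂ) (S : Finset σ) (x : Fin m → ℂ) {i : σ} (hi : i ∈ S) :
    ((prI L S x : VI L S) : σ → ℂ) i = ∑ k, x k * L k.succ i := by
  show rsp (Ash L) S x i = _
  rw [rsp_apply, if_pos hi]; rfl

lemma prI_ell (L : Matrix (Fin (m+1)) σ ℂ) (S : Finset σ) (x : Fin m → ℂ) {i : σ} (hi : i ∈ S) :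
    aI L S i (prI L S x) + bI L i = ell ℂ L x i := by
  rw [aI_apply, prI_apply L S x hi, ell, bI, add_comm]

lemma quot_char {X Y : Type} [TopologicalSpace X] [TopologicalSpace Y] (f : C(X, Y)) (hf : IsQuotientMap f)
    (s : Setoid X) (hs : s = Setoid.ker f) : eulerChar (Quotient s) = eulerChar Y := by
  subst hs
  exact (FH_homeo hf.homeomorph).2

lemma XI_char (L : Matrix (Fin (m+1)) σ ℂ) (S : Finset σ) :
    eulerChar (XI L (S : Set σ)) = eulerChar (AX S (aI L S) (bI L)) := by
  have hpre : prI L S ⁻¹' (AX S (aI L S) (bI L)) = subComplement L (S : Set σ) := by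
    ext x
    refine forall₂_congr fun i hi => ?_
    rw [prI_ell L S x hi]
  have hc : Continuous (prI L S) := (prI L S).continuous_of_finiteDimensional
  have hs : Function.Surjective (prI L S) := LinearMap.surjective_rangeRestrict _
  have ho : IsOpenMap (prI L S) := LinearMap.isOpenMap_of_finiteDimensional _ hs
  let f : C(subComplement L (S : Set σ), AX S (aI L S) (bI L)) :=
    ⟨fun x => ⟨prI L S x, hpre.symm.subset x.2⟩, by
      exact (hc.comp continuous_subtype_val).subtype_mk _⟩
  have hso : IsOpen (subComplement L (S : Set σ)) := by
    rw [← hpre]; exact AX_open.preimage hc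
  have hfo : IsOpenMap f := by
    intro U hU
    obtain ⟨U', hU', rfl⟩ := hU
    have : f '' (Subtype.val ⁻¹' U') = Subtype.val ⁻¹' (prI L S '' (U' ∩ subComplement L (S : Set σ))) := by
      ext z
      constructor
      · rintro ⟨x, hx, rfl⟩
        exact ⟨x, ⟨hx, x.2⟩, rfl⟩
      · rintro ⟨x, ⟨hx1, hx2⟩, hxz⟩
        exact ⟨⟨x, hx2⟩, hx1, Subtype.ext hxz⟩
    rw [this]
    exact (ho _ (hU'.inter hso)).preimage continuous_subtype_val
  have hfs : Function.Surjective f := by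
    rintro ⟨z, hz⟩
    obtain ⟨x, rfl⟩ := hs z
    have : x ∈ prI L S ⁻¹' (AX S (aI L S) (bI L)) := hz
    rw [hpre] at this
    exact ⟨⟨x, this⟩, rfl⟩
  refine quot_char f (hfo.isQuotientMap f.continuous hfs) (XIsetoid L (S : Set σ)) ?_
  ext x y
  rw [Setoid.ker_def]
  constructor
  · intro h
    apply Subtype.ext
    apply Subtype.ext
    funext i
    show ((prI L S x : VI L S) : σ → ℂ) i = ((prI L S y : VI L S) : σ → ℂ) i
    by_cases hi : i ∈ S
    · rw [prI_apply _ _ _ hi, prI_apply _ _ _ hi]; exact h i hi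
    · rw [VI_off _ _ _ hi, VI_off _ _ _ hi]
  · intro h i hi
    have hi : i ∈ S := hi
    have h2 : prI L S x = prI L S y := congrArg Subtype.val h
    rw [← prI_apply L S x hi, ← prI_apply L S y hi, h2]

/-- the reciprocal vector -/
def recv (L : Matrix (Fin (m+1)) σ ℂ) (S : Finset σ) (z : VI L S) : σ → ℂ :=
  fun i => if i ∈ S then (aI L S i z + bI L i)⁻¹ else 0

lemma recv_ne (L : Matrix (Fin (m+1)) σ ℂ) (S : Finset σ) (hS : S.Nonempty) {z : VI L S}
    (hz : z ∈ AX S (aI L S) (bI L)) : recv L S z ≠ 0 := by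
  obtain ⟨i, hi⟩ := hS
  intro h
  have := congrFun h i
  simp only [recv, if_pos hi, Pi.zero_apply, inv_eq_zero] at this
  exact hz i hi this

lemma rep_eq {p : Pn σ} {y : σ → ℂ} (hy : y ≠ 0) (h : p = Projectivization.mk ℂ y hy) :
    ∃ c : ℂ, c ≠ 0 ∧ p.rep = c • y := by
  have h1 := p.mk_rep
  rw [h] at h1 ⊢
  rw [Projectivization.mk_eq_mk_iff'] at h1
  obtain ⟨c, hc⟩ := h1
  refine ⟨c, fun h0 => ?_, hc.symm⟩
  rw [h0, zero_smul] at hc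
  exact (Projectivization.rep_nonzero _) hc.symm

lemma crit_iff (L : Matrix (Fin (m+1)) σ ℂ) (S : Finset σ) (u : σ → ℂ) (z : VI L S) :
    z ∈ Crit S (aI L S) (bI L) u ↔ z ∈ AX S (aI L S) (bI L) ∧
      ∀ k : Fin m, ∑ i : σ, L k.succ i * u i * recv L S z i = 0 := by
  refine and_congr_right fun hz => ?_
  have hoff : ∀ i, recv L S z i ≠ 0 → i ∈ S := fun i h => by
    by_contra hi
    exact h (by simp [recv, hi])
  simp only [str_Lu hoff]
  have hk : ∀ k : Fin m, ∑ i ∈ S, L k.succ i * u i * recv L S z i =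
      ∑ i ∈ S, u i * aI L S i (prI L S (Pi.single k 1)) / (aI L S i z + bI L i) := by
    intro k
    refine Finset.sum_congr rfl fun i hi => ?_
    rw [aI_apply _ _ _ (prI L S _), prI_apply _ _ _ hi]
    simp [recv, hi, Pi.single_apply]
    ring
  constructor
  · intro h k
    rw [hk]; exact h _
  · intro h v
    obtain ⟨x, hx⟩ := LinearMap.surjective_rangeRestrict (rsp (Ash L) S) v
    have hx : prI L S x = v := hx
    have h3 : ∀ i ∈ S, u i * aI L S i v / (aI L S i z + bI L i) = ∑ k, x k * (L k.succ i * u i * recv L S z i) := by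
      intro i hi
      rw [← hx, aI_apply _ _ _ (prI L S x), prI_apply _ _ _ hi, Finset.mul_sum, Finset.sum_div]
      refine Finset.sum_congr rfl fun k _ => ?_
      simp [recv, hi]
      ring
    rw [Finset.sum_congr rfl h3, Finset.sum_comm]
    refine Finset.sum_eq_zero fun k _ => ?_
    rw [← Finset.mul_sum, h k, mul_zero]

/-- the map from critical points to projective space -/
def psi (L : Matrix (Fin (m+1)) σ ℂ) (S : Finset σ) (hS : S.Nonempty) (u : σ → ℂ)
    (z : Crit S (aI L S) (bI L) u) : Pn σ := Projectivization.mk ℂ (recv L S z) (recv_ne L S hS z.2.1)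

lemma psi_mem (L : Matrix (Fin (m+1)) σ ℂ) (S : Finset σ) (hS : S.Nonempty) (u : σ → ℂ)
    (z : Crit S (aI L S) (bI L) u) : psi L S hS u z ∈ LuSet L u ∩ RLsubOpen L (S : Set σ) := by
  obtain ⟨c, hc, hrep⟩ := rep_eq (recv_ne L S hS z.2.1) (p := psi L S hS u z) rfl
  have hz := (crit_iff L S u z).1 z.2
  refine ⟨fun k => ?_, ?_, fun i => ?_⟩
  · rw [hrep]
    have : ∑ i, L k.succ i * u i * (c • recv L S z) i = c * ∑ i, L k.succ i * u i * recv L S z i := by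
      rw [Finset.mul_sum]
      exact Finset.sum_congr rfl fun i _ => by simp; ring
    rw [this, hz.2 k, mul_zero]
  · intro f hf
    apply hf
    obtain ⟨x, hx⟩ := LinearMap.surjective_rangeRestrict (rsp (Ash L) S) z.1
    have hx : prI L S x = z.1 := hx
    refine ⟨c, x, fun i hi => ?_, ?_⟩
    · rw [← prI_ell L S x hi, hx]; exact hz.1 i hi
    · rw [hrep]
      funext i
      by_cases hi : i ∈ S
      · rw [Set.indicator_of_mem (show i ∈ (S : Set σ) from hi), ← prI_ell L S x hi, hx]
        simp [recv, hi, div_eq_mul_inv]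
      · rw [Set.indicator_of_notMem (show i ∉ (S : Set σ) from hi)]
        simp [recv, hi]
  · rw [hrep]
    by_cases hi : i ∈ S
    · have := hz.1 i hi
      simp [recv, hi, hc, this]
    · simp [recv, hi]

lemma psi_inj (L : Matrix (Fin (m+1)) σ ℂ) (S : Finset σ) (hS : S.Nonempty) (u : σ → ℂ)
    (hb : b0 L S ∉ LinearMap.range (rsp (Ash L) S)) : Function.Injective (psi L S hS u) := by
  intro z z' h
  rw [psi, psi, Projectivization.mk_eq_mk_iff'] at h
  obtain ⟨c, hc⟩ := h
  have h1 : ∀ i ∈ S, aI L S i z' + bI L i = c * (aI L S i z + bI L i) := by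
    intro i hi
    have h2 := congrFun hc i
    simp only [Pi.smul_apply, recv, if_pos hi, smul_eq_mul] at h2
    have e1 := z.2.1 i hi
    have e2 := z'.2.1 i hi
    field_simp at h2
    linear_combination -h2
  have hc1 : c = 1 := by
    by_contra hne
    apply hb
    have hne' : c - 1 ≠ 0 := sub_ne_zero.2 hne
    have : b0 L S = (((c - 1)⁻¹ • ((z' : VI L S) - c • (z : VI L S)) : VI L S) : σ → ℂ) := by
      funext i
      by_cases hi : i ∈ S
      · have h3 := h1 i hi
        rw [aI_apply, aI_apply] at h3
        simp only [b0, if_pos hi, Submodule.coe_smul, Submodule.coe_sub, Pi.smul_apply, Pi.sub_apply, smul_eq_mul]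
        rw [eq_inv_mul_iff_mul_eq₀ hne']
        have : bI L i = L 0 i := rfl
        rw [← this]
        linear_combination -h3
      · rw [VI_off L S _ hi]
        simp [b0, hi]
    rw [this]
    exact Subtype.mem _
  apply Subtype.ext
  apply Subtype.ext
  funext i
  by_cases hi : i ∈ S
  · have h3 := h1 i hi
    rw [hc1, one_mul] at h3
    exact (add_right_cancel h3).symm
  · rw [VI_off L S _ hi, VI_off L S _ hi]

lemma psi_surj (L : Matrix (Fin (m+1)) σ ℂ) (S : Finset σ) (hS : S.Nonempty) (u : σ → ℂ)
    (hu : ∀ B : Finset σ, B.Nonempty → ∑ i ∈ B, u i ≠ 0) : Str L S u ⊆ Set.range (psi L S hS u) := by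
  intro p hp
  obtain ⟨w, hw⟩ := hp.2.2
  have hw0 : w 0 ≠ 0 := by
    intro h
    apply hu S hS
    rw [str_w0 hp w hw, h, zero_mul]
  let x : Fin m → ℂ := fun k => (w 0)⁻¹ * w k.succ
  have hx : ∀ i ∈ S, (p.rep i)⁻¹ = w 0 * ell ℂ L x i := by
    intro i hi
    rw [hw i hi, Fin.sum_univ_succ, ell, mul_add, Finset.mul_sum]
    congr 1
    refine Finset.sum_congr rfl fun k _ => ?_
    simp only [x]
    field_simp
  have hne : ∀ i ∈ S, p.rep i ≠ 0 := fun i hi => (hp.2.1 i).2 hi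
  have hell : ∀ i ∈ S, ell ℂ L x i ≠ 0 := by
    intro i hi h
    have := hx i hi
    rw [h, mul_zero, inv_eq_zero] at this
    exact hne i hi this
  have hAX : prI L S x ∈ AX S (aI L S) (bI L) := fun i hi => by
    rw [prI_ell L S x hi]; exact hell i hi
  have hrec : recv L S (prI L S x) = w 0 • p.rep := by
    funext i
    by_cases hi : i ∈ S
    · simp only [recv, if_pos hi, Pi.smul_apply, smul_eq_mul]
      rw [prI_ell L S x hi]
      have h1 := hx i hi
      have h2 := hell i hi
      have h3 := hne i hi
      field_simp at h1 ⊢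
      linear_combination h1
    · have : p.rep i = 0 := by
        by_contra h
        exact hi ((hp.2.1 i).1 h)
      simp [recv, hi, this]
  refine ⟨⟨prI L S x, (crit_iff L S u _).2 ⟨hAX, fun k => ?_⟩⟩, ?_⟩
  · rw [hrec]
    have : ∑ i, L k.succ i * u i * (w 0 • p.rep) i = w 0 * ∑ i, L k.succ i * u i * p.rep i := by
      rw [Finset.mul_sum]
      exact Finset.sum_congr rfl fun i _ => by simp; ring
    rw [this, hp.1 k, mul_zero]
  · rw [psi]
    conv_rhs => rw [← p.mk_rep]
    rw [Projectivization.mk_eq_mk_iff']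
    exact ⟨w 0, hrec.symm⟩

lemma str_card (L : Matrix (Fin (m+1)) σ ℂ) (S : Finset σ) (hS : S.Nonempty) (u : σ → ℂ)
    (hu : ∀ B : Finset σ, B.Nonempty → ∑ i ∈ B, u i ≠ 0)
    (hb : b0 L S ∉ LinearMap.range (rsp (Ash L) S)) (N : ℕ) (hN : GoodCount S (aI L S) (bI L) N u) :
    LuSet L u ∩ RLsubOpen L (S : Set σ) = Str L S u ∧ (Str L S u).encard = N := by
  have h1 : Set.range (psi L S hS u) ⊆ LuSet L u ∩ RLsubOpen L (S : Set σ) := by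
    rintro _ ⟨z, rfl⟩; exact psi_mem L S hS u z
  have h2 := str_of_sub L S u
  have h3 := psi_surj L S hS u hu
  refine ⟨h2.antisymm (h3.trans h1), ?_⟩
  have h4 : Str L S u = Set.range (psi L S hS u) := h3.antisymm (h1.trans h2)
  rw [h4, ← Set.image_univ, (psi_inj L S hS u hb).encard_image, Set.encard_univ]
  exact hN.1

end assembly2

theorem flat_main
    {d n : ℕ} (L : Matrix (Fin (d+1)) (Fin (n+1)) ℂ) :
    Generically (fun u : Fin (n+1) → ℂ =>
      (LuSet L u ∩ RL L).Finite ∧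
      ∀ I : Set (Fin (n+1)), IsFlat ℂ L I →
        (rkA ℂ L I = rkL ℂ L I → LuSet L u ∩ RLsubOpen L I = ∅) ∧
        (rkA ℂ L I + 1 = rkL ℂ L I →
          (LuSet L u ∩ RLsubOpen L I).Finite ∧
          ((LuSet L u ∩ RLsubOpen L I).ncard : ℤ)
            = (-1) ^ (rkA ℂ L I) * eulerChar (XI L I))) := by
  have hmain : ∀ S : Finset (Fin (n+1)), MainClaim (VI L S) S (aI L S) (bI L) := fun S =>
    main_induct S.card (VI L S) S (aI L S) (bI L) rfl (aI_ess L S)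
  choose _ N hN hgen using hmain
  refine gen_mono (gen_and gen_sums (gen_all (P := fun S => GoodCount S (aI L S) (bI L) (N S)) hgen)) ?_
  rintro u ⟨hu, hc⟩
  have hdich : ∀ S : Finset (Fin (n+1)), b0 L S ∉ LinearMap.range (rsp (Ash L) S) →
      LuSet L u ∩ RLsubOpen L (S : Set (Fin (n+1))) = Str L S u ∧ (Str L S u).encard = N S := by
    intro S hb
    refine str_card L S ?_ u hu hb (N S) (hc S)
    rw [Finset.nonempty_iff_ne_empty]
    rintro rfl
    apply hb
    have : b0 L ∅ = 0 := by funext i; simp [b0]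
    rw [this]; exact Submodule.zero_mem _
  refine ⟨?_, fun I _ => ?_⟩
  · refine (Set.finite_iUnion fun S => ?_).subset (str_of_RL L u)
    by_cases hb : b0 L S ∈ LinearMap.range (rsp (Ash L) S)
    · rw [str_empty L S u hu hb]; exact Set.finite_empty
    · exact Set.finite_of_encard_eq_coe (hdich S hb).2
  · obtain ⟨S, rfl⟩ : ∃ S : Finset (Fin (n+1)), (S : Set (Fin (n+1))) = I :=
      ⟨(Set.toFinite I).toFinset, by simp⟩
    refine ⟨fun h => ?_, fun h => ?_⟩
    · rw [Set.eq_empty_iff_forall_notMem]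
      intro p hp
      have := str_of_sub L S u hp
      rw [str_empty L S u hu ((rk_iff L S).1 h)] at this
      exact this
    · have hb : b0 L S ∉ LinearMap.range (rsp (Ash L) S) := fun hb => by
        have := (rk_iff L S).2 hb
        omega
      obtain ⟨e1, e2⟩ := hdich S hb
      rw [e1]
      refine ⟨Set.finite_of_encard_eq_coe e2, ?_⟩
      have : (Str L S u).ncard = N S := by rw [Set.ncard, e2]; rfl
      rw [this, hN S, XI_char]
      congr 2
      exact rsp_rank (Ash L) S

end

/-- Theorem 3.3.  For `rank L = d+1` and generic `u`, the intersection
`𝕃_u ∩ ℛ_L` is finite; for a flat `I`: (i) if `rank A_I^⊤ = rank L_I` then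
`𝕃_u ∩ ℛ_{L_I}^∘ = ∅`; (ii) if `rank A_I^⊤ = rank L_I − 1` then `𝕃_u ∩ ℛ_{L_I}^∘`
consists of `(-1)^{rank A_I^⊤} ⋅ χ(X_I)` points, where `X_I = (ℂ^d ∖ 𝒜_I)/K_I`. -/
theorem flat_strata_intersection_counts
    {d n : ℕ} (L : Matrix (Fin (d+1)) (Fin (n+1)) ℂ) (hrank : L.rank = d + 1) :
    Generically (fun u : Fin (n+1) → ℂ =>
      (LuSet L u ∩ RL L).Finite ∧
      ∀ I : Set (Fin (n+1)), IsFlat ℂ L I →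
        (rkA ℂ L I = rkL ℂ L I → LuSet L u ∩ RLsubOpen L I = ∅) ∧
        (rkA ℂ L I + 1 = rkL ℂ L I →
          (LuSet L u ∩ RLsubOpen L I).Finite ∧
          ((LuSet L u ∩ RLsubOpen L I).ncard : ℤ)
            = (-1) ^ (rkA ℂ L I) * eulerChar (XI L I))) := by
  exact flat_main L

end ScatteringPaper
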